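/- Let X ⊆ P^2 be a smooth projective plane curve of degree d ≥ 3 over a field k such that there exists a line L ⊆ P^2 meeting X only at one point P, and let I be the ideal of P = k[z_{ij} : 0 ≤ i ≤ 2, j = 0,1] defining the Segre product X × P^1 ⊆ P^5. Then ara_h(I) = 4. Moreover, if k has characteristic 0, then ara(I) = ara_h(I) = 4. In particular X × P^1 is not a set-theoretic complete intersection. -/

import Mathlib

/-!
STATEMENT 8: Let `X ⊆ ℙ²` be a smooth projective plane curve of degree `d ≥ 3` over a field
`k` such that there exists a line `L ⊆ ℙ²` meeting `X` only at one point `P`, and let `I` be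
the ideal of `P = k[z_{ij} : 0 ≤ i ≤ 2, j = 0,1]` defining the Segre product `X × ℙ¹ ⊆ ℙ⁵`.
Then `ara_h(I) = 4`.  Moreover, if `k` has characteristic `0`, then `ara(I) = ara_h(I) = 4`.
In particular `X × ℙ¹` is not a set-theoretic complete intersection (its codimension in
`ℙ⁵` being `3`).

The curve is `X = V₊(F)` with `F` homogeneous of degree `d`, smooth in the sense of the
Jacobian criterion over the algebraic closure `K` of `k`; the line `L` is encoded by two
`k`-linearly independent vectors `v, w` of `k³` and the point `P` by a nonzero vector `p`
of `K³` lying on (the base change of) `L`.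
-/

open MvPolynomial

/-- The ideal of `P = k[z_{ij}]` defining the Segre product
`V₊(a) × V₊(b) ⊆ ℙ^{nm+n+m}`: the kernel of the map `z_{ij} ↦ x_i y_j (mod a,b)`. -/
noncomputable def segreIdeal (k : Type*) [Field k] (n m : ℕ)
    (a : Ideal (MvPolynomial (Fin (n+1)) k)) (b : Ideal (MvPolynomial (Fin (m+1)) k)) :
    Ideal (MvPolynomial (Fin (n+1) × Fin (m+1)) k) :=
  RingHom.ker (MvPolynomial.aeval (R := k) (fun p : Fin (n+1) × Fin (m+1) =>
    Ideal.Quotient.mk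
      (a.map (MvPolynomial.rename (Sum.inl : Fin (n+1) → Fin (n+1) ⊕ Fin (m+1)))
        ⊔ b.map (MvPolynomial.rename (Sum.inr : Fin (m+1) → Fin (n+1) ⊕ Fin (m+1))))
      (X (Sum.inl p.1) * X (Sum.inr p.2))))

/-- arithmetical rank -/
noncomputable def ara {R : Type*} [CommRing R] (I : Ideal R) : ℕ :=
  sInf {t | ∃ f : Fin t → R, (Ideal.span (Set.range f)).radical = I.radical}

/-- homogeneous arithmetical rank -/
noncomputable def araH {k : Type*} [CommRing k] {σ : Type*} (I : Ideal (MvPolynomial σ k)) : ℕ :=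
  sInf {t | ∃ f : Fin t → MvPolynomial σ k, (∀ i, ∃ d, (f i).IsHomogeneous d) ∧
    (Ideal.span (Set.range f)).radical = I.radical}

/-- smoothness of the projective hypersurface `V₊(F) ⊆ ℙⁿ` over a field `k`:
the Jacobian criterion over the algebraic closure. -/
def IsSmoothHypersurface {k : Type*} [Field k] {n : ℕ}
    (F : MvPolynomial (Fin (n+1)) k) : Prop :=
  ∀ v : Fin (n+1) → AlgebraicClosure k, v ≠ 0 →
    ¬ (MvPolynomial.eval v (F.map (algebraMap k (AlgebraicClosure k))) = 0 ∧
       ∀ i, MvPolynomial.eval v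
          ((MvPolynomial.pderiv i F).map (algebraMap k (AlgebraicClosure k))) = 0)

section PowerSeriesDlog

open PowerSeries

variable {K O : Type*} [Field K] [CommRing O] [Algebra K O]

/-- The coefficientwise extension of a derivation to power series. -/
noncomputable def coeffDeriv (D : Derivation K O O) (s : O⟦X⟧) : O⟦X⟧ :=
  PowerSeries.mk fun n => D (PowerSeries.coeff n s)

theorem coeff_coeffDeriv (D : Derivation K O O) (s : O⟦X⟧) (n : ℕ) :
    PowerSeries.coeff n (coeffDeriv D s) = D (PowerSeries.coeff n s) := by
  simp [coeffDeriv]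

theorem coeffDeriv_mul (D : Derivation K O O) (s t : O⟦X⟧) :
    coeffDeriv D (s * t) = coeffDeriv D s * t + s * coeffDeriv D t := by
  ext n
  simp only [coeff_coeffDeriv, PowerSeries.coeff_mul, map_add, map_sum, Derivation.leibniz,
      smul_eq_mul,
    ← Finset.sum_add_distrib]
  refine Finset.sum_congr rfl fun x _ => by ring

/-- The logarithmic derivative of a power series with constant coefficient `1`. -/
noncomputable def coeffDlog (D : Derivation K O O) (s : O⟦X⟧) : O⟦X⟧ :=
  coeffDeriv D s * invOfUnit s 1

theorem coeffDlog_mul_self (D : Derivation K O O) {s : O⟦X⟧} (hs : PowerSeries.constantCoeff s =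
    1) :
    coeffDlog D s * s = coeffDeriv D s := by
  rw [coeffDlog, mul_assoc, mul_comm _ s, mul_invOfUnit s 1 (by simpa using hs), mul_one]

theorem eq_of_mul_eq_of_constantCoeff {s a b : O⟦X⟧} (hs : PowerSeries.constantCoeff s = 1)
    (h : a * s = b * s) : a = b := by
  have := congrArg (· * invOfUnit s 1) h
  simpa [mul_assoc, mul_invOfUnit s 1 (by simpa using hs)] using this

theorem coeffDlog_mul (D : Derivation K O O) {s t : O⟦X⟧} (hs : PowerSeries.constantCoeff s = 1)
    (ht : PowerSeries.constantCoeff t = 1) :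
    coeffDlog D (s * t) = coeffDlog D s + coeffDlog D t := by
  refine eq_of_mul_eq_of_constantCoeff (s := s * t) (by simp [hs, ht]) ?_
  rw [coeffDlog_mul_self D (by simp [hs, ht]), coeffDeriv_mul, ← coeffDlog_mul_self D hs,
    ← coeffDlog_mul_self D ht]
  ring

theorem coeff_coeffDlog_mem (D : Derivation K O O) (S : Subalgebra K O) (M : AddSubgroup O)
    (hSM : ∀ a ∈ S, ∀ m ∈ M, a * m ∈ M) (hD : ∀ a ∈ S, D a ∈ M) {s : O⟦X⟧}
    (hs : PowerSeries.constantCoeff s = 1) (hcoeff : ∀ n, PowerSeries.coeff n s ∈ S) (n : ℕ) :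
    PowerSeries.coeff n (coeffDlog D s) ∈ M := by
  induction n using Nat.strong_induction_on with
  | _ n ih =>
    have h := congrArg (PowerSeries.coeff n) (coeffDlog_mul_self D hs)
    rw [coeff_coeffDeriv, PowerSeries.coeff_mul, Finset.Nat.sum_antidiagonal_eq_sum_range_succ_mk,
      Finset.sum_range_succ] at h
    simp only [Nat.sub_self, coeff_zero_eq_constantCoeff, hs, mul_one] at h
    rw [eq_sub_of_add_eq' h]
    refine M.sub_mem (hD _ (hcoeff n)) (M.sum_mem fun i hi => ?_)
    rw [mul_comm]
    exact hSM _ (hcoeff _) _ (ih i (Finset.mem_range.1 hi))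

theorem coeffDlog_one_sub (D : Derivation K O O) (b : O) {n : ℕ} (hn : n ≠ 0) :
    coeffDlog D (1 - PowerSeries.C b * PowerSeries.X ^ n) =
      PowerSeries.mk fun m => if n ∣ m ∧ m ≠ 0 then -(b ^ (m / n - 1) * D b) else 0 := by
  have h1 : PowerSeries.constantCoeff (1 - PowerSeries.C b * PowerSeries.X ^ n : O⟦X⟧) = 1 := by
      simp [hn]
  refine eq_of_mul_eq_of_constantCoeff h1 ?_
  rw [coeffDlog_mul_self D h1]
  ext m
  rw [coeff_coeffDeriv, mul_sub, mul_one, map_sub, map_sub, map_sub, PowerSeries.coeff_one,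
      PowerSeries.coeff_C_mul,
    mul_left_comm, PowerSeries.coeff_C_mul, coeff_mul_X_pow', PowerSeries.coeff_X_pow, coeff_mk,
        coeff_mk]
  have h10 : D (if m = 0 then 1 else 0) = 0 := by split_ifs <;> simp
  rw [h10, zero_sub]
  rcases lt_trichotomy m n with h | rfl | h
  · have h2 : ¬ (n ∣ m ∧ m ≠ 0) := fun h2 => h2.2 (Nat.eq_zero_of_dvd_of_lt h2.1 h)
    simp [h.ne, h.not_ge, h2]
  · simp [hn, Nat.div_self (Nat.pos_of_ne_zero hn)]
  · obtain ⟨l, rfl⟩ : ∃ l, m = n + l := ⟨m - n, by omega⟩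
    have hl : l ≠ 0 := by omega
    by_cases hd : n ∣ l
    · obtain ⟨c, rfl⟩ := hd
      have hn' := Nat.pos_of_ne_zero hn
      obtain ⟨c, rfl⟩ : ∃ c', c = c' + 1 := ⟨c - 1, by
        have : c ≠ 0 := by rintro rfl; simp at hl
        omega⟩
      have e1 : (n + n * (c + 1)) / n = c + 2 := by
        rw [show n + n * (c + 1) = n * (c + 2) by ring, Nat.mul_div_cancel_left _ hn']
      simp [hn, e1, Nat.mul_div_cancel_left _ hn']
      ring
    · simp [hn, hd, hl]

variable (p : ℕ) [hp : Fact p.Prime] [CharP K p]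

/-- The compatibility of `λ` with Frobenius extends from `b^{p-1} D b` to logarithmic
derivatives of power series. -/
theorem map_coeffDlog_frobenius (D : Derivation K O O) (ev : O →+ K)
    (hex : ∀ h, ev (D h) = 0)
    (hcar : ∀ g b, ev (g ^ p * b ^ (p - 1) * D b) = ev (g * D b) ^ p)
    (s : O⟦X⟧) (hs : PowerSeries.constantCoeff s = 1) (g : O) (j : ℕ) :
    ev (g ^ p * PowerSeries.coeff (p * j) (coeffDlog D s)) =
        ev (g * PowerSeries.coeff j (coeffDlog D s)) ^ p := by
  have hp0 := hp.out.pos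
  have hp1 := hp.out.one_lt
  rcases Nat.eq_zero_or_pos j with rfl | hj
  · have : PowerSeries.coeff 0 (coeffDlog D s) = 0 := by
      have h := congrArg (PowerSeries.coeff 0) (coeffDlog_mul_self D hs)
      rw [coeff_coeffDeriv] at h
      simpa [hs] using h
    simp [this, hp0.ne']
  -- the elementary factors
  have key : ∀ (b : O) (n : ℕ), n ≠ 0 →
      ev (g ^ p * PowerSeries.coeff (p * j) (coeffDlog D (1 - PowerSeries.C b * PowerSeries.X ^ n)))
          =
        ev (g * PowerSeries.coeff j (coeffDlog D (1 - PowerSeries.C b * PowerSeries.X ^ n))) ^ p :=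
            by
    intro b n hn
    have hn' := Nat.pos_of_ne_zero hn
    rw [coeffDlog_one_sub D b hn, coeff_mk, coeff_mk]
    by_cases hnj : n ∣ j
    · obtain ⟨c, rfl⟩ := hnj
      obtain ⟨c, rfl⟩ : ∃ c', c = c' + 1 := ⟨c - 1, by
        have : c ≠ 0 := by rintro rfl; simp at hj
        omega⟩
      have e1 : p * (n * (c + 1)) / n - 1 = p * c + (p - 1) := by
        rw [show p * (n * (c + 1)) = n * (p * c + p) by ring, Nat.mul_div_cancel_left _ hn']
        omega
      have e2 : n * (c + 1) / n - 1 = c := by rw [Nat.mul_div_cancel_left _ hn']; omega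
      rw [if_pos ⟨⟨p * (c + 1), by ring⟩, by positivity⟩, if_pos ⟨⟨c + 1, rfl⟩, by positivity⟩,
        e1, e2]
      have h := hcar (g * b ^ c) b
      have hneg : ∀ y : K, (-y) ^ p = -(y ^ p) := fun y => by
        simpa [frobenius_def] using (frobenius K p).map_neg y
      rw [mul_neg, mul_neg, map_neg, map_neg, hneg, pow_add, pow_mul]
      rw [mul_pow, mul_assoc g] at h
      rw [← h]
      congr 2
      ring
    · rw [if_neg (show ¬ (n ∣ j ∧ j ≠ 0) from fun h => hnj h.1), mul_zero, map_zero,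
        zero_pow hp0.ne']
      split_ifs with h
      · obtain ⟨⟨c, hc⟩, -⟩ := h
        have hc0 : c ≠ 0 := by
          rintro rfl
          have : p * j ≠ 0 := by positivity
          simp [hc] at this
        have hpc : ¬ p ∣ c := by
          rintro ⟨c', rfl⟩
          apply hnj
          refine ⟨c', ?_⟩
          have : p * j = p * (n * c') := by rw [hc]; ring
          exact Nat.eq_of_mul_eq_mul_left hp0 this
        rw [hc, Nat.mul_div_cancel_left _ hn']
        have h0 := hex (g ^ p * b ^ c)
        have hchar : CharP O p ∨ Subsingleton O := by
          rcases subsingleton_or_nontrivial O with h | h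
          · exact Or.inr h
          · exact Or.inl (charP_of_injective_algebraMap (algebraMap K O).injective p)
        have hgp : D (g ^ p) = 0 := by
          rcases hchar with h | h
          · rw [Derivation.leibniz_pow]
            simp
          · exact Subsingleton.elim _ _
        rw [Derivation.leibniz, hgp, smul_zero, add_zero, Derivation.leibniz_pow, smul_comm,
          map_nsmul, nsmul_eq_mul, mul_eq_zero] at h0
        rcases h0 with h0 | h0
        · exact absurd ((CharP.cast_eq_zero_iff K p c).1 h0) hpc
        · rw [mul_neg, map_neg, neg_eq_zero]
          simpa [smul_eq_mul] using h0
      · simp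
  -- descending induction on the order of `s - 1`
  have main : ∀ (m n : ℕ), n ≠ 0 → p * j + 1 ≤ n + m → ∀ s : O⟦X⟧, PowerSeries.X ^ n ∣ s - 1 →
      ev (g ^ p * PowerSeries.coeff (p * j) (coeffDlog D s)) =
          ev (g * PowerSeries.coeff j (coeffDlog D s)) ^ p := by
    intro m
    induction m with
    | zero =>
      intro n hn hle s hdvd
      have h : ∀ i, i < n → PowerSeries.coeff i (coeffDlog D s) = 0 := by
        have : PowerSeries.X ^ n ∣ coeffDeriv D s := by
          rw [X_pow_dvd_iff] at hdvd ⊢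
          intro i hi
          have := hdvd i hi
          rw [map_sub, sub_eq_zero] at this
          rw [coeff_coeffDeriv, this, PowerSeries.coeff_one]
          split_ifs <;> simp
        exact X_pow_dvd_iff.1 (this.mul_right _)
      have hjp : j ≤ p * j := Nat.le_mul_of_pos_left _ hp0
      rw [h _ (by omega), h _ (by omega)]
      simp [hp0.ne']
    | succ m ih =>
      intro n hn hle s hdvd
      have hs1 : PowerSeries.constantCoeff s = 1 := by
        have := X_pow_dvd_iff.1 hdvd 0 (Nat.pos_of_ne_zero hn)
        simpa [sub_eq_zero] using this
      set b := -PowerSeries.coeff n s with hb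
      set u : O⟦X⟧ := 1 - PowerSeries.C b * PowerSeries.X ^ n with hu
      have hu1 : PowerSeries.constantCoeff u = 1 := by simp [hu, hn]
      set v := invOfUnit u 1 with hv
      have huv : u * v = 1 := mul_invOfUnit u 1 (by simpa using hu1)
      have hv1 : PowerSeries.constantCoeff v = 1 := by
        have := congrArg PowerSeries.constantCoeff huv
        simpa [hu1] using this
      have hsplit : s = u * (s * v) := by
        rw [mul_left_comm, huv, mul_one]
      have hnext : PowerSeries.X ^ (n + 1) ∣ s * v - 1 := by
        have : s * v - 1 = (s - u) * v := by
          rw [sub_mul, huv]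
        rw [this]
        refine Dvd.dvd.mul_right ?_ _
        rw [X_pow_dvd_iff] at hdvd ⊢
        intro i hi
        rw [hu, sub_sub_eq_add_sub, add_sub_right_comm, map_add, PowerSeries.coeff_C_mul,
            PowerSeries.coeff_X_pow]
        rcases Nat.lt_succ_iff_lt_or_eq.1 hi with h | rfl
        · simp [hdvd i h, h.ne]
        · simp [hb, PowerSeries.coeff_one, hn]
      have h2 := ih (n + 1) (by omega) (by omega) _ hnext
      have h3 := key b n hn
      rw [hsplit, coeffDlog_mul D hu1 (by simp [hs1, hv1]), map_add, map_add, mul_add, mul_add,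
        map_add, map_add, h2, h3, add_pow_char]
  refine main (p * j) 1 one_ne_zero (by omega) s ?_
  rw [pow_one, X_dvd_iff]
  simp [hs]

theorem map_coeffDlog_iterateFrobenius (D : Derivation K O O) (ev : O →+ K)
    (hex : ∀ h, ev (D h) = 0)
    (hcar : ∀ g b, ev (g ^ p * b ^ (p - 1) * D b) = ev (g * D b) ^ p)
    (s : O⟦X⟧) (hs : PowerSeries.constantCoeff s = 1) (g : O) (j e : ℕ) :
    ev (g ^ p ^ e * PowerSeries.coeff (p ^ e * j) (coeffDlog D s)) =
      ev (g * PowerSeries.coeff j (coeffDlog D s)) ^ p ^ e := by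
  induction e with
  | zero => simp
  | succ e ih =>
    rw [pow_succ, pow_mul g, pow_mul (ev _), ← ih, mul_comm (p ^ e) p, mul_assoc,
      map_coeffDlog_frobenius p D ev hex hcar s hs]

end PowerSeriesDlog

section Splitting

open PowerSeries

variable {K O : Type*} [Field K] [CommRing O] [Algebra K O]

/-- If every element of `R₁₂` is a sum of elements of `R₁` and `R₂`, then `1 - tσ` factors
modulo any power of `σ` as a product of power series over `R₁` and `R₂`. -/
theorem exists_factorization_mod_X_pow {O : Type*} [CommRing O] (R₁ R₂ R₁₂ : Subring O)
    (h₁ : R₁ ≤ R₁₂) (h₂ : R₂ ≤ R₁₂)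
    (hsplit : ∀ r ∈ R₁₂, ∃ r₁ ∈ R₁, ∃ r₂ ∈ R₂, r = r₁ + r₂) (s : O⟦X⟧)
    (hs : PowerSeries.constantCoeff s = 1) (hsR : ∀ n, PowerSeries.coeff n s ∈ R₁₂) (N : ℕ) :
    ∃ s₁ s₂ : O⟦X⟧, PowerSeries.constantCoeff s₁ = 1 ∧ PowerSeries.constantCoeff s₂ = 1 ∧
      (∀ n, PowerSeries.coeff n s₁ ∈ R₁) ∧ (∀ n, PowerSeries.coeff n s₂ ∈ R₂) ∧ PowerSeries.X ^ (N +
          1) ∣ s - s₁ * s₂ := by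
  have hone : ∀ (R : Subring O) (n : ℕ), PowerSeries.coeff n (1 : O⟦X⟧) ∈ R := fun R n => by
    rw [PowerSeries.coeff_one]
    split_ifs
    exacts [R.one_mem, R.zero_mem]
  induction N with
  | zero =>
    refine ⟨1, 1, by simp, by simp, hone R₁, hone R₂, ?_⟩
    rw [zero_add, pow_one, X_dvd_iff]
    simp [hs]
  | succ N ih =>
    obtain ⟨s₁, s₂, hc₁, hc₂, hm₁, hm₂, hdvd⟩ := ih
    have hmem : PowerSeries.coeff (N + 1) (s - s₁ * s₂) ∈ R₁₂ := by
      rw [map_sub, PowerSeries.coeff_mul]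
      exact R₁₂.sub_mem (hsR _) (R₁₂.sum_mem fun i _ => R₁₂.mul_mem (h₁ (hm₁ _)) (h₂ (hm₂ _)))
    obtain ⟨r₁, hr₁, r₂, hr₂, hr⟩ := hsplit _ hmem
    have hmon : ∀ (R : Subring O) (r : O), r ∈ R → ∀ n, PowerSeries.coeff n (PowerSeries.C r *
        PowerSeries.X ^ (N + 1)) ∈ R := by
      intro R r hr n
      rw [coeff_C_mul_X_pow]
      split_ifs
      exacts [hr, R.zero_mem]
    refine ⟨s₁ + PowerSeries.C r₁ * PowerSeries.X ^ (N + 1),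
        s₂ + PowerSeries.C r₂ * PowerSeries.X ^ (N + 1), by simp [hc₁], by simp [hc₂],
      fun n => ?_, fun n => ?_, ?_⟩
    · rw [map_add]
      exact R₁.add_mem (hm₁ n) (hmon _ _ hr₁ n)
    · rw [map_add]
      exact R₂.add_mem (hm₂ n) (hmon _ _ hr₂ n)
    · obtain ⟨c, hc⟩ := hdvd
      have hcc : PowerSeries.constantCoeff c = r₁ + r₂ := by
        have := congrArg (PowerSeries.coeff (N + 1)) hc
        rw [hr, coeff_X_pow_mul'] at this
        simpa using this.symm
      have : s - (s₁ + PowerSeries.C r₁ * PowerSeries.X ^ (N + 1)) * (s₂ + PowerSeries.C r₂ *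
          PowerSeries.X ^ (N + 1)) =
          PowerSeries.X ^ (N + 1) * (c - PowerSeries.C r₁ * s₂ - PowerSeries.C r₂ *
              s₁ - PowerSeries.C r₁ * PowerSeries.C r₂ * PowerSeries.X ^ (N + 1)) := by
        linear_combination hc
      rw [this, pow_succ PowerSeries.X (N + 1)]
      refine mul_dvd_mul_left _ ?_
      rw [X_dvd_iff]
      simp [hc₁, hc₂, hcc]

variable (p : ℕ) [hp : Fact p.Prime] [CharP K p]

theorem false_of_splitting_of_frobenius [IsReduced O] (D : Derivation K O O) (ev : O →+ K)
    (O₁ O₂ : Subalgebra K O)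
    (hex : ∀ h, ev (D h) = 0)
    (hcar : ∀ g b, ev (g ^ p * b ^ (p - 1) * D b) = ev (g * D b) ^ p)
    (hD₁ : ∀ a ∈ O₁, ∀ b ∈ O₁, ev (a * D b) = 0)
    (hD₂ : ∀ a ∈ O₂, ∀ b ∈ O₂, ev (a * D b) = 0)
    (hroot₁ : ∀ a ∈ O₁, D a = 0 → ∃ b ∈ O₁, b ^ p = a)
    (hroot₂ : ∀ a ∈ O₂, D a = 0 → ∃ b ∈ O₂, b ^ p = a)
    (S : Set O) (hnd : ∀ a, (∀ g ∈ S, ev (g * a) = 0) → a = 0)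
    (R₁ R₂ R₁₂ : Subring O) (h₁ : R₁ ≤ R₁₂) (h₂ : R₂ ≤ R₁₂)
    (hR₁ : ∀ a ∈ R₁, a ∈ O₁) (hR₂ : ∀ a ∈ R₂, a ∈ O₂)
    (hsplit : ∀ r ∈ R₁₂, ∃ r₁ ∈ R₁, ∃ r₂ ∈ R₂, r = r₁ + r₂)
    (e : ℕ) (hS : ∀ g ∈ S, g ^ p ^ e ∈ R₁₂)
    (t : O) (htS : t ∈ S) (ht : ¬ ∃ a ∈ O₁, ∃ b ∈ O₂, t = a + b) : False := by
  have hp0 := hp.out.pos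
  rcases subsingleton_or_nontrivial O with hO | hO
  · exact ht ⟨0, O₁.zero_mem, 0, O₂.zero_mem, Subsingleton.elim _ _⟩
  have : CharP O p := charP_of_injective_algebraMap (algebraMap K O).injective p
  have hDp : ∀ a : O, D (a ^ p) = 0 := fun a => by
    rw [Derivation.leibniz_pow]
    simp
  have hcong : ∀ m ≤ e, ∀ N : ℕ, ∃ s₁ s₂ : O⟦X⟧, PowerSeries.constantCoeff s₁ =
      1 ∧ PowerSeries.constantCoeff s₂ = 1 ∧
      (∀ n, PowerSeries.coeff n s₁ ∈ O₁) ∧ (∀ n, PowerSeries.coeff n s₂ ∈ O₂) ∧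
      PowerSeries.X ^ (N + 1) ∣ (1 - PowerSeries.C (t ^ p ^ m) * PowerSeries.X) - s₁ * s₂ := by
    intro m hm
    induction hm using Nat.decreasingInduction with
    | self =>
      intro N
      obtain ⟨s₁, s₂, a, b, c, d, h⟩ := exists_factorization_mod_X_pow R₁ R₂ R₁₂ h₁ h₂ hsplit
        (1 - PowerSeries.C (t ^ p ^ e) * PowerSeries.X) (by simp) (fun n => by
          rw [map_sub, PowerSeries.coeff_one, PowerSeries.coeff_C_mul, PowerSeries.coeff_X]
          refine R₁₂.sub_mem ?_ (R₁₂.mul_mem (hS _ htS) ?_) <;> split_ifs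
          exacts [R₁₂.one_mem, R₁₂.zero_mem, R₁₂.one_mem, R₁₂.zero_mem]) N
      exact ⟨s₁, s₂, a, b, fun n => hR₁ _ (c n), fun n => hR₂ _ (d n), h⟩
    | of_succ m hm ih =>
      intro N
      obtain ⟨s₁, s₂, hc₁, hc₂, hm₁, hm₂, hdvd⟩ := ih (p ^ e * (N + 1))
      have hω : PowerSeries.X ^ (p ^ e * (N + 1) + 1) ∣ coeffDlog D s₁ + coeffDlog D s₂ := by
        rw [← coeffDlog_mul D hc₁ hc₂]
        refine Dvd.dvd.mul_right ?_ _
        rw [X_pow_dvd_iff] at hdvd ⊢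
        intro i hi
        have h := hdvd i hi
        rw [map_sub, sub_eq_zero] at h
        rw [coeff_coeffDeriv, ← h, map_sub, PowerSeries.coeff_one, PowerSeries.coeff_C_mul,
            PowerSeries.coeff_X, pow_succ, pow_mul]
        split_ifs <;> simp [hDp]
      have hann : ∀ (S : Subalgebra K O), (∀ a ∈ S, ∀ b ∈ S, ev (a * D b) = 0) →
          ∀ s : O⟦X⟧, PowerSeries.constantCoeff s = 1 → (∀ n, PowerSeries.coeff n s ∈ S) → ∀ a ∈ S,
              ∀ n,
          ev (a * PowerSeries.coeff n (coeffDlog D s)) = 0 := by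
        intro S hS s hs hsm a ha n
        let M : AddSubgroup O :=
          { carrier := {m | ∀ a ∈ S, ev (a * m) = 0}
            zero_mem' := by simp
            add_mem' := fun {x y} hx hy a ha => by rw [mul_add, map_add, hx a ha, hy a ha, add_zero]
            neg_mem' := fun {x} hx a ha => by rw [mul_neg, map_neg, hx a ha, neg_zero] }
        exact coeff_coeffDlog_mem D S M
          (fun a ha m hm b hb => by rw [← mul_assoc]; exact hm _ (S.mul_mem hb ha))
          (fun a ha b hb => hS b hb a ha) hs hsm n a ha
      have hzero : ∀ j ≤ N, PowerSeries.coeff j (coeffDlog D s₁) = 0 := by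
        intro j hj
        refine hnd _ fun g hg => ?_
        obtain ⟨r₁, hr₁, r₂, hr₂, hr⟩ := hsplit _ (hS g hg)
        have h := map_coeffDlog_iterateFrobenius p D ev hex hcar s₁ hc₁ g j e
        have hlt : p ^ e * j < p ^ e * (N + 1) + 1 :=
          Nat.lt_succ_of_le (Nat.mul_le_mul_left _ (by omega))
        have h12 := X_pow_dvd_iff.1 hω _ hlt
        rw [map_add, add_eq_zero_iff_eq_neg] at h12
        rw [hr, add_mul, map_add, hann O₁ hD₁ s₁ hc₁ hm₁ r₁ (hR₁ _ hr₁), h12, mul_neg, map_neg,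
          hann O₂ hD₂ s₂ hc₂ hm₂ r₂ (hR₂ _ hr₂), neg_zero, add_zero, eq_comm] at h
        exact eq_zero_of_pow_eq_zero h
      have hzero₂ : ∀ j ≤ N, PowerSeries.coeff j (coeffDlog D s₂) = 0 := by
        intro j hj
        have hlt : j < p ^ e * (N + 1) + 1 := by
          have : N + 1 ≤ p ^ e * (N + 1) := Nat.le_mul_of_pos_left _ (by positivity)
          omega
        have h12 := X_pow_dvd_iff.1 hω _ hlt
        rwa [map_add, hzero j hj, zero_add] at h12
      have hfrob : ∀ (S : Subalgebra K O), (∀ a ∈ S, D a = 0 → ∃ b ∈ S, b ^ p = a) →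
          ∀ s : O⟦X⟧, PowerSeries.constantCoeff s = 1 → (∀ n, PowerSeries.coeff n s ∈ S) →
          (∀ j ≤ N, PowerSeries.coeff j (coeffDlog D s) = 0) →
          ∃ h : O⟦X⟧, PowerSeries.constantCoeff h = 1 ∧ (∀ n, PowerSeries.coeff n h ∈ S) ∧
            PowerSeries.X ^ (N + 1) ∣ PowerSeries.map (frobenius O p) h - s := by
        intro S hS s hs hsm hz
        have hDs : ∀ j ≤ N, D (PowerSeries.coeff j s) = 0 := by
          intro j hj
          have : PowerSeries.X ^ (N + 1) ∣ coeffDeriv D s := by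
            rw [← coeffDlog_mul_self D hs]
            refine Dvd.dvd.mul_right (X_pow_dvd_iff.2 fun i hi => hz i (by omega)) _
          rw [← coeff_coeffDeriv]
          exact X_pow_dvd_iff.1 this j (by omega)
        have hex : ∀ j, ∃ b ∈ S, j ≤ N → b ^ p = PowerSeries.coeff j s := by
          intro j
          by_cases hj : j ≤ N
          · obtain ⟨b, hb, hbp⟩ := hS _ (hsm j) (hDs j hj)
            exact ⟨b, hb, fun _ => hbp⟩
          · exact ⟨0, S.zero_mem, fun h => absurd h hj⟩
        choose b hb hbp using hex
        refine ⟨PowerSeries.mk b, ?_, fun n => by simpa using hb n, ?_⟩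
        · have h0 := hbp 0 (Nat.zero_le _)
          rw [coeff_zero_eq_constantCoeff, hs] at h0
          have : frobenius O p (b 0) = frobenius O p 1 := by simpa [frobenius_def] using h0
          rw [← coeff_zero_eq_constantCoeff_apply, coeff_mk]
          exact frobenius_inj O p this
        · rw [X_pow_dvd_iff]
          intro i hi
          rw [map_sub, PowerSeries.coeff_map, coeff_mk, frobenius_def, hbp i (by omega), sub_self]
      obtain ⟨g₁, hg₁, hgm₁, hgd₁⟩ := hfrob O₁ hroot₁ s₁ hc₁ hm₁ hzero
      obtain ⟨g₂, hg₂, hgm₂, hgd₂⟩ := hfrob O₂ hroot₂ s₂ hc₂ hm₂ hzero₂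
      refine ⟨g₁, g₂, hg₁, hg₂, hgm₁, hgm₂, ?_⟩
      have hle : N + 1 ≤ p ^ e * (N + 1) + 1 := by
        have : N + 1 ≤ p ^ e * (N + 1) := Nat.le_mul_of_pos_left _ (by positivity)
        omega
      have hmap : PowerSeries.X ^ (N + 1) ∣ PowerSeries.map (frobenius O p)
          ((1 - PowerSeries.C (t ^ p ^ m) * PowerSeries.X) - g₁ * g₂) := by
        have hdvd' := (pow_dvd_pow PowerSeries.X hle).trans hdvd
        have : PowerSeries.map (frobenius O p) ((1 - PowerSeries.C (t ^ p ^ m) * PowerSeries.X)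
            - g₁ * g₂) =
            ((1 - PowerSeries.C (t ^ p ^ (m + 1)) * PowerSeries.X) - s₁ * s₂)
            - (PowerSeries.map (frobenius O p) g₁ - s₁) * PowerSeries.map (frobenius O p) g₂
            - s₁ * (PowerSeries.map (frobenius O p) g₂ - s₂) := by
          simp only [map_sub, map_mul, map_one, PowerSeries.map_C, PowerSeries.map_X, frobenius_def,
              ← pow_mul, ← pow_succ]
          ring
        rw [this]
        exact dvd_sub (dvd_sub hdvd' (hgd₁.mul_right _)) (hgd₂.mul_left _)
      rw [X_pow_dvd_iff] at hmap ⊢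
      intro i hi
      have := hmap i hi
      rw [PowerSeries.coeff_map, ← map_zero (frobenius O p)] at this
      exact frobenius_inj O p this
  obtain ⟨s₁, s₂, hc₁, hc₂, hm₁, hm₂, hdvd⟩ := hcong 0 (Nat.zero_le _) 1
  have h := X_pow_dvd_iff.1 hdvd 1 (by norm_num)
  apply ht
  refine ⟨-PowerSeries.coeff 1 s₁, O₁.neg_mem (hm₁ 1), -PowerSeries.coeff 1 s₂, O₂.neg_mem (hm₂ 1),
      ?_⟩
  rw [map_sub, map_sub, PowerSeries.coeff_C_mul, PowerSeries.coeff_mul,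
      Finset.Nat.sum_antidiagonal_eq_sum_range_succ_mk,
    Finset.sum_range_succ, Finset.sum_range_one] at h
  simp only [PowerSeries.coeff_one, coeff_one_X, pow_zero, pow_one, coeff_zero_eq_constantCoeff,
      hc₁, hc₂,
    Nat.sub_zero, Nat.sub_self, one_ne_zero, if_false, one_mul, mul_one, zero_sub] at h
  linear_combination -h

end Splitting

section PthRoots

variable {K O : Type*} [Field K] [CommRing O] [Algebra K O] (p : ℕ)

theorem exists_pow_mul_eq_zero_of_sum_eq_zero [CharP K p] (D : Derivation K O O) (u : O) (n : ℕ)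
    (hn : n ≤ p) (M : ℕ) (e : ℕ → O) (he : ∀ i, D (e i) = 0)
    (h : D u ^ M * ∑ i ∈ Finset.range n, e i * u ^ i = 0) :
    ∃ M', ∀ i < n, D u ^ M' * e i = 0 := by
  induction n generalizing M e with
  | zero => exact ⟨0, by simp⟩
  | succ n ih =>
    have hD := congrArg (fun y => D u * D y) h
    simp only [Derivation.leibniz, Derivation.leibniz_pow, map_zero, mul_zero, map_sum, he,
      smul_eq_mul, add_zero] at hD
    have h0 : D u * ((∑ i ∈ Finset.range (n + 1), e i * u ^ i) * (M • (D u ^ (M - 1) * D (D u)))) =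
        0 := by
      rcases Nat.eq_zero_or_pos M with rfl | hM
      · simp
      · rw [show D u * ((∑ i ∈ Finset.range (n + 1), e i * u ^ i) * (M • (D u ^ (M - 1) * D (D u))))
          = (D u ^ (M - 1 + 1) * ∑ i ∈ Finset.range (n + 1), e i * u ^ i) * (M • D (D u)) by
            simp only [nsmul_eq_mul, pow_succ]; ring, Nat.sub_add_cancel hM, h, zero_mul]
    have h1 : D u ^ (M + 2) * ∑ i ∈ Finset.range n, ((i + 1 : ℕ) * e (i + 1)) * u ^ i = 0 := by
      rw [mul_add, h0, add_zero, Finset.sum_range_succ'] at hD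
      rw [← hD, Finset.mul_sum, ← mul_assoc]
      simp only [zero_smul, mul_zero, add_zero, Finset.mul_sum]
      refine Finset.sum_congr rfl fun i _ => ?_
      simp only [nsmul_eq_mul, Nat.add_sub_cancel]
      ring
    obtain ⟨M', hM'⟩ := ih (by omega) (M + 2) (fun i => ((i + 1 : ℕ) : O) * e (i + 1))
      (fun i => by rw [Derivation.leibniz, he]; simp) h1
    have hpos : ∀ i < n, D u ^ M' * e (i + 1) = 0 := by
      intro i hi
      have hne : ((i + 1 : ℕ) : K) ≠ 0 := fun h0 => by
        have := Nat.le_of_dvd (by omega) ((CharP.cast_eq_zero_iff K p _).1 h0)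
        omega
      have h2 := hM' i hi
      have h3 : algebraMap K O ((i + 1 : ℕ) : K)⁻¹ * (((i + 1 : ℕ) : O)) = 1 := by
        rw [← map_natCast (algebraMap K O), ← map_mul, inv_mul_cancel₀ hne, map_one]
      calc D u ^ M' * e (i + 1)
          = (algebraMap K O ((i + 1 : ℕ) : K)⁻¹ * (((i + 1 : ℕ) : O))) * (D u ^ M' * e (i + 1)) :=
              by
            rw [h3, one_mul]
        _ = algebraMap K O ((i + 1 : ℕ) : K)⁻¹ * (D u ^ M' * (((i + 1 : ℕ) : O) * e (i + 1))) := by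
            ring
        _ = 0 := by rw [h2, mul_zero]
    refine ⟨M + M', fun i hi => ?_⟩
    rcases i with _ | i
    · rw [Finset.sum_range_succ', mul_add] at h
      have : D u ^ M' * (D u ^ M * ∑ k ∈ Finset.range n, e (k + 1) * u ^ (k + 1)) = 0 := by
        rw [Finset.mul_sum, Finset.mul_sum]
        refine Finset.sum_eq_zero fun k hk => ?_
        rw [show D u ^ M' * (D u ^ M * (e (k + 1) * u ^ (k + 1))) =
          D u ^ M * u ^ (k + 1) * (D u ^ M' * e (k + 1)) by ring, hpos k (Finset.mem_range.1 hk),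
          mul_zero]
      have h4 := congrArg (D u ^ M' * ·) h
      simp only [mul_add, this, zero_add, pow_zero, mul_one, mul_zero] at h4
      rw [pow_add, mul_comm (D u ^ M), mul_assoc, h4]
    · rw [pow_add, mul_assoc, hpos i (by omega), mul_zero]

variable [hp : Fact p.Prime]

theorem finite_frobenius_range [IsAlgClosed K] [ExpChar O p] [CharP O p] {x₁ x₂ : O}
    (hgen : Algebra.adjoin K {x₁, x₂} = ⊤) :
    Module.Finite (frobenius O p).range O := by
  have hintegral : Algebra.IsIntegral (frobenius O p).range O := ⟨fun y => by
    refine IsIntegral.of_pow hp.out.pos (?_ : IsIntegral _ (y ^ p))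
    exact isIntegral_algebraMap (x := (⟨y ^ p, y, rfl⟩ : (frobenius O p).range))⟩
  have hft : Algebra.FiniteType (frobenius O p).range O := by
    refine Subalgebra.fg_def.2 ⟨{x₁, x₂}, Set.toFinite _, ?_⟩ |> fun h => ⟨h⟩
    rw [eq_top_iff]
    intro y _
    have hy : y ∈ Algebra.adjoin K {x₁, x₂} := hgen ▸ Algebra.mem_top
    induction hy using Algebra.adjoin_induction with
    | mem x hx => exact Algebra.subset_adjoin (by simpa using hx)
    | algebraMap r =>
      obtain ⟨s, hs⟩ := IsAlgClosed.exists_pow_nat_eq r hp.out.pos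
      refine Subalgebra.algebraMap_mem _
        (⟨algebraMap K O r, algebraMap K O s, ?_⟩ : (frobenius O p).range)
      rw [frobenius_def, ← map_pow, hs]
    | add x y _ _ hx hy => exact Subalgebra.add_mem _ (hx trivial) (hy trivial)
    | mul x y _ _ hx hy => exact Subalgebra.mul_mem _ (hx trivial) (hy trivial)
  exact Algebra.IsIntegral.finite

variable [CharP K p]

theorem ker_eq_span_of_adjoin_eq_top {x₁ x₂ : O} (hgen : Algebra.adjoin K {x₁, x₂} = ⊤)
    (χ : O →ₐ[K] K) :
    RingHom.ker χ = Ideal.span {x₁ - algebraMap K O (χ x₁)} ⊔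
      Ideal.span {x₂ - algebraMap K O (χ x₂)} := by
  apply le_antisymm
  · have : ∀ y ∈ Algebra.adjoin K {x₁, x₂}, y - algebraMap K O (χ y) ∈
        Ideal.span {x₁ - algebraMap K O (χ x₁)} ⊔ Ideal.span {x₂ - algebraMap K O (χ x₂)} := by
      intro y hy
      induction hy using Algebra.adjoin_induction with
      | mem x hx =>
        rcases hx with rfl | rfl
        · exact Ideal.mem_sup_left (Ideal.mem_span_singleton_self _)
        · exact Ideal.mem_sup_right (Ideal.mem_span_singleton_self _)
      | algebraMap r => simp
      | add x y _ _ hx hy =>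
        rw [map_add, map_add, add_sub_add_comm]
        exact add_mem hx hy
      | mul x y _ _ hx hy =>
        rw [map_mul, map_mul, show x * y - algebraMap K O (χ x) * algebraMap K O (χ y) =
          y * (x - algebraMap K O (χ x)) + algebraMap K O (χ x) * (y - algebraMap K O (χ y))
              by ring]
        exact add_mem (Ideal.mul_mem_left _ _ hx) (Ideal.mul_mem_left _ _ hy)
    intro y hy
    have h := this y (hgen ▸ Algebra.mem_top)
    rwa [(RingHom.mem_ker).1 hy, map_zero, sub_zero] at h
  · rw [sup_le_iff, Ideal.span_singleton_le_iff_mem, Ideal.span_singleton_le_iff_mem]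
    constructor <;> simp [RingHom.mem_ker]

/-- Near a point at which `u` is a uniformizer with `D u ≠ 0`, elements killed by `D` are `p`-th
powers up to multiplication by a `p`-th power. -/
theorem exists_pow_mul_eq_pow_of_uniformizer [IsAlgClosed K] [CharP O p] {x₁ x₂ : O}
    (hgen : Algebra.adjoin K {x₁, x₂} = ⊤) (D : Derivation K O O) (χ : O →ₐ[K] K) (u : O)
    (hu : χ u = 0) (hDu : χ (D u) ≠ 0)
    (hm : RingHom.ker χ ≤ Ideal.span {u} ⊔ RingHom.ker χ ^ 2) (a : O) (ha : D a = 0) :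
    ∃ s c : O, χ s ≠ 0 ∧ s ^ p * a = c ^ p := by
  have hp0 := hp.out.pos
  set m := RingHom.ker χ with hmdef
  have hmn : ∀ n, m ≤ Ideal.span {u} ⊔ m ^ (n + 1) := by
    intro n
    induction n with
    | zero => simp
    | succ n ih =>
      refine hm.trans (sup_le le_sup_left ?_)
      calc m ^ 2 = m * m := pow_two m
        _ ≤ (Ideal.span {u} ⊔ m ^ (n + 1)) * m := Ideal.mul_mono_left ih
        _ = Ideal.span {u} * m ⊔ m ^ (n + 1) * m := Ideal.sup_mul _ _ _
        _ ≤ _ := sup_le_sup Ideal.mul_le_left (pow_succ m (n + 1)).ge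
  let E := (frobenius O p).range
  have hfin : Module.Finite E O := finite_frobenius_range p hgen
  have hE : ∀ y : O, y ^ p ∈ E := fun y => ⟨y, rfl⟩
  let 𝔫 : Ideal E := m.comap E.subtype
  let W : Submodule E O := Submodule.span E (Set.range fun i : Fin p => u ^ (i : ℕ))
  set V : Submodule E O := W ⊔ 𝔫 • ⊤ with hV
  have hpm : ∀ y ∈ m, ∀ o : O, o * y ^ p ∈ V := by
    intro y hy o
    refine Submodule.mem_sup_right ?_
    have : (⟨y ^ p, hE y⟩ : E) • o ∈ 𝔫 • (⊤ : Submodule E O) :=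
      Submodule.smul_mem_smul (show y ^ p ∈ m from Ideal.pow_mem_of_mem _ hy p hp0) trivial
    rwa [Subring.smul_def, smul_eq_mul, mul_comm] at this
  have h2p : ∀ y ∈ m ^ (p + p), y ∈ V := by
    intro y hy
    rw [hmdef, ker_eq_span_of_adjoin_eq_top hgen χ] at hy
    have := Ideal.sup_pow_add_le_pow_sup_pow hy
    rw [Ideal.span_singleton_pow, Ideal.span_singleton_pow] at this
    obtain ⟨y₁, h₁, y₂, h₂, rfl⟩ := Submodule.mem_sup.1 this
    obtain ⟨o₁, rfl⟩ := Ideal.mem_span_singleton'.1 h₁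
    obtain ⟨o₂, rfl⟩ := Ideal.mem_span_singleton'.1 h₂
    exact V.add_mem (hpm _ (by simp [hmdef, RingHom.mem_ker]) _)
      (hpm _ (by simp [hmdef, RingHom.mem_ker]) _)
  have hall : ∀ l i o, l + i = p → u ^ i * o ∈ V := by
    intro l
    induction l with
    | zero =>
      rintro i o hi
      rw [zero_add] at hi
      rw [hi, mul_comm]
      exact hpm u hu o
    | succ l ih =>
      intro i o hi
      have h1 : o - algebraMap K O (χ o) ∈ m := by simp [hmdef, RingHom.mem_ker]
      obtain ⟨y₁, h₁, r, hr, h⟩ := Submodule.mem_sup.1 (hmn (p + p) h1)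
      obtain ⟨o', rfl⟩ := Ideal.mem_span_singleton'.1 h₁
      obtain ⟨s, hs⟩ := IsAlgClosed.exists_pow_nat_eq (χ o) hp0
      have : u ^ i * o = (⟨algebraMap K O s ^ p, hE _⟩ : E) • u ^ i + u ^ (i + 1) * o' + u ^ i *
          r := by
        rw [Subring.smul_def, smul_eq_mul]
        simp only
        rw [← map_pow, hs]
        linear_combination - u ^ i * h
      rw [this]
      refine V.add_mem (V.add_mem (V.smul_mem _ (Submodule.mem_sup_left ?_)) (ih _ _ (by omega)))
        (h2p _ (Ideal.mul_mem_left _ _ (Ideal.pow_le_pow_right (by omega) hr)))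
      exact Submodule.subset_span ⟨⟨i, by omega⟩, rfl⟩
  have htop : (⊤ : Submodule E (O ⧸ W)) ≤ 𝔫 • ⊤ := by
    have : V = ⊤ := by
      rw [eq_top_iff]
      intro o _
      simpa using hall p 0 o (by omega)
    have h := congrArg (Submodule.map W.mkQ) this
    rw [hV, Submodule.map_sup, Submodule.map_smul'', Submodule.map_top, Submodule.range_mkQ,
      Submodule.mkQ_map_self, bot_sup_eq] at h
    exact h.ge
  obtain ⟨⟨_, s, rfl⟩, hr, hr0⟩ := Submodule.exists_sub_one_mem_and_smul_eq_zero_of_fg_of_le_smul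
    𝔫 (⊤ : Submodule E (O ⧸ W)) Module.Finite.fg_top htop
  have hs : χ s ≠ 0 := by
    intro h0
    have : χ (s ^ p - 1) = 0 := hr
    rw [map_sub, map_pow, h0, zero_pow hp0.ne', map_one] at this
    simp at this
  have hsa : s ^ p * a ∈ W := by
    have := hr0 (W.mkQ a) trivial
    rw [← map_smul, Submodule.mkQ_apply, Submodule.Quotient.mk_eq_zero] at this
    exact this
  obtain ⟨c, hc⟩ := (Submodule.mem_span_range_iff_exists_fun E).1 hsa
  have hce : ∀ i : ℕ, ∃ b : O, ∀ h : i < p, b ^ p = (c ⟨i, h⟩ : O) := by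
    intro i
    by_cases h : i < p
    · obtain ⟨b, hb⟩ := (c ⟨i, h⟩).2
      exact ⟨b, fun _ => hb⟩
    · exact ⟨0, fun h' => absurd h' h⟩
  choose b hb using hce
  have hsum : s ^ p * a = ∑ i ∈ Finset.range p, b i ^ p * u ^ i := by
    rw [← hc, Finset.sum_range]
    refine Finset.sum_congr rfl fun i _ => ?_
    rw [hb i i.2, Subring.smul_def, smul_eq_mul]
  have hDp : ∀ y : O, D (y ^ p) = 0 := fun y => by
    rw [Derivation.leibniz_pow]
    simp
  obtain ⟨q, hq⟩ : ∃ q, p = q + 1 := ⟨p - 1, by omega⟩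
  have hD := congrArg D hsum
  rw [hq, Finset.sum_range_succ', ← hq] at hD
  simp only [Derivation.leibniz, hDp, ha, mul_zero, add_zero, map_sum, map_add, pow_zero,
    Derivation.leibniz_pow, Derivation.map_one_eq_zero, Nat.add_sub_cancel, smul_eq_mul] at hD
  obtain ⟨M, hM⟩ := exists_pow_mul_eq_zero_of_sum_eq_zero p D u q (by omega) 1
    (fun i => ((i + 1 : ℕ) : O) * b (i + 1) ^ p) (fun i => by
      rw [Derivation.leibniz, hDp]; simp) (by
      refine Eq.trans ?_ hD.symm
      rw [Finset.mul_sum]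
      refine Finset.sum_congr rfl fun i _ => ?_
      rw [nsmul_eq_mul]
      ring)
  have hpos : ∀ i < q, D u ^ M * b (i + 1) ^ p = 0 := by
    intro i hi
    have hne : ((i + 1 : ℕ) : K) ≠ 0 := fun h0 => by
      have := Nat.le_of_dvd (by omega) ((CharP.cast_eq_zero_iff K p _).1 h0)
      omega
    have h2 := hM i hi
    have h3 : algebraMap K O ((i + 1 : ℕ) : K)⁻¹ * (((i + 1 : ℕ) : O)) = 1 := by
      rw [← map_natCast (algebraMap K O), ← map_mul, inv_mul_cancel₀ hne, map_one]
    calc D u ^ M * b (i + 1) ^ p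
        = (algebraMap K O ((i + 1 : ℕ) : K)⁻¹ * (((i + 1 : ℕ) : O))) * (D u ^ M * b (i + 1) ^ p) :=
            by
          rw [h3, one_mul]
      _ = algebraMap K O ((i + 1 : ℕ) : K)⁻¹ * (D u ^ M * (((i + 1 : ℕ) : O) * b (i + 1) ^ p)) := by
          ring
      _ = 0 := by rw [h2, mul_zero]
  refine ⟨D u ^ M * s, D u ^ M * b 0, ?_, ?_⟩
  · rw [map_mul, map_pow]
    exact mul_ne_zero (pow_ne_zero _ hDu) hs
  · rw [mul_pow, mul_assoc, hsum, hq, Finset.sum_range_succ', ← hq, mul_add, Finset.mul_sum,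
      Finset.sum_eq_zero, mul_pow]
    · simp
    · intro i hi
      obtain ⟨r, hr⟩ : ∃ r, p = r + 1 := ⟨p - 1, by omega⟩
      have : (D u ^ M) ^ p = (D u ^ M) ^ r * D u ^ M := by rw [hr, pow_succ]
      rw [this, show (D u ^ M) ^ r * D u ^ M * (b (i + 1) ^ p * u ^ (i + 1)) =
        (D u ^ M) ^ r * u ^ (i + 1) * (D u ^ M * b (i + 1) ^ p) by ring,
        hpos i (Finset.mem_range.1 hi), mul_zero]

theorem exists_algHom_ker_eq_of_isMaximal [IsAlgClosed K] [Algebra.FiniteType K O]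
    (m : Ideal O) [m.IsMaximal] : ∃ χ : O →ₐ[K] K, RingHom.ker χ = m := by
  let _ : Field (O ⧸ m) := Ideal.Quotient.field m
  have : Module.Finite K (O ⧸ m) := finite_of_finite_type_of_isJacobsonRing K (O ⧸ m)
  have hb : Function.Bijective (algebraMap K (O ⧸ m)) :=
    IsAlgClosed.algebraMap_bijective_of_isIntegral
  let ε : K ≃ₐ[K] (O ⧸ m) := AlgEquiv.ofBijective (Algebra.ofId K (O ⧸ m)) hb
  refine ⟨ε.symm.toAlgHom.comp (Ideal.Quotient.mkₐ K m), ?_⟩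
  ext y
  simp [RingHom.mem_ker, Ideal.Quotient.eq_zero_iff_mem]

/-- On a smooth affine plane curve with a nowhere vanishing derivation `D`, the kernel of `D`
consists of `p`-th powers. -/
theorem exists_pow_eq_of_derivation_eq_zero [IsAlgClosed K] {x₁ x₂ : O}
    (hgen : Algebra.adjoin K {x₁, x₂} = ⊤) (D : Derivation K O O)
    (hsm : ∀ χ : O →ₐ[K] K, ∃ c₁ c₂ : K, ¬ (c₁ = 0 ∧ c₂ = 0) ∧
      algebraMap K O c₁ * (x₁ - algebraMap K O (χ x₁)) +
        algebraMap K O c₂ * (x₂ - algebraMap K O (χ x₂)) ∈ RingHom.ker χ ^ 2 ∧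
      χ (D x₂) = c₁ ∧ χ (D x₁) = -c₂)
    (a : O) (ha : D a = 0) : ∃ b, b ^ p = a := by
  rcases subsingleton_or_nontrivial O with hO | hO
  · exact ⟨0, Subsingleton.elim _ _⟩
  have : CharP O p := charP_of_injective_algebraMap (algebraMap K O).injective p
  have hft : Algebra.FiniteType K O :=
    ⟨Subalgebra.fg_def.2 ⟨{x₁, x₂}, Set.toFinite _, hgen⟩⟩
  let I : Ideal O :=
    { carrier := {b | ∃ c, b ^ p * a = c ^ p}
      zero_mem' := ⟨0, by simp [hp.out.pos.ne']⟩
      add_mem' := by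
        rintro x y ⟨c, hc⟩ ⟨c', hc'⟩
        exact ⟨c + c', by rw [add_pow_char, add_pow_char, add_mul, hc, hc']⟩
      smul_mem' := by
        rintro o x ⟨c, hc⟩
        exact ⟨o * c, by rw [smul_eq_mul, mul_pow, mul_pow, mul_assoc, hc]⟩ }
  have hI : I = ⊤ := by
    by_contra hne
    obtain ⟨m, hm, hIm⟩ := Ideal.exists_le_maximal I hne
    obtain ⟨χ, rfl⟩ := exists_algHom_ker_eq_of_isMaximal (K := K) m
    obtain ⟨c₁, c₂, hne, hmem, h₂, h₁⟩ := hsm χ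
    have key : ∃ s c : O, χ s ≠ 0 ∧ s ^ p * a = c ^ p := by
      have hker := ker_eq_span_of_adjoin_eq_top hgen χ
      have aux : ∀ (c e : K) (y z : O), c ≠ 0 →
          algebraMap K O c * y + algebraMap K O e * z ∈ RingHom.ker χ ^ 2 →
          y ∈ Ideal.span {z} ⊔ RingHom.ker χ ^ 2 := by
        intro c e y z hc h
        have : y = -(algebraMap K O (c⁻¹ * e)) * z +
            algebraMap K O c⁻¹ * (algebraMap K O c * y + algebraMap K O e * z) := by
          rw [mul_add, ← mul_assoc, ← map_mul, inv_mul_cancel₀ hc, map_one, one_mul, map_mul]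
          ring
        rw [this]
        exact add_mem (Ideal.mem_sup_left (Ideal.mul_mem_left _ _ (Ideal.mem_span_singleton_self
            _)))
          (Ideal.mem_sup_right (Ideal.mul_mem_left _ _ h))
      by_cases hc₁ : c₁ = 0
      · have hc₂ : c₂ ≠ 0 := fun h => hne ⟨hc₁, h⟩
        refine exists_pow_mul_eq_pow_of_uniformizer p hgen D χ (x₁ - algebraMap K O (χ x₁))
          (by simp) (by simpa [h₁] using hc₂) ?_ a ha
        conv_lhs => rw [hker]
        refine sup_le le_sup_left ?_
        rw [Ideal.span_singleton_le_iff_mem]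
        exact aux c₂ c₁ _ _ hc₂ (by rwa [add_comm])
      · refine exists_pow_mul_eq_pow_of_uniformizer p hgen D χ (x₂ - algebraMap K O (χ x₂))
          (by simp) (by simpa [h₂] using hc₁) ?_ a ha
        conv_lhs => rw [hker]
        refine sup_le ?_ le_sup_left
        rw [Ideal.span_singleton_le_iff_mem]
        exact aux c₁ c₂ _ _ hc₁ hmem
    obtain ⟨s, c, hs, hsc⟩ := key
    exact hs (hIm ⟨c, hsc⟩)
  obtain ⟨c, hc⟩ : (1 : O) ∈ I := hI ▸ trivial
  exact ⟨c, by simpa using hc.symm⟩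

end PthRoots

section Jacobian

variable {K B : Type*} [Field K] [CommRing B] [Algebra K B]

/-- The derivation `b ↦ D₁ b * D₂ h - D₂ b * D₁ h`. -/
noncomputable def jacobianDerivation (D₁ D₂ : Derivation K B B) (h : B) : Derivation K B B :=
  D₂ h • D₁ - D₁ h • D₂

theorem jacobianDerivation_apply (D₁ D₂ : Derivation K B B) (h b : B) :
    jacobianDerivation D₁ D₂ h b = D₁ b * D₂ h - D₂ b * D₁ h := by
  simp [jacobianDerivation, mul_comm]

theorem exists_add_pow_pred_mul_derivation {p : ℕ} (hp : p.Prime) (D : Derivation K B B)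
    (a b : B) : ∃ w, (a + b) ^ (p - 1) * D (a + b) =
      a ^ (p - 1) * D a + b ^ (p - 1) * D b + D w := by
  obtain ⟨n, rfl⟩ : ∃ n, p = n + 1 := ⟨p - 1, (Nat.sub_add_cancel hp.one_le).symm⟩
  have hc : ∀ k ∈ Finset.range n, 
      (k + 1) * (n.choose k / (k + 1)) = n.choose k ∧
      (n - k) * (n.choose k / (k + 1)) = n.choose (k + 1) := by
    intro k hk
    have hk' := Finset.mem_range.1 hk
    have h1 := Nat.add_one_mul_choose_eq n k
    have hco : Nat.Coprime (k + 1) (n + 1) := by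
      rw [Nat.coprime_comm, hp.coprime_iff_not_dvd]
      intro h
      have := Nat.le_of_dvd (by omega) h
      omega
    have hdvd : (k + 1) ∣ n.choose k :=
      hco.dvd_of_dvd_mul_left ⟨(n + 1).choose (k + 1), by rw [h1, mul_comm]⟩
    obtain ⟨c, hc⟩ := hdvd
    have hdiv : n.choose k / (k + 1) = c := by
      rw [hc, Nat.mul_div_cancel_left _ (Nat.succ_pos k)]
    refine ⟨?_, ?_⟩
    · rw [hdiv, hc]
    · apply Nat.eq_of_mul_eq_mul_right (Nat.succ_pos k)
      rw [Nat.succ_eq_add_one, Nat.choose_succ_right_eq, hdiv, hc]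
      ring
  refine ⟨∑ k ∈ Finset.range n,
    ((n.choose k / (k + 1) : ℕ) : B) * (a ^ (k + 1) * b ^ (n - k)), ?_⟩
  have hD : ∀ k ∈ Finset.range n, D (((n.choose k / (k + 1) : ℕ) :
      B) * (a ^ (k + 1) * b ^ (n - k))) =
      (n.choose k : B) * a ^ k * b ^ (n - k) * D a +
        (n.choose (k + 1) : B) * a ^ (k + 1) * b ^ (n - (k + 1)) * D b := by
    intro k hk
    obtain ⟨h2, h3⟩ := hc k hk
    generalize n.choose k / (k + 1) = c at *
    rw [← h2, ← h3]
    simp only [Derivation.leibniz, Derivation.leibniz_pow, Derivation.map_natCast, smul_eq_mul,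
      nsmul_eq_mul, Nat.cast_mul, mul_zero, add_zero, Nat.add_sub_cancel]
    rw [show n - k - 1 = n - (k + 1) by omega]
    ring
  have hA : (a + b) ^ n = ∑ k ∈ Finset.range n, (n.choose k : B) * a ^ k * b ^ (n - k) + a ^ n := by
    rw [add_pow, Finset.sum_range_succ]
    simp only [Nat.sub_self, pow_zero, Nat.choose_self, Nat.cast_one, mul_one]
    congr 1
    exact Finset.sum_congr rfl fun k _ => by ring
  have hB : (a + b) ^ n =
      ∑ k ∈ Finset.range n, (n.choose (k + 1) : B) * a ^ (k + 1) * b ^ (n - (k + 1)) + b ^ n := by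
    rw [add_pow, Finset.sum_range_succ']
    simp only [Nat.sub_zero, pow_zero, Nat.choose_zero_right, Nat.cast_one, mul_one, one_mul]
    congr 1
    exact Finset.sum_congr rfl fun k _ => by ring
  rw [Nat.add_sub_cancel, map_sum, Finset.sum_congr rfl hD, Finset.sum_add_distrib,
    ← Finset.sum_mul, ← Finset.sum_mul, map_add, mul_add]
  conv_lhs => rw [hA]
  linear_combination (hB - hA) * D b

variable (p : ℕ) [CharP K p]

/-- Exactness: `E (G^p h^m J(Q,h)) = 0`. -/
theorem map_pow_mul_jacobianDerivation_eq_zero (D₁ D₂ : Derivation K B B)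
    (hcomm : ∀ b, D₁ (D₂ b) = D₂ (D₁ b)) (E : B →+ K)
    (hE₁ : ∀ b, E (D₁ b) = 0) (hE₂ : ∀ b, E (D₂ b) = 0) (G Q h : B) (m : ℕ) :
    E (G ^ p * h ^ m * jacobianDerivation D₁ D₂ h Q) = 0 := by
  have hDp : ∀ (D : Derivation K B B) (a : B), D (a ^ p) = 0 := fun D a => by
    have hpB : (p : B) = 0 := by
      rw [← map_natCast (algebraMap K B), CharP.cast_eq_zero, map_zero]
    simp [Derivation.leibniz_pow, ← Nat.cast_smul_eq_nsmul B, hpB]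
  have : G ^ p * h ^ m * jacobianDerivation D₁ D₂ h Q =
      D₁ (G ^ p * (Q * (h ^ m * D₂ h))) - D₂ (G ^ p * (Q * (h ^ m * D₁ h))) := by
    simp only [jacobianDerivation_apply, Derivation.leibniz, Derivation.leibniz_pow, hDp,
      smul_eq_mul, nsmul_eq_mul, hcomm]
    ring
  rw [this, map_sub, hE₁, hE₂, sub_zero]

variable [hp : Fact p.Prime]

/-- The Cartier-type identity `E (G^p (b h)^{p-1} J(b,h)) = ε (G J(b,h))^p` holds for all `b, h`
as soon as it holds for generators. -/
theorem cartier_identity_of_adjoin (D₁ D₂ : Derivation K B B)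
    (hcomm : ∀ b, D₁ (D₂ b) = D₂ (D₁ b)) (E ε : B →+ K)
    (hE₁ : ∀ b, E (D₁ b) = 0) (hE₂ : ∀ b, E (D₂ b) = 0) (S : Set B)
    (hS : Algebra.adjoin K S = ⊤)
    (hgen : ∀ s ∈ S, ∀ s' ∈ S, ∀ G, E (G ^ p * s ^ (p - 1) * s' ^ (p - 1) *
      jacobianDerivation D₁ D₂ s' s) = ε (G * jacobianDerivation D₁ D₂ s' s) ^ p)
    (b h G : B) :
    E (G ^ p * b ^ (p - 1) * h ^ (p - 1) * jacobianDerivation D₁ D₂ h b) =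
      ε (G * jacobianDerivation D₁ D₂ h b) ^ p := by
  have hp0 := hp.out.pos
  rcases subsingleton_or_nontrivial B with hB | hB
  · rw [Subsingleton.elim (G ^ p * b ^ (p - 1) * h ^ (p - 1) * jacobianDerivation D₁ D₂ h b) 0,
      Subsingleton.elim (G * jacobianDerivation D₁ D₂ h b) 0]
    simp [hp0.ne']
  have : CharP B p := charP_of_injective_algebraMap (algebraMap K B).injective p
  have hneg : ∀ y : K, (-y) ^ p = -(y ^ p) := fun y => by
    simpa [frobenius_def] using (frobenius K p).map_neg y
  have hanti : ∀ b h : B, jacobianDerivation D₁ D₂ h b = -jacobianDerivation D₁ D₂ b h := by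
    intro b h
    simp only [jacobianDerivation_apply]
    ring
  have hclos : ∀ h : B, (∀ s ∈ S, ∀ G, E (G ^ p * s ^ (p - 1) * h ^ (p - 1) *
      jacobianDerivation D₁ D₂ h s) = ε (G * jacobianDerivation D₁ D₂ h s) ^ p) →
      ∀ b G, E (G ^ p * b ^ (p - 1) * h ^ (p - 1) * jacobianDerivation D₁ D₂ h b) =
        ε (G * jacobianDerivation D₁ D₂ h b) ^ p := by
    intro h hh b
    have hb : b ∈ Algebra.adjoin K S := hS ▸ Algebra.mem_top
    induction hb using Algebra.adjoin_induction with
    | mem x hx => exact hh x hx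
    | algebraMap r => intro G; simp [hp0.ne']
    | add x y _ _ hx hy =>
      intro G
      obtain ⟨w, hw⟩ :=
        exists_add_pow_pred_mul_derivation hp.out (jacobianDerivation D₁ D₂ h) x y
      have : G ^ p * (x + y) ^ (p - 1) * h ^ (p - 1) * jacobianDerivation D₁ D₂ h (x + y) =
          G ^ p * x ^ (p - 1) * h ^ (p - 1) * jacobianDerivation D₁ D₂ h x +
          G ^ p * y ^ (p - 1) * h ^ (p - 1) * jacobianDerivation D₁ D₂ h y +
          G ^ p * h ^ (p - 1) * jacobianDerivation D₁ D₂ h w := by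
        linear_combination G ^ p * h ^ (p - 1) * hw
      rw [this, map_add, map_add, hx, hy,
        map_pow_mul_jacobianDerivation_eq_zero p D₁ D₂ hcomm E hE₁ hE₂, add_zero, map_add, mul_add,
            map_add,
        add_pow_char]
    | mul x y _ _ hx hy =>
      intro G
      have hx' := hx (G * y)
      have hy' := hy (G * x)
      have hpp : p = p - 1 + 1 := by omega
      have : G ^ p * (x * y) ^ (p - 1) * h ^ (p - 1) * jacobianDerivation D₁ D₂ h (x * y) =
          (G * y) ^ p * x ^ (p - 1) * h ^ (p - 1) * jacobianDerivation D₁ D₂ h x +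
          (G * x) ^ p * y ^ (p - 1) * h ^ (p - 1) * jacobianDerivation D₁ D₂ h y := by
        rw [Derivation.leibniz, mul_pow G y, mul_pow G x, smul_eq_mul, smul_eq_mul]
        have hxp : x ^ p = x ^ (p - 1) * x := by rw [← pow_succ, ← hpp]
        have hyp : y ^ p = y ^ (p - 1) * y := by rw [← pow_succ, ← hpp]
        rw [hxp, hyp]
        ring
      rw [this, map_add, hx', hy', ← add_pow_char, ← map_add, Derivation.leibniz, smul_eq_mul,
        smul_eq_mul]
      congr 2
      ring
  refine hclos h (fun s hs G => ?_) b G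
  have h1 := hclos s (fun s' hs' G => hgen s' hs' s hs G) h G
  rw [hanti s h, mul_neg, mul_neg, map_neg, map_neg, hneg, ← h1]
  congr 2
  ring

end Jacobian

section LaurentDerivation

open LaurentPolynomial

variable {K : Type*} [Field K]

/-- The linear map underlying `d/dT` on Laurent polynomials. -/
noncomputable def laurentDerivLinear : K[T;T⁻¹] →ₗ[K] K[T;T⁻¹] :=
  Finsupp.linearCombination K (fun n : ℤ => LaurentPolynomial.C (n : K) * T (n - 1)) ∘ₗ
    (AddMonoidAlgebra.coeffLinearEquiv K).toLinearMap

theorem laurentDerivLinear_C_mul_T (a : K) (n : ℤ) :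
    laurentDerivLinear (LaurentPolynomial.C a * T n : K[T;T⁻¹]) = LaurentPolynomial.C (a * n :
        K) * T (n - 1) := by
  rw [← single_eq_C_mul_T, map_mul, mul_assoc, ← LaurentPolynomial.smul_eq_C_mul]
  exact Finsupp.linearCombination_single K a n

/-- The derivation `d/dT` on Laurent polynomials. -/
noncomputable def laurentDeriv : Derivation K K[T;T⁻¹] K[T;T⁻¹] :=
  Derivation.mk' laurentDerivLinear (by
    intro a b
    induction a using LaurentPolynomial.induction_on' with
    | add x y hx hy => rw [add_mul, map_add, hx, hy, map_add, add_smul, smul_add]; abel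
    | C_mul_T n r =>
      induction b using LaurentPolynomial.induction_on' with
      | add x y hx hy => rw [mul_add, map_add, hx, hy, map_add, add_smul, smul_add]; abel
      | C_mul_T m s =>
        rw [show LaurentPolynomial.C r * T n * (LaurentPolynomial.C s * T m) =
            (LaurentPolynomial.C (r * s) * T (n + m) : K[T;T⁻¹]) by
          rw [T_add, map_mul]; ring]
        rw [laurentDerivLinear_C_mul_T, laurentDerivLinear_C_mul_T, laurentDerivLinear_C_mul_T]
        simp only [smul_eq_mul, map_mul, map_add, Int.cast_add, T_add, T_sub]
        ring)

theorem laurentDeriv_C_mul_T (a : K) (n : ℤ) :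
    laurentDeriv (LaurentPolynomial.C a * T n : K[T;T⁻¹]) = LaurentPolynomial.C (a * n :
        K) * T (n - 1) :=
  laurentDerivLinear_C_mul_T a n

theorem laurentDeriv_T (n : ℤ) : laurentDeriv (T n : K[T;T⁻¹]) = LaurentPolynomial.C (n :
    K) * T (n - 1) := by
  simpa using laurentDeriv_C_mul_T (1 : K) n

theorem coeff_laurentDeriv (g : K[T;T⁻¹]) (n : ℤ) :
    (laurentDeriv g).coeff n = (n + 1) * g.coeff (n + 1) := by
  induction g using LaurentPolynomial.induction_on' with
  | add x y hx hy => simp [map_add, hx, hy, mul_add]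
  | C_mul_T m s =>
    rw [laurentDeriv_C_mul_T, ← single_eq_C_mul_T, ← single_eq_C_mul_T]
    simp only [AddMonoidAlgebra.coeff_single, Finsupp.single_apply]
    by_cases h : m = n + 1
    · subst h; simp [mul_comm]
    · rw [if_neg h, if_neg (by omega), mul_zero]

end LaurentDerivation

section LaurentResidue

open LaurentPolynomial Polynomial

variable {K : Type*} [Field K]

/-- The derivation of `A[X]` acting on the coefficients through `δ`. -/
noncomputable def coeffwiseDerivation {A : Type*} [CommRing A] [Algebra K A]
    (δ : Derivation K A A) : Derivation K A[X] A[X] :=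
  PolynomialModule.equivPolynomialSelf.compDer δ.mapCoeffs

theorem coeff_coeffwiseDerivation {A : Type*} [CommRing A] [Algebra K A]
    (δ : Derivation K A A) (g : A[X]) (n : ℕ) :
    (coeffwiseDerivation δ g).coeff n = δ (g.coeff n) := rfl

/-- The derivative `d/dX` of `A[X]`, seen as a `K`-linear derivation. -/
noncomputable def derivativeOver (K : Type*) [Field K] (A : Type*) [CommRing A] [Algebra K A] :
    Derivation K A[X] A[X] :=
  (Polynomial.derivative' (R := A)).restrictScalars K

theorem derivativeOver_apply {A : Type*} [CommRing A] [Algebra K A] (g : A[X]) :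
    derivativeOver K A g = derivative g := rfl

/-- The coefficient of `T⁻¹ X^n`. -/
noncomputable def laurentRes (n : ℕ) : K[T;T⁻¹][X] →+ K where
  toFun g := (g.coeff n).coeff (-1)
  map_zero' := by simp
  map_add' := by simp

theorem laurentRes_apply (n : ℕ) (g : K[T;T⁻¹][X]) :
    laurentRes n g = (g.coeff n).coeff (-1) := rfl

theorem laurentRes_coeffwiseDerivation (n : ℕ) (g : K[T;T⁻¹][X]) :
    laurentRes n (coeffwiseDerivation laurentDeriv g) = 0 := by
  simp [laurentRes_apply, coeff_coeffwiseDerivation, coeff_laurentDeriv]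

theorem coeffwiseDerivation_derivative_comm (g : K[T;T⁻¹][X]) :
    coeffwiseDerivation laurentDeriv (derivativeOver K _ g) =
      derivativeOver K _ (coeffwiseDerivation laurentDeriv g) := by
  ext1 n
  rw [coeff_coeffwiseDerivation, derivativeOver_apply, derivativeOver_apply, coeff_derivative,
    coeff_derivative, coeff_coeffwiseDerivation, Derivation.leibniz, ← Nat.cast_add_one,
    Derivation.map_natCast, smul_zero, zero_add, smul_eq_mul, mul_comm]

variable (p : ℕ) [CharP K p]

theorem laurentRes_derivative (n : ℕ) (g : K[T;T⁻¹][X]) (hn : p ∣ n + 1) :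
    laurentRes n (derivativeOver K _ g) = 0 := by
  rw [laurentRes_apply, derivativeOver_apply, coeff_derivative, ← Nat.cast_add_one,
    ← nsmul_eq_mul']
  have : ((n + 1 : ℕ) : K) = 0 := (CharP.cast_eq_zero_iff K p _).2 hn
  rw [← Nat.cast_smul_eq_nsmul K, this, zero_smul]
  rfl

variable [hp : Fact p.Prime]

theorem coeff_pow_char (G : K[T;T⁻¹][X]) (n : ℕ) : (G ^ p).coeff (p * n) = G.coeff n ^ p := by
  have : CharP K[T;T⁻¹] p := charP_of_injective_algebraMap (algebraMap K _).injective p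
  rw [← Polynomial.map_frobenius_expand p G, Polynomial.coeff_map, mul_comm,
      coeff_expand_mul hp.out.pos, frobenius_def]

theorem laurent_coeff_pow_char (a : K[T;T⁻¹]) (n : ℤ) : (a ^ p).coeff (p * n) = a.coeff n ^ p := by
  have : CharP K[T;T⁻¹] p := charP_of_injective_algebraMap (algebraMap K _).injective p
  induction a using LaurentPolynomial.induction_on' with
  | add x y hx hy => simp [add_pow_char, hx, hy]
  | C_mul_T m s =>
    rw [mul_pow, ← map_pow, T_pow, ← single_eq_C_mul_T, ← single_eq_C_mul_T]
    simp only [AddMonoidAlgebra.coeff_single, Finsupp.single_apply]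
    have h0 : (p : ℤ) ≠ 0 := by exact_mod_cast hp.out.pos.ne'
    by_cases h : m = n
    · simp [h]
    · rw [if_neg h, if_neg (fun h' => h (mul_left_cancel₀ h0 h')), zero_pow hp.out.pos.ne']

theorem laurent_coeff_mul_T (a : K[T;T⁻¹]) (m n : ℤ) : (a * T m).coeff n = a.coeff (n - m) := by
  induction a using LaurentPolynomial.induction_on' with
  | add x y hx hy => simp [add_mul, hx, hy]
  | C_mul_T k s =>
    rw [mul_assoc, ← T_add, ← single_eq_C_mul_T, ← single_eq_C_mul_T]
    simp only [AddMonoidAlgebra.coeff_single, Finsupp.single_apply]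
    exact if_congr (by omega) rfl rfl

theorem laurentRes_pow_char (n : ℕ) (G : K[T;T⁻¹][X]) :
    laurentRes (p * n + (p - 1)) (G ^ p * (Polynomial.C (T 1)) ^ (p - 1) * Polynomial.X ^ (p - 1)) =
      laurentRes n G ^ p := by
  rw [laurentRes_apply, coeff_mul_X_pow, ← map_pow, coeff_mul_C, coeff_pow_char, laurentRes_apply,
    ← laurent_coeff_pow_char, T_pow, laurent_coeff_mul_T]
  congr 1
  have := hp.out.one_le
  push_cast [this]
  ring

theorem adjoin_T_X : Algebra.adjoin K
    {Polynomial.C (T 1), Polynomial.C (T (-1)), (Polynomial.X : K[T;T⁻¹][X])} = ⊤ := by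
  set S := Algebra.adjoin K
    {Polynomial.C (T 1), Polynomial.C (T (-1)), (Polynomial.X : K[T;T⁻¹][X])}
  have h₁ : Polynomial.C (T 1) ∈ S := Algebra.subset_adjoin (by simp)
  have h₂ : Polynomial.C (T (-1)) ∈ S := Algebra.subset_adjoin (by simp)
  have h₃ : Polynomial.X ∈ S := Algebra.subset_adjoin (by simp)
  have hT : ∀ n : ℤ, (Polynomial.C (T n) : K[T;T⁻¹][X]) ∈ S := by
    intro n
    obtain ⟨m, rfl | rfl⟩ := n.eq_nat_or_neg
    · simpa [← map_pow, T_pow] using pow_mem h₁ m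
    · simpa [← map_pow, T_pow] using pow_mem h₂ m
  have hC : ∀ a : K[T;T⁻¹], Polynomial.C a ∈ S := by
    intro a
    induction a using LaurentPolynomial.induction_on' with
    | add x y hx hy => rw [map_add]; exact add_mem hx hy
    | C_mul_T k s =>
      rw [map_mul]
      exact mul_mem (S.algebraMap_mem s) (hT k)
  refine eq_top_iff.2 fun g _ => ?_
  induction g using Polynomial.induction_on' with
  | add x y hx hy => exact add_mem (hx trivial) (hy trivial)
  | monomial n a =>
    rw [← Polynomial.C_mul_X_pow_eq_monomial]
    exact mul_mem (hC a) (pow_mem h₃ n)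

theorem laurentRes_cartier (n : ℕ) (b h G : K[T;T⁻¹][X]) :
    laurentRes (p * n + (p - 1)) (G ^ p * b ^ (p - 1) * h ^ (p - 1) *
      jacobianDerivation (coeffwiseDerivation laurentDeriv) (derivativeOver K _) h b) =
    laurentRes n (G * jacobianDerivation (coeffwiseDerivation laurentDeriv)
      (derivativeOver K _) h b) ^ p := by
  have hp0 := hp.out.pos
  refine cartier_identity_of_adjoin p _ _ coeffwiseDerivation_derivative_comm _ _
    (laurentRes_coeffwiseDerivation _) 
    (fun g => laurentRes_derivative p _ g ⟨n + 1, by rw [mul_add]; omega⟩) _ adjoin_T_X ?_ b h G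
  have hneg : ∀ y : K, (-y) ^ p = -(y ^ p) := fun y => by
    simpa [frobenius_def] using (frobenius K p).map_neg y
  have hD₁C : ∀ a, coeffwiseDerivation laurentDeriv (Polynomial.C a : K[T;T⁻¹][X]) =
      Polynomial.C (laurentDeriv a) := by
    intro a
    ext1 n
    rw [coeff_coeffwiseDerivation, Polynomial.coeff_C, Polynomial.coeff_C]
    split_ifs <;> simp
  have hD₁X : coeffwiseDerivation laurentDeriv (Polynomial.X : K[T;T⁻¹][X]) = 0 := by
    ext1 n
    rw [coeff_coeffwiseDerivation, Polynomial.coeff_X]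
    split_ifs <;> simp
  have hD₂C : ∀ a, derivativeOver K K[T;T⁻¹] (Polynomial.C a) = 0 := fun a => by
    simp [derivativeOver_apply]
  have hD₂X : derivativeOver K K[T;T⁻¹] Polynomial.X = 1 := by
    simp [derivativeOver_apply]
  have hJT : ∀ m : ℤ, jacobianDerivation (coeffwiseDerivation laurentDeriv) (derivativeOver K _)
      Polynomial.X (Polynomial.C (T m)) = Polynomial.C (LaurentPolynomial.C (m : K) * T (m - 1)) :=
          by
    intro m
    rw [jacobianDerivation_apply, hD₁C, hD₂X, hD₂C, laurentDeriv_T]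
    simp
  have hJX : ∀ m : ℤ, jacobianDerivation (coeffwiseDerivation laurentDeriv) (derivativeOver K _)
      (Polynomial.C (T m)) Polynomial.X = -Polynomial.C (LaurentPolynomial.C (m : K) * T (m - 1)) :=
          by
    intro m
    rw [jacobianDerivation_apply, hD₁C, hD₂X, hD₂C, laurentDeriv_T]
    simp
  have hJJ : ∀ m m' : ℤ, jacobianDerivation (coeffwiseDerivation laurentDeriv) (derivativeOver K _)
      (Polynomial.C (T m : K[T;T⁻¹])) (Polynomial.C (T m')) = 0 := by
    intro m m'
    rw [jacobianDerivation_apply, hD₂C, hD₂C]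
    simp
  have hJXX : jacobianDerivation (coeffwiseDerivation laurentDeriv) (derivativeOver K _)
      (Polynomial.X : K[T;T⁻¹][X]) Polynomial.X = 0 := by
    rw [jacobianDerivation_apply, hD₁X]
    simp
  have key : ∀ m : ℤ, (m : K) ^ p = m → ∀ G : K[T;T⁻¹][X], laurentRes (p * n + (p - 1))
      (G ^ p * Polynomial.C (T m) ^ (p - 1) * Polynomial.X ^ (p - 1) *
        Polynomial.C (LaurentPolynomial.C (m : K) * T (m - 1))) =
      laurentRes n (G * Polynomial.C (LaurentPolynomial.C (m : K) * T (m - 1))) ^ p := by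
    intro m hm G
    rw [← laurentRes_pow_char]
    congr 1
    have : (T m : K[T;T⁻¹]) ^ (p - 1) * T (m - 1) = T (m - 1) ^ p * T 1 ^ (p - 1) := by
      simp only [T_pow, ← T_add]
      congr 1
      push_cast [hp.out.one_le]
      ring
    have h2 : Polynomial.C (T m : K[T;T⁻¹]) ^ (p - 1) * Polynomial.C (T (m - 1)) =
        Polynomial.C (T (m - 1)) ^ p * Polynomial.C (T 1) ^ (p - 1) := by
      simp only [← map_pow, ← map_mul, this]
    have h3 : Polynomial.C (LaurentPolynomial.C (m : K)) ^ p =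
        Polynomial.C (LaurentPolynomial.C (m : K)) := by
      rw [← map_pow, ← map_pow, hm]
    rw [mul_pow, map_mul, mul_pow, h3]
    linear_combination G ^ p * Polynomial.X ^ (p - 1) * Polynomial.C (LaurentPolynomial.C (m :
        K)) * h2
  have hm₁ : ((1 : ℤ) : K) ^ p = (1 : ℤ) := by simp
  have hm₂ : ((-1 : ℤ) : K) ^ p = (-1 : ℤ) := by simp [hneg]
  have h00 : (0 : K) ^ p = 0 := zero_pow hp0.ne'
  have key' : ∀ m : ℤ, (m : K) ^ p = m → ∀ G : K[T;T⁻¹][X], laurentRes (p * n + (p - 1))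
      (G ^ p * Polynomial.X ^ (p - 1) * Polynomial.C (T m) ^ (p - 1) *
        -Polynomial.C (LaurentPolynomial.C (m : K) * T (m - 1))) =
      laurentRes n (G * -Polynomial.C (LaurentPolynomial.C (m : K) * T (m - 1))) ^ p := by
    intro m hm G
    have e : ∀ u v : K[T;T⁻¹][X], u * -v = -(u * v) := fun u v => mul_neg u v
    rw [e, map_neg, e, map_neg, hneg, ← key m hm, mul_right_comm (G ^ p)]
  rintro s (rfl | rfl | rfl) s' (rfl | rfl | rfl) G
  · rw [hJJ, mul_zero, mul_zero, map_zero, map_zero, h00]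
  · rw [hJJ, mul_zero, mul_zero, map_zero, map_zero, h00]
  · rw [hJT]; exact key 1 hm₁ G
  · rw [hJJ, mul_zero, mul_zero, map_zero, map_zero, h00]
  · rw [hJJ, mul_zero, mul_zero, map_zero, map_zero, h00]
  · rw [hJT]; exact key (-1) hm₂ G
  · rw [hJX]; exact key' 1 hm₁ G
  · rw [hJX]; exact key' (-1) hm₂ G
  · rw [hJXX, mul_zero, mul_zero, map_zero, map_zero, h00]

section Monic

variable (f : K[T;T⁻¹][X])

/-- The coefficient of `T⁻¹ X^(d-1)` in the remainder modulo `f`, where `d = deg f`. -/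
noncomputable def residueMod : K[T;T⁻¹][X] →+ K where
  toFun g := laurentRes (f.natDegree - 1) (g %ₘ f)
  map_zero' := by simp
  map_add' := by simp [add_modByMonic]

theorem residueMod_apply (g : K[T;T⁻¹][X]) :
    residueMod f g = laurentRes (f.natDegree - 1) (g %ₘ f) := rfl

variable {f}

theorem residueMod_eq (hf : f.Monic) (hd : 0 < f.natDegree) (g : K[T;T⁻¹][X]) (e : ℕ)
    (he : g.natDegree + 1 < p ^ e) :
    residueMod f g = laurentRes (p ^ e * (f.natDegree - 1) + (p ^ e - 1))
      (g * f ^ (p ^ e - 1)) := by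
  have hchar : CharP K[T;T⁻¹] p := charP_of_injective_algebraMap (algebraMap K _).injective p
  set d := f.natDegree with hdef
  set q := p ^ e with hq
  have hidx : q * (d - 1) + (q - 1) = (d - 1) + (q - 1) * d := by
    obtain ⟨c, hc⟩ : ∃ c, d = c + 1 := ⟨d - 1, by omega⟩
    obtain ⟨c', hc'⟩ : ∃ c, q = c + 1 := ⟨q - 1, by omega⟩
    rw [hc, hc', Nat.add_sub_cancel, Nat.add_sub_cancel]
    ring
  have hr : (g %ₘ f).natDegree ≤ d - 1 := by
    have := natDegree_modByMonic_lt g hf (by rintro rfl; simp at hdef; omega)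
    omega
  have h1 : ((g %ₘ f) * f ^ (q - 1)).coeff ((d - 1) + (q - 1) * d) = (g %ₘ f).coeff (d - 1) := by
    rw [coeff_mul_add_eq_of_natDegree_le hr (natDegree_pow_le_of_le _ le_rfl)]
    have := (hf.pow (q - 1)).coeff_natDegree
    rw [hf.natDegree_pow] at this
    rw [this, mul_one]
  have h2 : ((g /ₘ f) * f ^ q).coeff ((d - 1) + (q - 1) * d) = 0 := by
    have hu : (g /ₘ f).natDegree ≤ g.natDegree := by
      rw [natDegree_divByMonic g hf]; omega
    have hfe : f = Polynomial.X ^ d + f.eraseLead := by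
      have := f.eraseLead_add_C_mul_X_pow
      rw [hf.leadingCoeff, map_one, one_mul, add_comm] at this
      exact this.symm
    have hfq : f ^ q = Polynomial.X ^ (d * q) + f.eraseLead ^ q := by
      conv_lhs => rw [hfe, hq, add_pow_char_pow, ← hq, ← pow_mul]
    rw [hfq, mul_add, Polynomial.coeff_add, coeff_mul_X_pow', if_neg, zero_add]
    · apply coeff_eq_zero_of_natDegree_lt
      have h3 := f.eraseLead_natDegree_le
      have h4 : (f.eraseLead ^ q).natDegree ≤ q * (d - 1) := natDegree_pow_le_of_le _ h3
      refine lt_of_le_of_lt natDegree_mul_le ?_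
      omega
    · rw [← hidx, mul_comm d]
      have : q * d = q * (d - 1) + q := by
        rw [← Nat.mul_succ]; congr 1; omega
      omega
  have h3 : g * f ^ (q - 1) = (g %ₘ f) * f ^ (q - 1) + (g /ₘ f) * f ^ q := by
    have : f ^ q = f ^ (q - 1) * f := by rw [← pow_succ]; congr 1; omega
    rw [this]
    linear_combination -f ^ (q - 1) * modByMonic_add_div g f
  rw [residueMod_apply, hidx, h3, map_add, laurentRes_apply, laurentRes_apply, laurentRes_apply,
    h1, h2]
  simp [hdef]

theorem residueMod_jacobian (p : ℕ) [CharP K p] [hp : Fact p.Prime] (hf : f.Monic) (hd :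
    0 < f.natDegree) (h : K[T;T⁻¹][X]) :
    residueMod f (jacobianDerivation (coeffwiseDerivation laurentDeriv) (derivativeOver K _) f h)
      = 0 := by
  have key := fun e => map_pow_mul_jacobianDerivation_eq_zero p _ _
    coeffwiseDerivation_derivative_comm
    (laurentRes (p ^ (e + 1) * (f.natDegree - 1) + (p ^ (e + 1) - 1)))
    (laurentRes_coeffwiseDerivation (K := K) _)
    (fun g => laurentRes_derivative p _ g (by
      rw [add_assoc, Nat.sub_add_cancel (Nat.one_le_pow _ _ hp.out.pos)]
      exact dvd_add (dvd_mul_of_dvd_left (dvd_pow_self p (by omega)) _)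
        (dvd_pow_self p (by omega)))) 1 h f (p ^ (e + 1) - 1)
  generalize jacobianDerivation (coeffwiseDerivation laurentDeriv) (derivativeOver K _) f h = J
    at key ⊢
  obtain ⟨e, he⟩ : ∃ e, J.natDegree + 1 < p ^ (e + 1) :=
    ⟨J.natDegree + 1, (Nat.lt_succ_self _).trans (Nat.lt_pow_self hp.out.one_lt)⟩
  have h1 := key e
  rw [one_pow, one_mul, mul_comm _ J] at h1
  rw [residueMod_eq p hf hd _ (e + 1) he, h1]

theorem residueMod_cartier (hf : f.Monic) (hd : 0 < f.natDegree) (g b : K[T;T⁻¹][X]) :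
    residueMod f (g ^ p * b ^ (p - 1) *
      jacobianDerivation (coeffwiseDerivation laurentDeriv) (derivativeOver K _) f b) =
    residueMod f (g *
      jacobianDerivation (coeffwiseDerivation laurentDeriv) (derivativeOver K _) f b) ^ p := by
  generalize hJ : jacobianDerivation (coeffwiseDerivation laurentDeriv) (derivativeOver K _) f b = J
  obtain ⟨N, hN₁, hN₂⟩ : ∃ N, (g ^ p * b ^ (p - 1) * J).natDegree ≤ N ∧ (g * J).natDegree ≤ N :=
    ⟨_, le_max_left _ _, le_max_right _ _⟩
  have h1 : N + 1 < p ^ (N + 1) := Nat.lt_pow_self hp.out.one_lt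
  have h2 : N + 1 < p ^ (N + 2) := (Nat.lt_succ_self _).trans (Nat.lt_pow_self hp.out.one_lt)
  rw [residueMod_eq p hf hd _ (N + 1) (lt_of_le_of_lt (Nat.succ_le_succ hN₂) h1),
    residueMod_eq p hf hd _ (N + 2) (lt_of_le_of_lt (Nat.succ_le_succ hN₁) h2)]
  have := laurentRes_cartier p (p ^ (N + 1) * (f.natDegree - 1) + (p ^ (N + 1) - 1)) b f
    (g * f ^ (p ^ (N + 1) - 1))
  rw [hJ] at this
  have e1 : p * (p ^ (N + 1) * (f.natDegree - 1) + (p ^ (N + 1) - 1)) + (p - 1) =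
      p ^ (N + 2) * (f.natDegree - 1) + (p ^ (N + 2) - 1) := by
    obtain ⟨c, hc⟩ : ∃ c, p ^ (N + 1) = c + 1 := ⟨p ^ (N + 1) - 1, by omega⟩
    rw [pow_succ p (N + 1), hc, Nat.add_sub_cancel]
    have := hp.out.pos
    have : (c + 1) * p - 1 = c * p + (p - 1) := by
      rw [add_mul, one_mul]; omega
    rw [this]
    ring
  have e2 : p ^ (N + 2) - 1 = (p ^ (N + 1) - 1) * p + (p - 1) := by
    obtain ⟨c, hc⟩ : ∃ c, p ^ (N + 1) = c + 1 := ⟨p ^ (N + 1) - 1, by omega⟩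
    rw [pow_succ p (N + 1), hc, Nat.add_sub_cancel]
    have := hp.out.pos
    rw [add_mul, one_mul]; omega
  rw [e1] at this
  rw [show g * J * f ^ (p ^ (N + 1) - 1) = g * f ^ (p ^ (N + 1) - 1) * J by ring, ← this]
  congr 1
  rw [e2, pow_add, pow_mul, mul_pow]
  ring

end Monic

end LaurentResidue

section Forms

variable {K : Type*} [Field K] {σ : Type*}

theorem MvPolynomial.IsHomogeneous.aeval_mul_left {A : Type*} [CommRing A] [Algebra K A]
    {F : MvPolynomial σ K} {d : ℕ} (hF : F.IsHomogeneous d) (c : A) (v : σ → A) :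
    MvPolynomial.aeval (fun i => c * v i) F = c ^ d * MvPolynomial.aeval v F := by
  rw [F.as_sum, map_sum, map_sum, Finset.mul_sum]
  refine Finset.sum_congr rfl fun m hm => ?_
  rw [aeval_monomial, aeval_monomial, ← hF (mem_support_iff.1 hm), Finsupp.weight_apply,
    Finsupp.prod, Finsupp.prod, Finsupp.sum]
  simp only [mul_pow, Finset.prod_mul_distrib, Pi.one_apply, smul_eq_mul, mul_one,
    Finset.prod_pow_eq_pow_sum]
  ring

theorem Derivation.aeval_eq_sum_pderiv [Fintype σ] {A : Type*} [CommRing A] [Algebra K A]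
    (D : Derivation K A A) (v : σ → A) (F : MvPolynomial σ K) :
    D (aeval v F) = ∑ i, aeval v (pderiv i F) * D (v i) := by
  classical
  induction F using MvPolynomial.induction_on with
  | C a => simp
  | add x y hx hy => simp only [map_add, hx, hy, add_mul, Finset.sum_add_distrib]
  | mul_X x i hx =>
    simp only [map_mul, Derivation.leibniz, hx, smul_eq_mul, aeval_X, map_add, pderiv_X,
      add_mul, Finset.sum_add_distrib]
    have hs : ∑ j, aeval v x * aeval v (Pi.single (M := fun _ => MvPolynomial σ K) j 1 i) *
        D (v j) = aeval v x * D (v i) := by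
      rw [Finset.sum_eq_single i (fun j _ hj => by simp [hj.symm]) (by simp)]
      simp
    rw [hs, Finset.mul_sum]
    congr 1
    exact Finset.sum_congr rfl fun j _ => by ring

theorem aeval_sub_sub_mem_ker_sq [Fintype σ] {A : Type*} [CommRing A] [Algebra K A]
    (χ : A →ₐ[K] K) (v : σ → A) (F : MvPolynomial σ K) :
    aeval v F - algebraMap K A (χ (aeval v F)) -
      ∑ i, algebraMap K A (χ (aeval v (pderiv i F))) * (v i - algebraMap K A (χ (v i))) ∈
    RingHom.ker χ ^ 2 := by
  classical
  induction F using MvPolynomial.induction_on with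
  | C a => simp
  | add x y hx hy =>
    convert add_mem hx hy using 1
    simp only [map_add, add_mul, Finset.sum_add_distrib]
    ring
  | mul_X x i hx =>
    have h1 : ∀ a : A, a - algebraMap K A (χ a) ∈ RingHom.ker χ := fun a => by simp
    have h2 := Ideal.mul_mem_left _ (algebraMap K A (χ (v i))) hx
    have h3 : (aeval v x - algebraMap K A (χ (aeval v x))) * (v i - algebraMap K A (χ (v i))) ∈
        RingHom.ker χ ^ 2 := by
      rw [sq]; exact Ideal.mul_mem_mul (h1 _) (h1 _)
    convert add_mem h2 h3 using 1
    simp only [map_mul, Derivation.leibniz, smul_eq_mul, aeval_X, map_add, pderiv_X,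
      add_mul, Finset.sum_add_distrib]
    have hs : ∑ j, algebraMap K A (χ (aeval v x)) *
        algebraMap K A (χ (aeval v (Pi.single (M := fun _ => MvPolynomial σ K) j 1 i))) *
        (v j - algebraMap K A (χ (v j))) =
        algebraMap K A (χ (aeval v x)) * (v i - algebraMap K A (χ (v i))) := by
      rw [Finset.sum_eq_single i (fun j _ hj => by simp [hj.symm]) (by simp)]
      simp
    have hs' : ∑ j, algebraMap K A (χ (v i)) * algebraMap K A (χ (aeval v (pderiv j x))) *
        (v j - algebraMap K A (χ (v j))) = algebraMap K A (χ (v i)) *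
        ∑ j, algebraMap K A (χ (aeval v (pderiv j x))) * (v j - algebraMap K A (χ (v j))) := by
      rw [Finset.mul_sum]
      exact Finset.sum_congr rfl fun j _ => by ring
    rw [hs, hs']
    ring

variable {F : MvPolynomial (Fin 3) K} {d : ℕ}

/-- A ternary form with `x₀^d`-coefficient `1`, as a monic polynomial in `x₀`. -/
theorem monic_aeval_form (hF : F.IsHomogeneous d) (hc : F.coeff (Finsupp.single 0 d) = 1)
    {A : Type*} [CommRing A] [Nontrivial A] [Algebra K A] (b c : A) :
    (aeval ![Polynomial.X, Polynomial.C b, Polynomial.C c] F).Monic ∧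
      (aeval ![Polynomial.X, Polynomial.C b, Polynomial.C c] F).natDegree = d := by
  have hmon : ∀ m : Fin 3 →₀ ℕ, aeval ![Polynomial.X, Polynomial.C b, Polynomial.C c]
      (monomial m (F.coeff m)) = Polynomial.C (algebraMap K A (F.coeff m) * (b ^ m 1 * c ^ m 2)) *
        Polynomial.X ^ m 0 := by
    intro m
    rw [aeval_monomial, Finsupp.prod_fintype _ _ (by simp), Fin.prod_univ_three]
    simp [IsScalarTower.algebraMap_apply K A (Polynomial A)]
    ring
  have hdeg : ∀ m ∈ F.support, m 0 + m 1 + m 2 = d := by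
    intro m hm
    have := hF (mem_support_iff.1 hm)
    rw [Finsupp.weight_apply, Finsupp.sum_fintype _ _ (by simp), Fin.sum_univ_three] at this
    simpa using this
  have hle : (aeval ![Polynomial.X, Polynomial.C b, Polynomial.C c] F).natDegree ≤ d := by
    rw [F.as_sum, map_sum]
    refine Polynomial.natDegree_sum_le_of_forall_le _ _ fun m hm => ?_
    rw [hmon]
    refine (Polynomial.natDegree_C_mul_X_pow_le _ _).trans ?_
    have := hdeg m hm
    omega
  have hcoeff : (aeval ![Polynomial.X, Polynomial.C b, Polynomial.C c] F).coeff d = 1 := by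
    have hmem : Finsupp.single 0 d ∈ F.support := by rw [mem_support_iff, hc]; exact one_ne_zero
    rw [F.as_sum, map_sum, Polynomial.finsetSum_coeff, Finset.sum_eq_single (Finsupp.single 0 d)]
    · rw [hmon, hc]
      simp
    · intro m hm hne
      rw [hmon, Polynomial.coeff_C_mul_X_pow, if_neg]
      rintro h
      apply hne
      have := hdeg m hm
      ext i
      fin_cases i
      · simp [← h]
      · simp; omega
      · simp; omega
    · exact fun h => absurd hmem h
  have hm := Polynomial.monic_of_natDegree_le_of_coeff_eq_one d hle hcoeff
  refine ⟨hm, le_antisymm hle (Polynomial.le_natDegree_of_ne_zero ?_)⟩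
  rw [hcoeff]
  exact one_ne_zero

end Forms

section Charts

variable {K : Type*} [Field K] {F : MvPolynomial (Fin 3) K} {d : ℕ}

/-- On an affine chart of a smooth plane curve, the kernel of the derivation dual to the
canonical differential form consists of `p`-th powers. -/
theorem exists_pow_eq_of_chart [IsAlgClosed K] (p : ℕ) [CharP K p] [Fact p.Prime]
    (hF : F.IsHomogeneous d)
    (hsm : ∀ v : Fin 3 → K, v ≠ 0 → ¬ (aeval v F = 0 ∧ ∀ i, aeval v (pderiv i F) = 0))
    {O : Type*} [CommRing O] [Algebra K O] (o : Fin 3 → O) (hFo : aeval o F = 0) {j l : Fin 3}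
    (hjl : (j = 1 ∧ l = 2) ∨ (j = 2 ∧ l = 1)) (ho : o l = 1)
    (hgen : Algebra.adjoin K {o 0, o j} = ⊤) (D : Derivation K O O)
    (h₀ : D (o 0) = -aeval o (pderiv j F)) (hj : D (o j) = aeval o (pderiv 0 F))
    (a : O) (ha : D a = 0) : ∃ b, b ^ p = a := by
  have hsum : ∀ g : Fin 3 → K, ∑ i, g i = g 0 + g j + g l := by
    intro g
    rcases hjl with ⟨rfl, rfl⟩ | ⟨rfl, rfl⟩ <;> rw [Fin.sum_univ_three]
    ring
  have hsum' : ∀ g : Fin 3 → O, ∑ i, g i = g 0 + g j + g l := by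
    intro g
    rcases hjl with ⟨rfl, rfl⟩ | ⟨rfl, rfl⟩ <;> rw [Fin.sum_univ_three]
    ring
  refine exists_pow_eq_of_derivation_eq_zero p hgen D (fun χ => ?_) a ha
  have hχ : ∀ G : MvPolynomial (Fin 3) K, χ (aeval o G) = aeval (χ ∘ o) G := fun G => by
    rw [← AlgHom.comp_apply, comp_aeval]; rfl
  refine ⟨χ (aeval o (pderiv 0 F)), χ (aeval o (pderiv j F)), ?_, ?_, by rw [hj],
    by rw [h₀, map_neg]⟩
  · rintro ⟨hc₁, hc₂⟩
    refine hsm (χ ∘ o) ?_ ⟨?_, ?_⟩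
    · intro h
      have := congrFun h l
      simp [ho] at this
    · rw [← hχ, hFo, map_zero]
    · have hE := congrArg (aeval (χ ∘ o)) hF.sum_X_mul_pderiv
      rw [map_sum, hsum] at hE
      simp only [map_mul, aeval_X, map_nsmul, ← hχ, hc₁, hc₂, hFo, ho,
        map_zero, mul_zero, smul_zero, one_mul, zero_add] at hE
      intro i
      rw [← hχ]
      rcases hjl with ⟨rfl, rfl⟩ | ⟨rfl, rfl⟩ <;> fin_cases i <;> assumption
  · have hT := aeval_sub_sub_mem_ker_sq χ o F
    rw [hFo, hsum', ho] at hT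
    simp only [map_zero, map_one, sub_self, mul_zero, add_zero, zero_sub] at hT
    exact neg_mem_iff.1 hT

theorem derivation_mem_adjoin_of_chart {O : Type*} [CommRing O] [Algebra K O] (o : Fin 3 → O)
    {u v : O} (ho : ∀ i, o i ∈ Algebra.adjoin K {u, v}) (D : Derivation K O O)
    {P Q : MvPolynomial (Fin 3) K} (hu : D u = aeval o P) (hv : D v = aeval o Q)
    {a : O} (ha : a ∈ Algebra.adjoin K {u, v}) : D a ∈ Algebra.adjoin K {u, v} := by
  have hmem : ∀ G : MvPolynomial (Fin 3) K, aeval o G ∈ Algebra.adjoin K {u, v} := by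
    intro G
    induction G using MvPolynomial.induction_on with
    | C a => simp
    | add x y hx hy => rw [map_add]; exact add_mem hx hy
    | mul_X x i hx => rw [map_mul, aeval_X]; exact mul_mem hx (ho i)
  induction ha using Algebra.adjoin_induction with
  | mem x hx =>
    rcases hx with rfl | rfl
    · rw [hu]; exact hmem _
    · rw [hv]; exact hmem _
  | algebraMap r => simp
  | add x y _ _ hx hy => rw [map_add]; exact add_mem hx hy
  | mul x y hx' hy' hx hy =>
    rw [D.leibniz]
    exact add_mem (mul_mem hx' hy) (mul_mem hy' hx)

/-- The restriction of a derivation to a stable subalgebra. -/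
def Derivation.restrictSubalgebra {O : Type*} [CommRing O] [Algebra K O] (D : Derivation K O O)
    (S : Subalgebra K O) (hS : ∀ a ∈ S, D a ∈ S) : Derivation K S S :=
  Derivation.mk' (D.toLinearMap.restrict (p := S.toSubmodule) (q := S.toSubmodule) hS) (by
    intro a b
    apply Subtype.ext
    exact D.leibniz (a : O) (b : O))

theorem exists_pow_eq_of_mem_chart [IsAlgClosed K] (p : ℕ) [CharP K p] [Fact p.Prime]
    (hF : F.IsHomogeneous d)
    (hsm : ∀ v : Fin 3 → K, v ≠ 0 → ¬ (aeval v F = 0 ∧ ∀ i, aeval v (pderiv i F) = 0))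
    {O : Type*} [CommRing O] [Algebra K O] (o : Fin 3 → O) (hFo : aeval o F = 0) {j l : Fin 3}
    (hjl : (j = 1 ∧ l = 2) ∨ (j = 2 ∧ l = 1)) (ho : o l = 1) (D : Derivation K O O)
    (h₀ : D (o 0) = -aeval o (pderiv j F)) (hj : D (o j) = aeval o (pderiv 0 F))
    {a : O} (ha : a ∈ Algebra.adjoin K {o 0, o j}) (hDa : D a = 0) :
    ∃ b ∈ Algebra.adjoin K {o 0, o j}, b ^ p = a := by
  set S := Algebra.adjoin K {o 0, o j} with hS
  have hoS : ∀ i, o i ∈ S := by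
    have h1 : o 0 ∈ S := Algebra.subset_adjoin (by simp)
    have h2 : o j ∈ S := Algebra.subset_adjoin (by simp)
    have h3 : o l ∈ S := by rw [ho]; exact one_mem _
    intro i
    rcases hjl with ⟨rfl, rfl⟩ | ⟨rfl, rfl⟩ <;> fin_cases i <;> assumption
  have hDS : ∀ a ∈ S, D a ∈ S := fun a ha =>
    derivation_mem_adjoin_of_chart o hoS D (P := -pderiv j F) (by rw [h₀, map_neg]) hj ha
  let o' : Fin 3 → S := fun i => ⟨o i, hoS i⟩
  have hval : ∀ G : MvPolynomial (Fin 3) K, ((aeval o' G : S) : O) = aeval o G := fun G => by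
    rw [← Subalgebra.coe_val, ← AlgHom.comp_apply, comp_aeval]; rfl
  have hgen : Algebra.adjoin K {o' 0, o' j} = ⊤ := by
    have := Algebra.adjoin_adjoin_coe_preimage (R := K) (s := {o 0, o j})
    convert this using 2
    ext ⟨x, hx⟩
    simp [o', Subtype.ext_iff]
  obtain ⟨b, hb⟩ := exists_pow_eq_of_chart p hF hsm o' (Subtype.ext (by rw [hval, hFo]; rfl)) hjl
    (Subtype.ext ho) hgen (D.restrictSubalgebra S hDS)
    (Subtype.ext (by rw [Subalgebra.coe_neg, hval]; exact h₀))
    (Subtype.ext (by rw [hval]; exact hj)) ⟨a, ha⟩ (Subtype.ext hDa)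
  exact ⟨b, b.2, congrArg Subtype.val hb⟩

end Charts

section Curve

open LaurentPolynomial

variable {K : Type*} [Field K] (F : MvPolynomial (Fin 3) K) {d : ℕ}

/-- The homogeneous coordinates `(x, T, 1)`. -/
noncomputable abbrev curveVec (K : Type*) [Field K] : Fin 3 → Polynomial K[T;T⁻¹] :=
  ![Polynomial.X, Polynomial.C (T 1), Polynomial.C 1]

/-- The dehomogenized equation `F(x, T, 1)` over the Laurent polynomials in `T`. -/
noncomputable def curvePoly : Polynomial K[T;T⁻¹] :=
  MvPolynomial.aeval (curveVec K) F

/-- The derivation `b ↦ ∂_T b · ∂_x f - ∂_x b · ∂_T f`, with `f` the curve equation. -/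
noncomputable abbrev curveJacobian :
    Derivation K (Polynomial K[T;T⁻¹]) (Polynomial K[T;T⁻¹]) :=
  jacobianDerivation (coeffwiseDerivation laurentDeriv) (derivativeOver K K[T;T⁻¹]) (curvePoly F)

/-- The coordinate ring of the intersection of two standard charts of the curve. -/
abbrev CurveRing : Type _ := AdjoinRoot (curvePoly F)

theorem curve_mk_jacobian_eq_zero (g : Polynomial K[T;T⁻¹])
    (hg : (AdjoinRoot.mkₐ (curvePoly F)).restrictScalars K g = 0) :
    (AdjoinRoot.mkₐ (curvePoly F)).restrictScalars K (curveJacobian F g) = 0 := by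
  have hg' : curvePoly F ∣ g := AdjoinRoot.mk_eq_zero.1 hg
  obtain ⟨c, rfl⟩ := hg'
  refine AdjoinRoot.mk_eq_zero.2 ?_
  rw [Derivation.leibniz]
  have : curveJacobian F (curvePoly F) = 0 := by
    rw [jacobianDerivation_apply]
    ring
  rw [this, smul_zero, add_zero]
  exact dvd_mul_right _ _

/-- The derivation of the coordinate ring dual to the canonical differential form. -/
noncomputable def curveDerivation : Derivation K (CurveRing F) (CurveRing F) :=
  Derivation.liftOfSurjective (f := (AdjoinRoot.mkₐ (curvePoly F)).restrictScalars K)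
    (d := curveJacobian F) AdjoinRoot.mk_surjective (curve_mk_jacobian_eq_zero F)

theorem curveDerivation_mk (g : Polynomial K[T;T⁻¹]) :
    curveDerivation F (AdjoinRoot.mk _ g) = AdjoinRoot.mk _ (curveJacobian F g) :=
  Derivation.liftOfSurjective_apply (f := (AdjoinRoot.mkₐ (curvePoly F)).restrictScalars K)
    (d := curveJacobian F) AdjoinRoot.mk_surjective (curve_mk_jacobian_eq_zero F) g

theorem coeffwiseDerivation_C (a : K[T;T⁻¹]) :
    coeffwiseDerivation laurentDeriv (Polynomial.C a) = Polynomial.C (laurentDeriv a) := by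
  ext1 n
  rw [coeff_coeffwiseDerivation, Polynomial.coeff_C, Polynomial.coeff_C]
  split_ifs <;> simp

theorem coeffwiseDerivation_X :
    coeffwiseDerivation (laurentDeriv (K := K)) (Polynomial.X : Polynomial K[T;T⁻¹]) = 0 := by
  ext1 n
  rw [coeff_coeffwiseDerivation, Polynomial.coeff_X]
  split_ifs <;> simp

theorem coeffwiseDerivation_curvePoly : coeffwiseDerivation laurentDeriv (curvePoly F) =
    MvPolynomial.aeval (curveVec K)
      (MvPolynomial.pderiv 1 F) := by
  have h := Derivation.aeval_eq_sum_pderiv (coeffwiseDerivation (laurentDeriv (K := K)))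
    (curveVec K) F
  rw [Fin.sum_univ_three] at h
  simp only [Matrix.cons_val, coeffwiseDerivation_X, coeffwiseDerivation_C, laurentDeriv_T] at h
  rw [curvePoly, h]
  simp

theorem derivativeOver_curvePoly : derivativeOver K _ (curvePoly F) =
    MvPolynomial.aeval (curveVec K)
      (MvPolynomial.pderiv 0 F) := by
  have h := Derivation.aeval_eq_sum_pderiv (derivativeOver K K[T;T⁻¹])
    (curveVec K) F
  rw [Fin.sum_univ_three] at h
  simp only [Matrix.cons_val, derivativeOver_apply, Polynomial.derivative_X,
    Polynomial.derivative_C] at h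
  rw [curvePoly, derivativeOver_apply, h]
  simp

/-- The coordinate functions of the chart where the last coordinate is `1`. -/
noncomputable def chartOne : Fin 3 → CurveRing F :=
  ![AdjoinRoot.root _, AdjoinRoot.of _ (T 1), 1]

/-- The coordinate functions of the chart where the middle coordinate is `1`. -/
noncomputable def chartTwo : Fin 3 → CurveRing F :=
  ![AdjoinRoot.root _ * AdjoinRoot.of _ (T (-1)), 1, AdjoinRoot.of _ (T (-1))]

theorem curve_of_T_mul (m n : ℤ) : AdjoinRoot.of (curvePoly F) (T m) * AdjoinRoot.of _ (T n) =
    AdjoinRoot.of _ (T (m + n)) := by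
  rw [← map_mul, ← T_add]

theorem chartOne_eq : chartOne F = fun i => AdjoinRoot.of _ (T 1) * chartTwo F i := by
  funext i
  fin_cases i
  · simp only [chartOne, chartTwo, Fin.zero_eta, Matrix.cons_val]
    rw [mul_left_comm, curve_of_T_mul]
    simp
  · simp [chartOne, chartTwo]
  · simp only [chartOne, chartTwo, Fin.reduceFinMk, Matrix.cons_val]
    rw [curve_of_T_mul]
    simp

theorem mk_aeval_curve (G : MvPolynomial (Fin 3) K) : AdjoinRoot.mk (curvePoly F)
    (MvPolynomial.aeval (curveVec K) G) =
    MvPolynomial.aeval (chartOne F) G := by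
  change (AdjoinRoot.mkₐ (curvePoly F)).restrictScalars K _ = _
  rw [← AlgHom.comp_apply, MvPolynomial.comp_aeval]
  congr 2
  funext i
  fin_cases i <;> simp [chartOne]

theorem aeval_chartOne : MvPolynomial.aeval (chartOne F) F = 0 := by
  rw [← mk_aeval_curve]
  exact AdjoinRoot.mk_self

variable {F}

theorem aeval_chartTwo (hF : F.IsHomogeneous d) : MvPolynomial.aeval (chartTwo F) F = 0 := by
  have h := aeval_chartOne F
  rw [chartOne_eq, hF.aeval_mul_left] at h
  have hu : AdjoinRoot.of (curvePoly F) (T (-1)) ^ d * AdjoinRoot.of _ (T 1) ^ d = 1 := by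
    rw [← mul_pow, curve_of_T_mul]
    simp
  rw [← one_mul (MvPolynomial.aeval _ F), ← hu, mul_assoc, h, mul_zero]

theorem curveDerivation_of_T (m : ℤ) : curveDerivation F (AdjoinRoot.of _ (T m)) =
    (m : CurveRing F) * AdjoinRoot.of _ (T (m - 1)) *
      MvPolynomial.aeval (chartOne F) (MvPolynomial.pderiv 0 F) := by
  rw [← AdjoinRoot.mk_C, curveDerivation_mk, jacobianDerivation_apply, coeffwiseDerivation_C,
    derivativeOver_curvePoly, derivativeOver_apply, Polynomial.derivative_C, zero_mul, sub_zero,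
    map_mul, mk_aeval_curve, laurentDeriv_T]
  simp

theorem curveDerivation_root : curveDerivation F (AdjoinRoot.root _) =
    -MvPolynomial.aeval (chartOne F) (MvPolynomial.pderiv 1 F) := by
  rw [← AdjoinRoot.mk_X, curveDerivation_mk, jacobianDerivation_apply, coeffwiseDerivation_X,
    coeffwiseDerivation_curvePoly, derivativeOver_apply Polynomial.X, Polynomial.derivative_X,
        zero_mul,
    one_mul, zero_sub, map_neg, mk_aeval_curve]

end Curve

section CurveResidue

open LaurentPolynomial

variable {K : Type*} [Field K] {F : MvPolynomial (Fin 3) K} {d : ℕ}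

/-- The Laurent coefficient at `T⁻¹` of the `x^(d-1)`-coordinate. -/
noncomputable def curveRes (F : MvPolynomial (Fin 3) K) (hf : (curvePoly F).Monic) :
    CurveRing F →+ K where
  toFun z := laurentRes ((curvePoly F).natDegree - 1) (AdjoinRoot.modByMonicHom hf z)
  map_zero' := by rw [map_zero, map_zero]
  map_add' x y := by rw [map_add, map_add]

theorem curveRes_mk (hf : (curvePoly F).Monic) (g : Polynomial K[T;T⁻¹]) :
    curveRes F hf (AdjoinRoot.mk _ g) = residueMod (curvePoly F) g := by
  rw [residueMod_apply, ← AdjoinRoot.modByMonicHom_mk hf]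
  rfl

theorem curveRes_derivation (p : ℕ) [CharP K p] [Fact p.Prime] (hf : (curvePoly F).Monic)
    (hd : 0 < (curvePoly F).natDegree) (h : CurveRing F) :
    curveRes F hf (curveDerivation F h) = 0 := by
  obtain ⟨h, rfl⟩ := AdjoinRoot.mk_surjective h
  rw [curveDerivation_mk, curveRes_mk, residueMod_jacobian p hf hd]

theorem curveRes_cartier (p : ℕ) [CharP K p] [Fact p.Prime] (hf : (curvePoly F).Monic)
    (hd : 0 < (curvePoly F).natDegree) (g b : CurveRing F) :
    curveRes F hf (g ^ p * b ^ (p - 1) * curveDerivation F b) =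
      curveRes F hf (g * curveDerivation F b) ^ p := by
  obtain ⟨g, rfl⟩ := AdjoinRoot.mk_surjective g
  obtain ⟨b, rfl⟩ := AdjoinRoot.mk_surjective b
  rw [curveDerivation_mk]
  simp only [← map_mul, ← map_pow]
  rw [curveRes_mk, curveRes_mk, residueMod_cartier p hf hd]

theorem curveRes_mk_of_natDegree_lt (hf : (curvePoly F).Monic) (g : Polynomial K[T;T⁻¹])
    (hg : g.natDegree < (curvePoly F).natDegree) :
    curveRes F hf (AdjoinRoot.mk _ g) =
      (g.coeff ((curvePoly F).natDegree - 1)).coeff (-1) := by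
  rw [curveRes_mk, residueMod_apply, laurentRes_apply,
    (Polynomial.modByMonic_eq_self_iff hf).2 (Polynomial.degree_lt_degree hg)]

theorem curveRes_sum (hf : (curvePoly F).Monic) (hd : 0 < (curvePoly F).natDegree)
    (c : ℕ → K[T;T⁻¹]) :
    curveRes F hf (∑ i ∈ Finset.range (curvePoly F).natDegree,
      AdjoinRoot.of _ (c i) * AdjoinRoot.root _ ^ i) =
      (c ((curvePoly F).natDegree - 1)).coeff (-1) := by
  have h : ∑ i ∈ Finset.range (curvePoly F).natDegree,
      AdjoinRoot.of _ (c i) * AdjoinRoot.root _ ^ i = AdjoinRoot.mk (curvePoly F)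
        (∑ i ∈ Finset.range (curvePoly F).natDegree, Polynomial.C (c i) * Polynomial.X ^ i) := by
    simp
  rw [h, curveRes_mk_of_natDegree_lt, Polynomial.finsetSum_coeff,
    Finset.sum_eq_single ((curvePoly F).natDegree - 1)]
  · simp
  · intro i _ hi
    rw [Polynomial.coeff_C_mul_X_pow, if_neg (Ne.symm hi)]
  · intro h
    exact absurd (Finset.mem_range.2 (by omega)) h
  · refine (Polynomial.natDegree_sum_le_of_forall_le (n := (curvePoly F).natDegree - 1) _ _
      fun i hi => (Polynomial.natDegree_C_mul_X_pow_le _ _).trans ?_).trans_lt (by omega)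
    have := Finset.mem_range.1 hi
    omega

theorem exists_eq_sum_of_mem_adjoin {O : Type*} [CommRing O] [Algebra K O] {u v : O}
    (P : Polynomial (Polynomial K)) (hP : P.Monic) (hP0 : 0 < P.natDegree)
    (h : P.eval₂ (Polynomial.aeval v : Polynomial K →ₐ[K] O).toRingHom u = 0) {a : O}
    (ha : a ∈ Algebra.adjoin K {u, v}) : ∃ c : ℕ → Polynomial K,
      a = ∑ i ∈ Finset.range P.natDegree, Polynomial.aeval v (c i) * u ^ i := by
  let φ : Polynomial K →+* O := (Polynomial.aeval v : Polynomial K →ₐ[K] O).toRingHom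
  obtain ⟨g, rfl⟩ : ∃ g : Polynomial (Polynomial K), a = g.eval₂ φ u := by
    induction ha using Algebra.adjoin_induction with
    | mem x hx =>
      rcases hx with rfl | rfl
      · exact ⟨Polynomial.X, by simp⟩
      · exact ⟨Polynomial.C Polynomial.X, by simp [φ]⟩
    | algebraMap r => exact ⟨Polynomial.C (Polynomial.C r), by simp [φ]⟩
    | add x y _ _ hx hy =>
      obtain ⟨g₁, rfl⟩ := hx
      obtain ⟨g₂, rfl⟩ := hy
      exact ⟨g₁ + g₂, by rw [Polynomial.eval₂_add]⟩
    | mul x y _ _ hx hy =>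
      obtain ⟨g₁, rfl⟩ := hx
      obtain ⟨g₂, rfl⟩ := hy
      exact ⟨g₁ * g₂, by rw [Polynomial.eval₂_mul]⟩
  refine ⟨(g %ₘ P).coeff, ?_⟩
  conv_lhs => rw [← Polynomial.modByMonic_add_div g P]
  rw [Polynomial.eval₂_add, Polynomial.eval₂_mul, show P.eval₂ φ u = 0 from h, zero_mul, add_zero,
    Polynomial.eval₂_eq_sum_range' φ (Polynomial.natDegree_modByMonic_lt g hP ?_)]
  · rfl
  · rintro rfl
    simp at hP0

theorem laurent_coeff_aeval_T (e n : ℤ) (h : ∀ m : ℕ, e * m ≠ n) (q : Polynomial K) :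
    (Polynomial.aeval (T e : K[T;T⁻¹]) q).coeff n = 0 := by
  induction q using Polynomial.induction_on' with
  | add p q hp hq => rw [map_add]; exact (congrArg₂ (· + ·) hp hq).trans (add_zero 0)
  | monomial m a =>
    rw [Polynomial.aeval_monomial, T_pow]
    change (LaurentPolynomial.C a * T _).coeff n = 0
    rw [← single_eq_C_mul_T]
    exact Finsupp.single_eq_of_ne (by rw [mul_comm]; exact (h m).symm)

end CurveResidue

section CurveCharts

open LaurentPolynomial

variable {K : Type*} [Field K] {F : MvPolynomial (Fin 3) K} {d : ℕ}

theorem curvePoly_monic (hF : F.IsHomogeneous d) (hc : F.coeff (Finsupp.single 0 d) = 1) :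
    (curvePoly F).Monic := (monic_aeval_form hF hc _ _).1

theorem natDegree_curvePoly (hF : F.IsHomogeneous d) (hc : F.coeff (Finsupp.single 0 d) = 1) :
    (curvePoly F).natDegree = d := (monic_aeval_form hF hc _ _).2

theorem curve_aeval_of (e : ℤ) (q : Polynomial K) :
    Polynomial.aeval (AdjoinRoot.of (curvePoly F) (T e)) q =
      AdjoinRoot.of _ (Polynomial.aeval (T e : K[T;T⁻¹]) q) := by
  have := Polynomial.aeval_algHom_apply
    ((Algebra.ofId K[T;T⁻¹] (CurveRing F)).restrictScalars K) (T e) q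
  exact this

theorem eval₂_aeval_form {O : Type*} [CommRing O] [Algebra K O] (u v : O) (b c : Polynomial K)
    (G : MvPolynomial (Fin 3) K) :
    (MvPolynomial.aeval ![Polynomial.X, Polynomial.C b, Polynomial.C c] G :
      Polynomial (Polynomial K)).eval₂
      (Polynomial.aeval v : Polynomial K →ₐ[K] O).toRingHom u =
    MvPolynomial.aeval ![u, Polynomial.aeval v b, Polynomial.aeval v c] G := by
  induction G using MvPolynomial.induction_on with
  | C a => simp [IsScalarTower.algebraMap_apply K (Polynomial K) (Polynomial (Polynomial K))]
  | add x y hx hy => rw [map_add, Polynomial.eval₂_add, hx, hy, map_add]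
  | mul_X x i hx =>
    rw [map_mul, Polynomial.eval₂_mul, hx, map_mul, MvPolynomial.aeval_X, MvPolynomial.aeval_X]
    congr 1
    fin_cases i <;> simp

theorem curveRes_eq_zero_of_mem_chartOne (hF : F.IsHomogeneous d)
    (hc : F.coeff (Finsupp.single 0 d) = 1) (hd : 0 < d) {a : CurveRing F}
    (ha : a ∈ Algebra.adjoin K {chartOne F 0, chartOne F 1}) :
    curveRes F (curvePoly_monic hF hc) a = 0 := by
  have hP := monic_aeval_form hF hc (Polynomial.X : Polynomial K) 1
  obtain ⟨c, rfl⟩ := exists_eq_sum_of_mem_adjoin _ hP.1 (by rw [hP.2]; exact hd) (by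
    rw [eval₂_aeval_form]
    convert aeval_chartOne F
    funext i
    fin_cases i <;> simp [chartOne]) ha
  have hdeg := natDegree_curvePoly hF hc
  have := curveRes_sum (curvePoly_monic hF hc) (by omega)
    fun i => Polynomial.aeval (T 1 : K[T;T⁻¹]) (c i)
  rw [laurent_coeff_aeval_T _ _ (by intro m; omega), hdeg] at this
  rw [hP.2, ← this]
  congr 1
  refine Finset.sum_congr rfl fun i _ => ?_
  rw [← curve_aeval_of]
  rfl

theorem curveRes_eq_zero_of_mem_chartTwo (hF : F.IsHomogeneous d)
    (hc : F.coeff (Finsupp.single 0 d) = 1) (j : ℤ) (hj : j + 3 ≤ d) (hd : 0 < d)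
    {a : CurveRing F} (ha : a ∈ Algebra.adjoin K {chartTwo F 0, chartTwo F 2}) :
    curveRes F (curvePoly_monic hF hc) (AdjoinRoot.of _ (T j) * a) = 0 := by
  have hP := monic_aeval_form hF hc 1 (Polynomial.X : Polynomial K)
  obtain ⟨c, rfl⟩ := exists_eq_sum_of_mem_adjoin _ hP.1 (by rw [hP.2]; exact hd) (by
    rw [eval₂_aeval_form]
    convert aeval_chartTwo hF
    funext i
    fin_cases i <;> simp [chartTwo]) ha
  have hdeg := natDegree_curvePoly hF hc
  have := curveRes_sum (curvePoly_monic hF hc) (by omega)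
    fun i => Polynomial.aeval (T (-1) : K[T;T⁻¹]) (c i) * T (j - i)
  rw [laurent_coeff_mul_T, laurent_coeff_aeval_T _ _ (by intro m; omega), hdeg] at this
  rw [hP.2, ← this, Finset.mul_sum]
  congr 1
  refine Finset.sum_congr rfl fun i _ => ?_
  have h0 : chartTwo F 0 = AdjoinRoot.root _ * AdjoinRoot.of _ (T (-1)) := rfl
  have h2 : chartTwo F 2 = AdjoinRoot.of _ (T (-1)) := rfl
  rw [map_mul, ← curve_aeval_of, h0, h2, mul_pow, ← map_pow, T_pow, sub_eq_add_neg,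
      ← curve_of_T_mul,
    mul_neg_one]
  ring

/-- The rescaled derivation adapted to the second chart. -/
theorem curveDerivation_chartTwo (hF : F.IsHomogeneous d) (hd : 3 ≤ d) :
    (-AdjoinRoot.of (curvePoly F) (T (-((d : ℤ) - 3))) • curveDerivation F) (chartTwo F 0) =
      -MvPolynomial.aeval (chartTwo F) (MvPolynomial.pderiv 2 F) ∧
    (-AdjoinRoot.of (curvePoly F) (T (-((d : ℤ) - 3))) • curveDerivation F) (chartTwo F 2) =
      MvPolynomial.aeval (chartTwo F) (MvPolynomial.pderiv 0 F) := by
  have hE := congrArg (MvPolynomial.aeval (chartOne F)) hF.sum_X_mul_pderiv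
  rw [map_sum, Fin.sum_univ_three, map_nsmul, aeval_chartOne, smul_zero] at hE
  simp only [map_mul, MvPolynomial.aeval_X] at hE
  have h0 : chartTwo F 0 = AdjoinRoot.root _ * AdjoinRoot.of _ (T (-1)) := rfl
  have h2 : chartTwo F 2 = AdjoinRoot.of _ (T (-1)) := rfl
  have e0 : chartOne F 0 = AdjoinRoot.root _ := rfl
  have e1 : chartOne F 1 = AdjoinRoot.of _ (T 1) := rfl
  have e2 : chartOne F 2 = 1 := rfl
  have hsc : ∀ i, MvPolynomial.aeval (chartOne F) (MvPolynomial.pderiv i F) =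
      AdjoinRoot.of _ (T ((d : ℤ) - 1)) *
        MvPolynomial.aeval (chartTwo F) (MvPolynomial.pderiv i F) := by
    intro i
    rw [chartOne_eq, (hF.pderiv).aeval_mul_left, ← map_pow, T_pow]
    congr 4
    push_cast [show 1 ≤ d by omega]
    ring
  have hTT : ∀ m n : ℤ, AdjoinRoot.of (curvePoly F) (T m) * AdjoinRoot.of _ (T n) =
    AdjoinRoot.of _ (T (m + n)) := curve_of_T_mul F
  have hone : AdjoinRoot.of (curvePoly F) (T (-((d : ℤ) - 3))) * AdjoinRoot.of _ (T (-2)) *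
      AdjoinRoot.of _ (T ((d : ℤ) - 1)) = 1 := by
    rw [hTT, hTT]
    ring_nf
    simp
  have hm1 : AdjoinRoot.of (curvePoly F) (T (-1)) =
      AdjoinRoot.of _ (T 1) * AdjoinRoot.of _ (T (-2)) := by
    rw [hTT]
    norm_num
  rw [Derivation.smul_apply, Derivation.smul_apply, h0, h2, Derivation.leibniz,
    curveDerivation_of_T, curveDerivation_root]
  simp only [smul_eq_mul, show (-1 - 1 : ℤ) = -2 from rfl]
  push_cast
  rw [e0, e1, e2, hsc, hsc, hsc] at hE
  rw [hsc, hsc, hm1]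
  set F0 := MvPolynomial.aeval (chartTwo F) (MvPolynomial.pderiv 0 F)
  set F1 := MvPolynomial.aeval (chartTwo F) (MvPolynomial.pderiv 1 F)
  set F2 := MvPolynomial.aeval (chartTwo F) (MvPolynomial.pderiv 2 F)
  set τ := AdjoinRoot.of (curvePoly F) (T (-((d : ℤ) - 3)))
  set s := AdjoinRoot.of (curvePoly F) (T (-2))
  constructor
  · linear_combination τ * s * hE - F2 * hone
  · linear_combination F0 * hone

end CurveCharts

section CurveReduced

open LaurentPolynomial

variable {K : Type*} [Field K] {F : MvPolynomial (Fin 3) K} {d : ℕ}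

instance LaurentPolynomial.instUniqueFactorizationMonoid : UniqueFactorizationMonoid K[T;T⁻¹] :=
  UniqueFactorizationMonoid.of_isLocalization (Submonoid.powers (Polynomial.X : Polynomial K)) _

theorem squarefree_curvePoly [IsAlgClosed K] (hF : F.IsHomogeneous d)
    (hc : F.coeff (Finsupp.single 0 d) = 1)
    (hsm : ∀ v : Fin 3 → K, v ≠ 0 →
      ¬ (MvPolynomial.aeval v F = 0 ∧ ∀ i, MvPolynomial.aeval v (MvPolynomial.pderiv i F) = 0)) :
    Squarefree (curvePoly F) := by
  rintro g ⟨h, hg⟩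
  have hu : IsUnit g.leadingCoeff := by
    have hm := curvePoly_monic hF hc
    rw [Polynomial.Monic, hg, Polynomial.leadingCoeff_mul, Polynomial.leadingCoeff_mul,
      mul_assoc] at hm
    exact IsUnit.of_mul_eq_one _ hm
  rcases Nat.eq_zero_or_pos g.natDegree with h0 | h0
  · rw [Polynomial.eq_C_of_natDegree_eq_zero h0]
    rw [Polynomial.leadingCoeff, h0] at hu
    exact hu.map Polynomial.C
  exfalso
  let φ : K[T;T⁻¹] →+* K := LaurentPolynomial.eval₂ (RingHom.id K) 1
  have hφC : ∀ a, φ (LaurentPolynomial.C a) = a := fun a => by simp [φ]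
  have hφT : φ (T 1) = 1 := by simp [φ]
  obtain ⟨r, hr⟩ := IsAlgClosed.exists_root (g.map φ) (by
    rw [Polynomial.degree_map_eq_of_leadingCoeff_ne_zero _ (hu.map φ).ne_zero]
    exact (Polynomial.natDegree_pos_iff_degree_pos.1 h0).ne')
  let χ : Polynomial K[T;T⁻¹] →ₐ[K] K :=
    { Polynomial.eval₂RingHom φ r with
      commutes' := fun a => by
        change Polynomial.eval₂ φ r (Polynomial.C (LaurentPolynomial.C a)) = a
        rw [Polynomial.eval₂_C, hφC] }
  have hχ : ∀ q, χ q = Polynomial.eval₂ φ r q := fun q => rfl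
  have hχg : χ g = 0 := by
    rw [hχ, ← Polynomial.eval_map]
    exact hr
  have hv : ∀ G : MvPolynomial (Fin 3) K, χ (MvPolynomial.aeval (curveVec K) G) =
      MvPolynomial.aeval ![r, 1, 1] G := by
    intro G
    rw [← AlgHom.comp_apply, MvPolynomial.comp_aeval]
    congr 2
    funext i
    fin_cases i <;> simp [hχ, hφT]
  have hD : ∀ D : Derivation K (Polynomial K[T;T⁻¹]) (Polynomial K[T;T⁻¹]),
      χ (D (curvePoly F)) = 0 := by
    intro D
    rw [hg]
    simp only [Derivation.leibniz, smul_eq_mul, map_add, map_mul, hχg]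
    ring
  have hv0 : MvPolynomial.aeval ![r, 1, 1] F = 0 := by
    rw [← hv]
    change χ (curvePoly F) = 0
    rw [hg, map_mul, map_mul, hχg, zero_mul, zero_mul]
  have hp0 := hD (derivativeOver K _)
  have hp1 := hD (coeffwiseDerivation laurentDeriv)
  rw [derivativeOver_curvePoly, hv] at hp0
  rw [coeffwiseDerivation_curvePoly, hv] at hp1
  refine hsm ![r, 1, 1] (fun h => ?_) ⟨hv0, ?_⟩
  · have := congrFun h 1
    simp at this
  · have hE := congrArg (MvPolynomial.aeval ![r, 1, 1]) hF.sum_X_mul_pderiv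
    rw [map_sum, Fin.sum_univ_three, map_nsmul, hv0, smul_zero] at hE
    simp only [map_mul, MvPolynomial.aeval_X, hp0, hp1, mul_zero, zero_add, Matrix.cons_val,
      one_mul] at hE
    intro i
    fin_cases i <;> assumption

theorem isReduced_curveRing [IsAlgClosed K] (hF : F.IsHomogeneous d)
    (hc : F.coeff (Finsupp.single 0 d) = 1)
    (hsm : ∀ v : Fin 3 → K, v ≠ 0 →
      ¬ (MvPolynomial.aeval v F = 0 ∧ ∀ i, MvPolynomial.aeval v (MvPolynomial.pderiv i F) = 0)) :
    IsReduced (CurveRing F) := by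
  refine (Ideal.isRadical_iff_quotient_reduced _).1 ?_
  have h : IsRadical (curvePoly F) := (squarefree_curvePoly hF hc hsm).isRadical
  intro x hx
  obtain ⟨n, hn⟩ := Ideal.mem_radical_iff.1 hx
  exact Ideal.mem_span_singleton.2 (h n x (Ideal.mem_span_singleton.1 hn))

end CurveReduced

section CurveFinal

open LaurentPolynomial

variable {K : Type*} [Field K] {F : MvPolynomial (Fin 3) K} {d : ℕ}

theorem exists_curveRes_ne_zero (hF : F.IsHomogeneous d)
    (hc : F.coeff (Finsupp.single 0 d) = 1) {a : CurveRing F} (ha : a ≠ 0) :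
    ∃ (i : ℕ) (j : ℤ), curveRes F (curvePoly_monic hF hc)
      (AdjoinRoot.root _ ^ i * AdjoinRoot.of _ (T j) * a) ≠ 0 := by
  have hf := curvePoly_monic hF hc
  obtain ⟨r, rfl⟩ := AdjoinRoot.mk_surjective a
  have hr' : AdjoinRoot.mk (curvePoly F) r = AdjoinRoot.mk _ (r %ₘ curvePoly F) := by
    rw [AdjoinRoot.mk_eq_mk]
    exact ⟨r /ₘ curvePoly F, by
      rw [sub_eq_iff_eq_add', Polynomial.modByMonic_add_div]⟩
  have hdpos : curvePoly F ≠ 1 := by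
    intro h
    apply ha
    rw [AdjoinRoot.mk_eq_zero, h]
    exact one_dvd _
  have hlt := Polynomial.natDegree_modByMonic_lt r hf hdpos
  rw [hr'] at ha ⊢
  set s := r %ₘ curvePoly F
  have hs : s ≠ 0 := by
    rintro h
    rw [h, map_zero] at ha
    exact ha rfl
  obtain ⟨m, hm⟩ : ∃ m, s.leadingCoeff.coeff m ≠ 0 := by
    by_contra! h
    exact Polynomial.leadingCoeff_ne_zero.2 hs (by ext m; exact h m)
  refine ⟨(curvePoly F).natDegree - 1 - s.natDegree, -1 - m, ?_⟩
  have e : AdjoinRoot.root (curvePoly F) ^ ((curvePoly F).natDegree - 1 - s.natDegree) *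
      AdjoinRoot.of _ (T (-1 - m)) * AdjoinRoot.mk _ s = AdjoinRoot.mk _
        (Polynomial.C (T (-1 - m)) * (s *
          Polynomial.X ^ ((curvePoly F).natDegree - 1 - s.natDegree))) := by
    simp only [map_mul, map_pow, AdjoinRoot.mk_C, AdjoinRoot.mk_X]
    ring
  rw [e, curveRes_mk_of_natDegree_lt, Polynomial.coeff_C_mul, Polynomial.coeff_mul_X_pow', if_pos,
    mul_comm, laurent_coeff_mul_T]
  · convert hm using 3
    · rw [Polynomial.leadingCoeff]
      congr 1
      omega
    · ring
  · omega
  · refine (Polynomial.natDegree_C_mul_le _ _).trans_lt ?_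
    rw [Polynomial.natDegree_mul_X_pow (hp := hs)]
    omega

/-- On a smooth plane curve of degree at least three the ring of functions on the intersection
of two charts is not, up to Frobenius, the sum of functions on the charts. -/
theorem false_of_splitting_curve [IsAlgClosed K] (p : ℕ) [CharP K p] [Fact p.Prime]
    (hF : F.IsHomogeneous d) (hc : F.coeff (Finsupp.single 0 d) = 1) (hd : 3 ≤ d)
    (hsm : ∀ v : Fin 3 → K, v ≠ 0 →
      ¬ (MvPolynomial.aeval v F = 0 ∧ ∀ i, MvPolynomial.aeval v (MvPolynomial.pderiv i F) = 0))
    (R₁ R₂ R₁₂ : Subring (CurveRing F)) (h₁ : R₁ ≤ R₁₂) (h₂ : R₂ ≤ R₁₂)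
    (hR₁ : ∀ a ∈ R₁, a ∈ Algebra.adjoin K {chartOne F 0, chartOne F 1})
    (hR₂ : ∀ a ∈ R₂, a ∈ Algebra.adjoin K {chartTwo F 0, chartTwo F 2})
    (hsplit : ∀ r ∈ R₁₂, ∃ r₁ ∈ R₁, ∃ r₂ ∈ R₂, r = r₁ + r₂) (e : ℕ)
    (hS : ∀ (i : ℕ) (j : ℤ), (AdjoinRoot.root _ ^ i * AdjoinRoot.of _ (T j)) ^ p ^ e ∈ R₁₂) :
    False := by
  have hf := curvePoly_monic hF hc
  have hdeg := natDegree_curvePoly hF hc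
  have hd0 : 0 < (curvePoly F).natDegree := by omega
  have := isReduced_curveRing hF hc hsm
  have hT := curveDerivation_chartTwo hF hd
  have hmem₁ : ∀ i, chartOne F i ∈ Algebra.adjoin K {chartOne F 0, chartOne F 1} := by
    intro i
    fin_cases i
    · exact Algebra.subset_adjoin (by simp)
    · exact Algebra.subset_adjoin (by simp)
    · exact one_mem _
  have hmem₂ : ∀ i, chartTwo F i ∈ Algebra.adjoin K {chartTwo F 0, chartTwo F 2} := by
    intro i
    fin_cases i
    · exact Algebra.subset_adjoin (by simp)
    · exact one_mem _
    · exact Algebra.subset_adjoin (by simp)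
  have h10 : curveDerivation F (chartOne F 0) =
      -MvPolynomial.aeval (chartOne F) (MvPolynomial.pderiv 1 F) := curveDerivation_root
  have h11 : curveDerivation F (chartOne F 1) =
      MvPolynomial.aeval (chartOne F) (MvPolynomial.pderiv 0 F) := by
    refine (curveDerivation_of_T 1).trans ?_
    simp
  set D' := -AdjoinRoot.of (curvePoly F) (T (-((d : ℤ) - 3))) • curveDerivation F with hD'
  have hDD' : ∀ b, curveDerivation F b = -AdjoinRoot.of (curvePoly F) (T ((d : ℤ) - 3)) * D' b := by
    intro b
    rw [hD', Derivation.smul_apply, smul_eq_mul, ← mul_assoc, neg_mul_neg, curve_of_T_mul]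
    simp
  refine false_of_splitting_of_frobenius p (curveDerivation F) (curveRes F hf)
    (Algebra.adjoin K {chartOne F 0, chartOne F 1}) (Algebra.adjoin K {chartTwo F 0, chartTwo F 2})
    (curveRes_derivation p hf hd0) (curveRes_cartier p hf hd0) ?_ ?_ ?_ ?_
    {z | ∃ (i : ℕ) (j : ℤ), z = AdjoinRoot.root _ ^ i * AdjoinRoot.of _ (T j)} ?_
    R₁ R₂ R₁₂ h₁ h₂ hR₁ hR₂ hsplit e ?_ (AdjoinRoot.root _ ^ (d - 1) * AdjoinRoot.of _ (T (-1)))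
    ⟨d - 1, -1, rfl⟩ ?_
  · intro a ha b hb
    refine curveRes_eq_zero_of_mem_chartOne hF hc (by omega) (mul_mem ha ?_)
    exact derivation_mem_adjoin_of_chart (chartOne F) hmem₁ _
      (P := -MvPolynomial.pderiv 1 F) (by rw [h10, map_neg]) h11 hb
  · intro a ha b hb
    rw [hDD', neg_mul, mul_neg, map_neg, neg_eq_zero, mul_left_comm]
    refine curveRes_eq_zero_of_mem_chartTwo hF hc _ (by omega) (by omega) (mul_mem ha ?_)
    exact derivation_mem_adjoin_of_chart (chartTwo F) hmem₂ _
      (P := -MvPolynomial.pderiv 2 F) (by rw [hT.1, map_neg]) hT.2 hb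
  · intro a ha hDa
    exact exists_pow_eq_of_mem_chart p hF hsm (chartOne F) (aeval_chartOne F)
      (Or.inl ⟨rfl, rfl⟩) rfl _ h10 h11 ha hDa
  · intro a ha hDa
    refine exists_pow_eq_of_mem_chart p hF hsm (chartTwo F) (aeval_chartTwo hF)
      (Or.inr ⟨rfl, rfl⟩) rfl D' hT.1 hT.2 ha ?_
    rw [hD', Derivation.smul_apply, hDa, smul_zero]
  · intro a ha
    by_contra hne
    obtain ⟨i, j, hij⟩ := exists_curveRes_ne_zero hF hc hne
    exact hij (ha _ ⟨i, j, rfl⟩)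
  · rintro _ ⟨i, j, rfl⟩
    exact hS i j
  · rintro ⟨a, ha, b, hb, hab⟩
    have h1 := curveRes_eq_zero_of_mem_chartOne hF hc (by omega) ha
    have h2 := curveRes_eq_zero_of_mem_chartTwo hF hc 0 (by omega) (by omega) hb
    rw [T_zero, map_one, one_mul] at h2
    have h3 := congrArg (curveRes F hf) hab
    rw [map_add, h1, h2, add_zero] at h3
    have e : AdjoinRoot.root (curvePoly F) ^ (d - 1) * AdjoinRoot.of _ (T (-1)) =
        AdjoinRoot.mk _ (Polynomial.C (T (-1)) * Polynomial.X ^ (d - 1)) := by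
      simp only [map_mul, map_pow, AdjoinRoot.mk_C, AdjoinRoot.mk_X]
      ring
    rw [e, curveRes_mk_of_natDegree_lt, hdeg, Polynomial.coeff_C_mul_X_pow, if_pos rfl] at h3
    · have : (T (-1) : K[T;T⁻¹]).coeff (-1) = 1 := Finsupp.single_eq_same
      rw [this] at h3
      exact one_ne_zero h3
    · refine (Polynomial.natDegree_C_mul_X_pow_le _ _).trans_lt ?_
      omega

end CurveFinal

section Depth

open RingTheory.Sequence CategoryTheory Abelian Limits Pointwise

universe u

variable {R : Type u} [CommRing R]

theorem RingTheory.Sequence.isWeaklyRegular_replicate_of_smul_eq {M : Type*} [AddCommGroup M]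
    [Module R M] (r : R) (hr : ∀ m : M, r • m = m) (n : ℕ) :
    IsWeaklyRegular M (List.replicate n r) := by
  induction n generalizing M with
  | zero => simp
  | succ n ih =>
    rw [List.replicate_succ, isWeaklyRegular_cons_iff]
    refine ⟨fun x y h => by simpa [hr] using h, ih fun m => ?_⟩
    obtain ⟨m, rfl⟩ := Submodule.Quotient.mk_surjective _ m
    rw [← Submodule.Quotient.mk_smul, hr]

theorem ModuleCat.subsingleton_ext_of_linearEquiv {N M M' : ModuleCat.{u} R} (e : M ≃ₗ[R] M')
    {i : ℕ} (h : Subsingleton (Ext N M i)) : Subsingleton (Ext N M' i) :=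
  (((extFunctorObj N i).mapIso e.toModuleIso).addCommGroupIsoToAddEquiv).symm.toEquiv.subsingleton
    (β := Ext N M i)

theorem ModuleCat.subsingleton_ext_quotOfList {N : ModuleCat.{u} R} (ss : List R) :
    ∀ (M : ModuleCat.{u} R) (n : ℕ), IsWeaklyRegular M ss →
      (∀ i < ss.length + n, Subsingleton (Ext N M i)) →
      ∀ i < n, Subsingleton (Ext N
        (ModuleCat.of R (M ⧸ (Ideal.ofList ss • ⊤ : Submodule R M))) i) := by
  induction ss with
  | nil =>
    intro M n _ h i hi
    exact subsingleton_ext_of_linearEquiv (Submodule.quotEquivOfEqBot _ (by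
      rw [Ideal.ofList_nil, Submodule.bot_smul])).symm (h i (by simpa using hi))
  | cons s ss ih =>
    intro M n hs h i hi
    rw [isWeaklyRegular_cons_iff] at hs
    refine subsingleton_ext_of_linearEquiv
      (Submodule.quotOfListConsSMulTopEquivQuotSMulTopInner M s ss).symm
      (ih (ModuleCat.of R (QuotSMulTop s M)) n hs.2 (fun j hj => by
      have zero1 := AddCommGrpCat.isZero_of_iff_subsingleton.mpr
        (h j (by simp only [List.length_cons]; omega))
      have zero2 := AddCommGrpCat.isZero_of_iff_subsingleton.mpr
        (h (j + 1) (by simp only [List.length_cons]; omega))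
      exact AddCommGrpCat.subsingleton_of_isZero <| ShortComplex.Exact.isZero_of_both_zeros
        ((Ext.covariant_sequence_exact₃' N hs.1.smulShortComplex_shortExact) j (j + 1) rfl)
        (zero1.eq_zero_of_src _) (zero2.eq_zero_of_tgt _)) i hi)

theorem Submodule.smul_top_ne_top_of_radical_eq {M : Type*} [AddCommGroup M] [Module R M]
    [Module.Finite R M] {I I' : Ideal R} (h : I'.radical = I.radical)
    (hI : I • (⊤ : Submodule R M) ≠ ⊤) : I' • (⊤ : Submodule R M) ≠ ⊤ := by
  intro h'
  obtain ⟨r, hr, hm⟩ := Submodule.exists_sub_one_mem_and_smul_eq_zero_of_fg_of_le_smul I'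
    (⊤ : Submodule R M) Module.Finite.fg_top h'.ge
  obtain ⟨k, hk⟩ : 1 - r ∈ I.radical := by
    rw [← h]; exact Ideal.le_radical (by rw [← neg_sub]; exact I'.neg_mem hr)
  apply hI
  rw [eq_top_iff]
  intro m _
  have : ∀ k : ℕ, (1 - r) ^ k • m = m := by
    intro k
    induction k with
    | zero => simp
    | succ k ih => rw [pow_succ, mul_smul, sub_smul, hm m trivial, one_smul, sub_zero, ih]
  rw [← this k]
  exact Submodule.smul_mem_smul hk trivial

theorem RingTheory.Sequence.exists_isWeaklyRegular_of_smul_top_eq_top {M : Type*} [AddCommGroup M]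
    [Module R M] [Module.Finite R M] {I : Ideal R} (htop : I • (⊤ : Submodule R M) = ⊤)
    (N : Submodule R M) (n : ℕ) :
    ∃ ts : List R, ts.length = n ∧ (∀ r ∈ ts, r ∈ I) ∧ IsWeaklyRegular (M ⧸ N) ts := by
  obtain ⟨r, hr, h⟩ := Submodule.exists_sub_one_mem_and_smul_eq_zero_of_fg_of_le_smul I
    (⊤ : Submodule R M) Module.Finite.fg_top htop.ge
  refine ⟨List.replicate n (1 - r), by simp, fun s hs => ?_,
    isWeaklyRegular_replicate_of_smul_eq _ (fun m => ?_) n⟩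
  · rw [List.eq_of_mem_replicate hs, ← neg_sub]; exact I.neg_mem hr
  · obtain ⟨m, rfl⟩ := Submodule.Quotient.mk_surjective _ m
    rw [← Submodule.Quotient.mk_smul, sub_smul, h m trivial, one_smul, sub_zero]

theorem RingTheory.Sequence.IsWeaklyRegular.exists_quotient [IsNoetherianRing R] {M : Type u}
    [AddCommGroup M] [Module R M] [Module.Finite R M] (I : Ideal R) {rs ss : List R}
    (hrs : IsWeaklyRegular M rs) (hrI : ∀ r ∈ rs, r ∈ I.radical)
    (hss : IsWeaklyRegular M ss) (hsI : ∀ r ∈ ss, r ∈ I) {n : ℕ}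
    (hn : rs.length = ss.length + n) :
    ∃ ts : List R, ts.length = n ∧ (∀ r ∈ ts, r ∈ I) ∧
      IsWeaklyRegular (M ⧸ (Ideal.ofList ss • ⊤ : Submodule R M)) ts := by
  by_cases htop : I • (⊤ : Submodule R M) = ⊤
  · exact exists_isWeaklyRegular_of_smul_top_eq_top htop _ n
  have hsupp : Module.support R (R ⧸ I) = PrimeSpectrum.zeroLocus I := by
    rw [Module.support_eq_zeroLocus, Ideal.annihilator_quotient]
  have hreg : ∀ ss : List R, (∀ r ∈ ss, r ∈ I.radical) → IsWeaklyRegular M ss →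
      IsRegular M ss := by
    exact fun ss hs h => ⟨h, fun h' =>
      Submodule.smul_top_ne_top_of_radical_eq (Ideal.radical_idem I) htop
        (top_le_iff.mp (h'.le.trans (Submodule.smul_mono_left (Ideal.span_le.mpr hs))))⟩
  have hext := ModuleCat.subsingleton_ext_of_exists_isRegular I.radical (ModuleCat.of R (R ⧸ I))
    (by rw [PrimeSpectrum.zeroLocus_radical]; exact hsupp.le) (ModuleCat.of R M)
    (lt_top_iff_ne_top.mpr (Submodule.smul_top_ne_top_of_radical_eq
      (Ideal.radical_idem I) htop)) rs hrI (hreg rs hrI hrs)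
  have hext' := ModuleCat.subsingleton_ext_quotOfList ss (ModuleCat.of R M) n hss
    (by rwa [← hn])
  have hlt : I • (⊤ : Submodule R (M ⧸ (Ideal.ofList ss • ⊤ : Submodule R M))) < ⊤ := by
    rw [lt_top_iff_ne_top]
    intro h
    apply htop
    have h4 := congrArg (Submodule.comap (Submodule.mkQ (Ideal.ofList ss • ⊤ : Submodule R M))) h
    rw [Submodule.comap_smul_top_of_surjective I _ (Submodule.mkQ_surjective _),
      Submodule.comap_top, Submodule.ker_mkQ] at h4
    exact (sup_eq_left.mpr (Submodule.smul_mono_left (Ideal.span_le.mpr hsI))).symm.trans h4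
  obtain ⟨ts, h1, h2, h3⟩ := ModuleCat.exists_isRegular_of_exists_subsingleton_ext I n
    (ModuleCat.of R (M ⧸ (Ideal.ofList ss • ⊤ : Submodule R M))) hlt (ModuleCat.of R (R ⧸ I)) hsupp
    hext'
  exact ⟨ts, h1, h2, h3.1⟩

end Depth

section Grade

open RingTheory.Sequence

universe u

variable {R : Type u} [CommRing R]

theorem RingTheory.Sequence.isWeaklyRegular_self_append_singleton_iff (rs : List R) (r : R) :
    IsWeaklyRegular R (rs ++ [r]) ↔ IsWeaklyRegular R rs ∧
      ∀ x : R, r * x ∈ Ideal.ofList rs → x ∈ Ideal.ofList rs := by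
  rw [isWeaklyRegular_append_iff, isWeaklyRegular_singleton_iff,
    isSMulRegular_quotient_iff_mem_of_smul_mem]
  simp only [smul_eq_mul, Ideal.mul_top]

theorem RingTheory.Sequence.IsWeaklyRegular.exists_append [IsNoetherianRing R] (I : Ideal R)
    {rs ss : List R} (hrs : IsWeaklyRegular R rs) (hrI : ∀ r ∈ rs, r ∈ I.radical)
    (hss : IsWeaklyRegular R ss) (hsI : ∀ r ∈ ss, r ∈ I) {n : ℕ}
    (hn : rs.length = ss.length + n) :
    ∃ ts : List R, ts.length = n ∧ (∀ r ∈ ts, r ∈ I) ∧ IsWeaklyRegular R (ss ++ ts) := by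
  obtain ⟨ts, h1, h2, h3⟩ := hrs.exists_quotient I hrI hss hsI hn
  exact ⟨ts, h1, h2, (isWeaklyRegular_append_iff _ _ _).mpr ⟨hss, h3⟩⟩

/-- The first of the elements of `ts` in `IsWeaklyRegular.exists_append`. -/
theorem RingTheory.Sequence.IsWeaklyRegular.exists_mem_regular_mod [IsNoetherianRing R]
    (I : Ideal R) {rs ss : List R} (hrs : IsWeaklyRegular R rs) (hrI : ∀ r ∈ rs, r ∈ I.radical)
    (hss : IsWeaklyRegular R ss) (hsI : ∀ r ∈ ss, r ∈ I) (hn : ss.length < rs.length) :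
    ∃ t ∈ I, ∀ x : R, t * x ∈ Ideal.ofList ss → x ∈ Ideal.ofList ss := by
  obtain ⟨n, hn⟩ := Nat.exists_eq_add_of_lt hn
  obtain ⟨ts, h1, h2, h3⟩ := hrs.exists_append I hrI hss hsI (n := n + 1) (by omega)
  match ts, h1 with
  | t :: ts, _ =>
    refine ⟨t, h2 t (by simp), ?_⟩
    rw [List.append_cons, isWeaklyRegular_append_iff] at h3
    exact ((isWeaklyRegular_self_append_singleton_iff _ _).mp h3.1).2

theorem exists_add_mul_regular [IsNoetherianRing R] {K : Type*} [Field K] [Infinite K]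
    [Algebra K R] {J I : Ideal R} {f g : R} (hI : I = J ⊔ Ideal.span {f, g})
    (h : ∃ t ∈ I, ∀ x : R, t * x ∈ J → x ∈ J) :
    ∃ c : K, ∀ x : R, (f + algebraMap K R c * g) * x ∈ J → x ∈ J := by
  by_contra hcon
  push Not at hcon
  have hass : ∀ r : R, (∃ x, r * x ∈ J ∧ x ∉ J) →
      ∃ q ∈ associatedPrimes R (R ⧸ J), r ∈ q := by
    rintro r ⟨x, hx, hx'⟩
    have h1 : r ∈ {r : R | IsSMulRegular (R ⧸ J) r}ᶜ := fun h =>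
      hx' ((isSMulRegular_quotient_iff_mem_of_smul_mem J r).mp h x hx)
    rw [← biUnion_associatedPrimes_eq_compl_regular] at h1
    simpa using h1
  have hJ : ∀ q ∈ associatedPrimes R (R ⧸ J), J ≤ q := by
    intro q hq
    have h1 := IsAssociatedPrime.annihilator_le hq
    rwa [Submodule.annihilator_top, Ideal.annihilator_quotient] at h1
  choose q hq hmem using fun c : K => hass _ (hcon c)
  have hinj : Function.Injective q := by
    intro c c' hcc
    by_contra hne
    have hp : (q c).IsPrime := (hq c).isPrime
    have h1 := hmem c
    have h2 := hmem c'
    rw [← hcc] at h2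
    have hg : g ∈ q c := by
      have h3 := (q c).mul_mem_left (algebraMap K R (c - c')⁻¹) (Ideal.sub_mem _ h1 h2)
      have h4 : algebraMap K R (c - c')⁻¹ * (f + algebraMap K R c * g -
          (f + algebraMap K R c' * g)) = g := by
        have h5 : algebraMap K R (c - c')⁻¹ * algebraMap K R (c - c') = 1 := by
          rw [← map_mul, inv_mul_cancel₀ (sub_ne_zero.mpr hne), map_one]
        rw [map_sub] at h5
        linear_combination g * h5
      rwa [h4] at h3
    have hf : f ∈ q c := by
      simpa using Ideal.sub_mem _ h1 ((q c).mul_mem_left (algebraMap K R c) hg)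
    obtain ⟨t, ht, htreg⟩ := h
    have htq : t ∈ q c := by
      have : I ≤ q c := by
        rw [hI, sup_le_iff, Ideal.span_le]
        refine ⟨hJ _ (hq c), ?_⟩
        rintro z (rfl | rfl)
        exacts [hf, hg]
      exact this ht
    have h6 : t ∈ ⋃ p ∈ associatedPrimes R (R ⧸ J), (p : Set R) :=
      Set.mem_biUnion (hq c) htq
    rw [biUnion_associatedPrimes_eq_compl_regular] at h6
    exact h6 ((isSMulRegular_quotient_iff_mem_of_smul_mem J t).mpr htreg)
  have := (associatedPrimes.finite R (R ⧸ J)).to_subtype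
  exact not_injective_infinite_finite (fun c : K => (⟨q c, hq c⟩ : associatedPrimes R (R ⧸ J)))
    fun c c' h => hinj (congrArg Subtype.val h)

theorem exists_regular_generators [IsNoetherianRing R] [IsDomain R] (K : Type*) [Field K]
    [Infinite K] [Algebra K R] (f : Fin 3 → R) {rs : List R} (hrs : IsWeaklyRegular R rs)
    (hlen : rs.length = 3) (hrI : ∀ r ∈ rs, r ∈ (Ideal.span (Set.range f)).radical) :
    ∃ gs : List R, gs.length = 3 ∧ IsWeaklyRegular R gs ∧
      Ideal.ofList gs = Ideal.span (Set.range f) := by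
  set J := Ideal.span (Set.range f) with hJ
  have hfJ : ∀ i, f i ∈ J := fun i => Ideal.subset_span ⟨i, rfl⟩
  obtain ⟨i, hi⟩ : ∃ i, f i ≠ 0 := by
    by_contra! h
    obtain ⟨t, ht, hreg⟩ := hrs.exists_mem_regular_mod J hrI (ss := []) (by simp) (by simp)
      (by simp [hlen])
    have hJ0 : J = ⊥ := by
      rw [hJ, Ideal.span_eq_bot]; rintro x ⟨j, rfl⟩; exact h j
    rw [hJ0, Ideal.mem_bot] at ht
    simpa using hreg 1 (by simp [ht])
  obtain ⟨j, l, hspan⟩ : ∃ j l, J = Ideal.span {f i} ⊔ Ideal.span {f j, f l} := by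
    have key : ∀ j l, (∀ m, m = i ∨ m = j ∨ m = l) →
        J = Ideal.span {f i} ⊔ Ideal.span {f j, f l} := by
      intro j l hm
      apply le_antisymm
      · rw [hJ, Ideal.span_le]
        rintro _ ⟨m, rfl⟩
        rcases hm m with rfl | rfl | rfl
        · exact Ideal.mem_sup_left (Ideal.mem_span_singleton_self _)
        · exact Ideal.mem_sup_right (Ideal.subset_span (by simp))
        · exact Ideal.mem_sup_right (Ideal.subset_span (by simp))
      · rw [sup_le_iff, Ideal.span_le, Ideal.span_le]
        refine ⟨?_, ?_⟩
        · rintro _ rfl; exact hfJ _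
        · rintro _ (rfl | rfl) <;> exact hfJ _
    have hmem : ∀ i m : Fin 3, m = i ∨ m = i + 1 ∨ m = i + 2 := by decide
    exact ⟨i + 1, i + 2, key _ _ (hmem i)⟩
  have h1 : IsWeaklyRegular R [f i] := by
    rw [isWeaklyRegular_singleton_iff]
    exact fun x y h => mul_left_cancel₀ hi h
  obtain ⟨c, hc⟩ := exists_add_mul_regular (K := K) (J := Ideal.ofList [f i]) (I := J)
    (f := f j) (g := f l) (by simpa using hspan)
    (hrs.exists_mem_regular_mod J hrI h1 (by simp [hfJ]) (by simp [hlen]))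
  set g := f j + algebraMap K R c * f l with hg
  have hgJ : g ∈ J := J.add_mem (hfJ _) (J.mul_mem_left _ (hfJ _))
  have h2 : IsWeaklyRegular R ([f i] ++ [g]) :=
    (isWeaklyRegular_self_append_singleton_iff _ _).mpr ⟨h1, hc⟩
  have hJ' : J = Ideal.ofList ([f i] ++ [g]) ⊔ Ideal.span {f l} := by
    apply le_antisymm
    · rw [hspan, sup_le_iff, Ideal.span_le, Ideal.span_le]
      have hfi : f i ∈ Ideal.ofList ([f i] ++ [g]) := Ideal.subset_span (by simp)
      have hgi : g ∈ Ideal.ofList ([f i] ++ [g]) := Ideal.subset_span (by simp)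
      have hl : f l ∈ Ideal.ofList ([f i] ++ [g]) ⊔ Ideal.span {f l} :=
        Ideal.mem_sup_right (Ideal.mem_span_singleton_self _)
      refine ⟨?_, ?_⟩
      · rintro _ rfl; exact Ideal.mem_sup_left hfi
      · rintro _ (rfl | rfl)
        · have := Ideal.sub_mem _ (Ideal.mem_sup_left hgi) (Ideal.mul_mem_left _
            (algebraMap K R c) hl)
          simpa [hg] using this
        · exact hl
    · rw [sup_le_iff, Ideal.ofList, Ideal.span_le, Ideal.span_le]
      refine ⟨?_, ?_⟩
      · intro x hx
        have : x = f i ∨ x = g := by simpa using hx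
        rcases this with rfl | rfl
        exacts [hfJ _, hgJ]
      · rintro _ rfl; exact hfJ _
  obtain ⟨t, ht, hreg⟩ := hrs.exists_mem_regular_mod J hrI h2 (by simp [hfJ, hgJ])
    (by simp [hlen])
  refine ⟨[f i] ++ [g] ++ [f l], by simp, (isWeaklyRegular_self_append_singleton_iff _ _).mpr
    ⟨h2, fun x hx => hreg x ?_⟩, ?_⟩
  · rw [hJ'] at ht
    obtain ⟨a, ha, b, hb, rfl⟩ := Submodule.mem_sup.mp ht
    obtain ⟨b, rfl⟩ := Ideal.mem_span_singleton'.mp hb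
    rw [add_mul, mul_assoc]
    exact Ideal.add_mem _ (Ideal.mul_mem_right _ _ ha) (Ideal.mul_mem_left _ _ hx)
  · rw [Ideal.ofList_append, Ideal.ofList_singleton, ← hJ']

theorem mem_of_mul_mem_of_regular [IsNoetherianRing R] {J : Ideal R} {rs gs : List R} (s : R)
    (hrs : IsWeaklyRegular R rs) (hrI : ∀ r ∈ rs, r ∈ J.radical ∨ r = s)
    (hgs : IsWeaklyRegular R gs) (hgJ : Ideal.ofList gs = J) (hlen : gs.length < rs.length)
    (x : R) (hx : s * x ∈ J) : x ∈ J := by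
  subst hgJ
  have hrI' : ∀ r ∈ rs, r ∈ (Ideal.ofList gs ⊔ Ideal.span {s}).radical := by
    intro r hr
    rcases hrI r hr with h | rfl
    · exact Ideal.radical_mono le_sup_left h
    · exact Ideal.le_radical (Ideal.mem_sup_right (Ideal.mem_span_singleton_self _))
  obtain ⟨t, ht, hreg⟩ := hrs.exists_mem_regular_mod _ hrI' hgs
    (fun r hr => Ideal.mem_sup_left (Ideal.subset_span hr)) hlen
  obtain ⟨a, ha, b, hb, rfl⟩ := Submodule.mem_sup.mp ht
  obtain ⟨b, rfl⟩ := Ideal.mem_span_singleton'.mp hb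
  refine hreg x ?_
  rw [add_mul, mul_assoc]
  exact Ideal.add_mem _ (Ideal.mul_mem_right _ _ ha) (Ideal.mul_mem_left _ _ hx)

theorem exists_regular_triple_quotient [IsNoetherianRing R] {J : Ideal R} {rs gs : List R}
    (hrs : IsWeaklyRegular R rs) (hgs : IsWeaklyRegular R gs) (hgJ : Ideal.ofList gs = J)
    (hlen : rs.length = gs.length + 3) {A : Type*} [CommRing A] (π : R →+* A)
    (hπ : Function.Surjective π) (hker : ∀ x, π x = 0 ↔ x ∈ J) (N : Ideal A)
    (hN : ∀ r ∈ rs, π r ∈ N.radical) :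
    ∃ r₁ ∈ N, ∃ r₂ ∈ N, ∃ r₃ ∈ N, (∀ x, r₁ * x = 0 → x = 0) ∧
      (∀ x, r₂ * x ∈ Ideal.span {r₁} → x ∈ Ideal.span {r₁}) ∧
      (∀ x, r₃ * x ∈ Ideal.span {r₁, r₂} → x ∈ Ideal.span {r₁, r₂}) := by
  have hgs' : ∀ r ∈ gs, r ∈ J := fun r hr => hgJ ▸ Ideal.subset_span hr
  obtain ⟨ts, h1, h2, h3⟩ := hrs.exists_append (N.comap π)
    (fun r hr => by rw [← Ideal.comap_radical]; exact hN r hr) hgs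
    (fun r hr => by
      rw [Ideal.mem_comap, (hker r).mpr (hgs' r hr)]
      exact N.zero_mem) hlen
  match ts, h1 with
  | [r₁, r₂, r₃], _ =>
    have e : gs ++ [r₁, r₂, r₃] = gs ++ [r₁] ++ [r₂] ++ [r₃] := by simp
    rw [e, isWeaklyRegular_self_append_singleton_iff, isWeaklyRegular_self_append_singleton_iff,
      isWeaklyRegular_self_append_singleton_iff] at h3
    simp only [Ideal.ofList_append, Ideal.ofList_singleton, hgJ] at h3
    obtain ⟨⟨⟨-, k1⟩, k2⟩, k3⟩ := h3
    have hJ : RingHom.ker π = J := Ideal.ext hker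
    have hmap : ∀ (s : Set R) (x : R), π x ∈ Ideal.span (π '' s) ↔ x ∈ J ⊔ Ideal.span s := by
      intro s x
      rw [← Ideal.map_span, ← Ideal.mem_comap,
        Ideal.comap_map_of_surjective _ hπ, ← RingHom.ker_eq_comap_bot, hJ, sup_comm]
    refine ⟨_, h2 r₁ (by simp), _, h2 r₂ (by simp), _, h2 r₃ (by simp), ?_, ?_, ?_⟩
    · intro x
      obtain ⟨x, rfl⟩ := hπ x
      rw [← map_mul, hker, hker]
      exact k1 x
    · intro x
      obtain ⟨x, rfl⟩ := hπ x
      rw [← map_mul, ← Set.image_singleton, hmap, hmap]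
      exact k2 x
    · intro x
      obtain ⟨x, rfl⟩ := hπ x
      rw [← map_mul, ← Set.image_pair, hmap, hmap, Ideal.span_insert, ← sup_assoc]
      exact k3 x

end Grade

section Sequences

open RingTheory.Sequence

variable {R : Type*} [CommRing R]

theorem RingTheory.Sequence.IsWeaklyRegular.append_monic {rs : List R} (h : IsWeaklyRegular R rs)
    {g : Polynomial R} (hg : g.Monic) :
    IsWeaklyRegular (Polynomial R) (rs.map Polynomial.C ++ [g]) := by
  rw [isWeaklyRegular_self_append_singleton_iff]
  refine ⟨h.of_flat, fun x hx => ?_⟩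
  rw [← Ideal.map_ofList] at hx ⊢
  have hker : ∀ y : Polynomial R, y ∈ (Ideal.ofList rs).map Polynomial.C ↔
      y.map (Ideal.Quotient.mk (Ideal.ofList rs)) = 0 := by
    intro y
    rw [← Polynomial.coe_mapRingHom, ← RingHom.mem_ker, Polynomial.ker_mapRingHom, Ideal.mk_ker]
  rw [hker] at hx ⊢
  rwa [Polynomial.map_mul, (hg.map _).mul_right_eq_zero_iff] at hx

end Sequences

section CoordRing

open RingTheory.Sequence

universe u

variable (K : Type u) [Field K]

/-- Polynomials in the coordinates `z_{ij}`, with `z₀₀` and `z₀₁` singled out. -/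
abbrev CoordRing : Type u := Polynomial (Polynomial (MvPolynomial (Fin 2 × Fin 2) K))

/-- The coordinates `z₁₀, z₁₁, z₂₀, z₂₁`. -/
noncomputable def coordLow (v : Fin 2 × Fin 2) : CoordRing K :=
  Polynomial.C (Polynomial.C (MvPolynomial.X v))

/-- The minor of the coordinates `z₁₀, z₁₁, z₂₀, z₂₁`. -/
noncomputable def lowMinor : MvPolynomial (Fin 2 × Fin 2) K :=
  MvPolynomial.X (0, 0) * MvPolynomial.X (1, 1) - MvPolynomial.X (0, 1) * MvPolynomial.X (1, 0)

variable {K}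

theorem MvPolynomial.mem_span_X_image_of_X_mul_mem {σ : Type*} {s : Set σ} {v : σ} (hv : v ∉ s)
    {x : MvPolynomial σ K} (hx : MvPolynomial.X v * x ∈ Ideal.span (MvPolynomial.X '' s)) :
    x ∈ Ideal.span (MvPolynomial.X '' s : Set (MvPolynomial σ K)) := by
  classical
  rw [MvPolynomial.mem_ideal_span_X_image] at hx ⊢
  intro m hm
  obtain ⟨i, hi, h⟩ := hx (Finsupp.single v 1 + m) (by
    rw [MvPolynomial.mem_support_iff] at hm ⊢
    rwa [MvPolynomial.coeff_X_mul])
  refine ⟨i, hi, ?_⟩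
  have : v ≠ i := fun h => hv (h ▸ hi)
  simpa [Finsupp.single_apply, this] using h

theorem isWeaklyRegular_X_lowMinor (v : Fin 2 × Fin 2) :
    IsWeaklyRegular (MvPolynomial (Fin 2 × Fin 2) K) [MvPolynomial.X v, lowMinor K] := by
  rw [← List.singleton_append, isWeaklyRegular_self_append_singleton_iff,
    isWeaklyRegular_singleton_iff]
  refine ⟨fun x y h => mul_left_cancel₀ (MvPolynomial.X_ne_zero v) h, fun x hx => ?_⟩
  rw [Ideal.ofList_singleton, Ideal.mem_span_singleton] at hx ⊢
  refine ((MvPolynomial.X_prime (i := v)).dvd_or_dvd hx).resolve_left fun hdvd => ?_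
  have h2 : ∃ u : Fin 2 × Fin 2 → K, u v = 0 ∧ u (0, 0) * u (1, 1) - u (0, 1) * u (1, 0) ≠ 0 := by
    by_cases h : v = (0, 0) ∨ v = (1, 1)
    · refine ⟨fun w => if w = (0, 1) ∨ w = (1, 0) then 1 else 0, ?_, by simp⟩
      rcases h with rfl | rfl <;> simp
    · refine ⟨fun w => if w = (0, 0) ∨ w = (1, 1) then 1 else 0, ?_, by simp⟩
      simp [h]
  obtain ⟨u, hu, hu'⟩ := h2
  obtain ⟨y, hy⟩ := hdvd
  apply hu'
  have := congrArg (MvPolynomial.eval u) hy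
  simpa [lowMinor, hu] using this

theorem isWeaklyRegular_lowMinor :
    IsWeaklyRegular (MvPolynomial (Fin 2 × Fin 2) K) [lowMinor K] := by
  have h0 : lowMinor K ≠ 0 := by
    intro h
    have := congrArg (MvPolynomial.eval (fun w => if w = (0, 0) ∨ w = (1, 1) then (1 : K) else 0)) h
    simp [lowMinor] at this
  rw [isWeaklyRegular_singleton_iff]
  exact fun x y h => mul_left_cancel₀ h0 h

theorem isWeaklyRegular_X_list {σ : Type*} (l : List σ) (hl : l.Nodup) :
    IsWeaklyRegular (MvPolynomial σ K) (l.map (MvPolynomial.X (R := K))) := by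
  induction l using List.reverseRecOn with
  | nil => simp
  | append_singleton l v ih =>
    rw [List.map_append, List.map_singleton, isWeaklyRegular_self_append_singleton_iff]
    rw [List.nodup_append] at hl
    refine ⟨ih hl.1, ?_⟩
    have h1 : Ideal.ofList (l.map (MvPolynomial.X (R := K))) =
        Ideal.span (MvPolynomial.X '' {v | v ∈ l} : Set (MvPolynomial σ K)) := by
      rw [Ideal.ofList]; congr 1; ext x; simp
    rw [h1]
    have h2 : v ∉ {v | v ∈ l} := fun h => hl.2.2 v h v (by simp) rfl
    exact fun x hx => MvPolynomial.mem_span_X_image_of_X_mul_mem h2 hx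

variable {d : ℕ} {F : MvPolynomial (Fin 3) K}

/-- `F` on the first column of coordinates. -/
noncomputable def colZero (F : MvPolynomial (Fin 3) K) :
    Polynomial (MvPolynomial (Fin 2 × Fin 2) K) :=
  MvPolynomial.aeval ![Polynomial.X, Polynomial.C (MvPolynomial.X (0, 0)),
    Polynomial.C (MvPolynomial.X (1, 0))] F

/-- `F` on the second column of coordinates. -/
noncomputable def colOne (F : MvPolynomial (Fin 3) K) : CoordRing K :=
  MvPolynomial.aeval ![Polynomial.X, coordLow K (0, 1), coordLow K (1, 1)] F

theorem isWeaklyRegular_append_cols (hF : F.IsHomogeneous d)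
    (hc : F.coeff (Finsupp.single 0 d) = 1) {rs : List (MvPolynomial (Fin 2 × Fin 2) K)}
    (h : IsWeaklyRegular (MvPolynomial (Fin 2 × Fin 2) K) rs) :
    IsWeaklyRegular (CoordRing K) (rs.map (fun r => Polynomial.C (Polynomial.C r)) ++
      [Polynomial.C (colZero F), colOne F]) := by
  have hm : (colOne F).Monic := (monic_aeval_form hF hc
    (Polynomial.C (MvPolynomial.X (0, 1) : MvPolynomial (Fin 2 × Fin 2) K))
    (Polynomial.C (MvPolynomial.X (1, 1)))).1
  have h1 := (h.append_monic (monic_aeval_form hF hc (MvPolynomial.X (0, 0))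
    (MvPolynomial.X (1, 0))).1).append_monic hm
  rw [List.map_append, List.map_map, List.append_assoc] at h1
  exact h1

variable [Infinite K]

theorem coordRing_regularity (hF : F.IsHomogeneous d)
    (hc : F.coeff (Finsupp.single 0 d) = 1) (f : Fin 3 → CoordRing K)
    (hΔ : Polynomial.C (Polynomial.C (lowMinor K)) ∈ (Ideal.span (Set.range f)).radical)
    (h0 : Polynomial.C (colZero F) ∈ (Ideal.span (Set.range f)).radical)
    (h1 : colOne F ∈ (Ideal.span (Set.range f)).radical) :
    (∀ v x, coordLow K v * x ∈ Ideal.span (Set.range f) → x ∈ Ideal.span (Set.range f)) ∧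
    ∀ {A : Type u} [CommRing A] (π : CoordRing K →+* A), Function.Surjective π →
      (∀ x, π x = 0 ↔ x ∈ Ideal.span (Set.range f)) → ∀ N : Ideal A,
      (∀ v, π (coordLow K v) ∈ N.radical) →
      ∃ r₁ ∈ N, ∃ r₂ ∈ N, ∃ r₃ ∈ N, (∀ x, r₁ * x = 0 → x = 0) ∧
        (∀ x, r₂ * x ∈ Ideal.span {r₁} → x ∈ Ideal.span {r₁}) ∧
        (∀ x, r₃ * x ∈ Ideal.span {r₁, r₂} → x ∈ Ideal.span {r₁, r₂}) := by
  set J := Ideal.span (Set.range f)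
  obtain ⟨gs, hlen, hgs, hgJ⟩ := exists_regular_generators K f
    (isWeaklyRegular_append_cols hF hc isWeaklyRegular_lowMinor) (by simp) (by
      intro r hr
      have : r = Polynomial.C (Polynomial.C (lowMinor K)) ∨ r = Polynomial.C (colZero F) ∨
        r = colOne F := by simpa using hr
      rcases this with rfl | rfl | rfl <;> assumption)
  refine ⟨fun v x hx => ?_, fun {A} _ π hπ hker N hN => ?_⟩
  · refine mem_of_mul_mem_of_regular (coordLow K v) (isWeaklyRegular_append_cols hF hc
      (isWeaklyRegular_X_lowMinor v)) ?_ hgs hgJ (by simp [hlen]) x hx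
    intro r hr
    have : r = coordLow K v ∨ r = Polynomial.C (Polynomial.C (lowMinor K)) ∨
        r = Polynomial.C (colZero F) ∨ r = colOne F := by simpa [coordLow] using hr
    rcases this with rfl | rfl | rfl | rfl
    · exact Or.inr rfl
    all_goals exact Or.inl (by assumption)
  · refine exists_regular_triple_quotient (isWeaklyRegular_append_cols hF hc
      (isWeaklyRegular_X_list [(0, 0), (0, 1), (1, 0), (1, 1)] (by decide))) hgs hgJ
      (by simp [hlen]) π hπ hker N ?_
    intro r hr
    have hJ : ∀ r ∈ J.radical, π r ∈ N.radical := by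
      rintro r ⟨n, hn⟩
      refine ⟨n, ?_⟩
      rw [← map_pow, (hker _).mpr hn]
      exact N.zero_mem
    have : r = coordLow K (0, 0) ∨ r = coordLow K (0, 1) ∨ r = coordLow K (1, 0) ∨
      r = coordLow K (1, 1) ∨ r = Polynomial.C (colZero F) ∨ r = colOne F := by
        simpa [coordLow] using hr
    rcases this with rfl | rfl | rfl | rfl | rfl | rfl
    · exact hN _
    · exact hN _
    · exact hN _
    · exact hN _
    · exact hJ _ h0
    · exact hJ _ h1

end CoordRing

section Saturation

variable {T : Type*} [CommRing T]

/-- The elements of `T` which become elements of `A` after multiplication by a high power of `a`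
as well as after multiplication by a high power of `b`. -/
def Subring.saturation (A : Subring T) {a b : T} (ha : a ∈ A) (hb : b ∈ A) : Subring T where
  carrier := {s | ∃ n : ℕ, a ^ n * s ∈ A ∧ b ^ n * s ∈ A}
  one_mem' := ⟨0, by simp [A.one_mem]⟩
  zero_mem' := ⟨0, by simp [A.zero_mem]⟩
  neg_mem' := by
    rintro s ⟨n, h1, h2⟩
    exact ⟨n, by rw [mul_neg]; exact A.neg_mem h1, by rw [mul_neg]; exact A.neg_mem h2⟩
  add_mem' := by
    rintro s t ⟨n, h1, h2⟩ ⟨m, h3, h4⟩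
    refine ⟨n + m, ?_, ?_⟩
    · have := A.add_mem (A.mul_mem (A.pow_mem ha m) h1) (A.mul_mem (A.pow_mem ha n) h3)
      convert this using 1; ring
    · have := A.add_mem (A.mul_mem (A.pow_mem hb m) h2) (A.mul_mem (A.pow_mem hb n) h4)
      convert this using 1; ring
  mul_mem' := by
    rintro s t ⟨n, h1, h2⟩ ⟨m, h3, h4⟩
    refine ⟨n + m, ?_, ?_⟩
    · have := A.mul_mem h1 h3
      convert this using 1; ring
    · have := A.mul_mem h2 h4
      convert this using 1; ring

variable {A : Subring T} {a b c e : T}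

theorem Subring.le_saturation (A : Subring T) (ha : a ∈ A) (hb : b ∈ A) : A ≤ A.saturation ha hb :=
  fun s hs => ⟨0, by simpa using hs, by simpa using hs⟩

theorem Subring.saturation_le_left (ha : a ∈ A) (hb : b ∈ A) (hc : c ∈ A) (he : e ∈ A)
    (hac : a * c ∈ A) (hbe : b * e ∈ A) :
    A.saturation ha hb ≤ A.saturation hac hbe := by
  rintro s ⟨n, h1, h2⟩
  refine ⟨n, ?_, ?_⟩
  · rw [mul_pow, mul_right_comm]; exact A.mul_mem h1 (A.pow_mem hc n)
  · rw [mul_pow, mul_right_comm]; exact A.mul_mem h2 (A.pow_mem he n)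

theorem Subring.saturation_le_right (ha : a ∈ A) (hb : b ∈ A) (hc : c ∈ A) (he : e ∈ A)
    (hac : a * c ∈ A) (hbe : b * e ∈ A) :
    A.saturation hc he ≤ A.saturation hac hbe := by
  rintro s ⟨n, h1, h2⟩
  refine ⟨n, ?_, ?_⟩
  · rw [mul_pow, mul_assoc]; exact A.mul_mem (A.pow_mem ha n) h1
  · rw [mul_pow, mul_assoc]; exact A.mul_mem (A.pow_mem hb n) h2

/-- A pair of elements of `A` which is regular on `A`, in terms of elements. -/
structure Subring.RegularPair (A : Subring T) (r₁ r₂ : A) : Prop where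
  fst : ∀ x : A, r₁ * x = 0 → x = 0
  snd : ∀ x : A, r₂ * x ∈ Ideal.span {r₁} → x ∈ Ideal.span {r₁}

theorem Subring.RegularPair.eq_zero {r₁ r₂ : A}
    (hden : ∀ s : T, ∃ m ∈ A, IsUnit m ∧ m * s ∈ A) (h : A.RegularPair r₁ r₂) {s : T}
    (hs : (r₁ : T) * s = 0) : s = 0 := by
  obtain ⟨m, hm, hu, hms⟩ := hden s
  have := h.fst ⟨m * s, hms⟩ (Subtype.ext (by
    change (r₁ : T) * (m * s) = 0
    rw [mul_left_comm, hs, mul_zero]))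
  exact (hu.mul_right_eq_zero).mp (congrArg Subtype.val this)

theorem Subring.RegularPair.exists_eq_mul {r₁ r₂ : A}
    (hden : ∀ s : T, ∃ m ∈ A, IsUnit m ∧ m * s ∈ A) (h : A.RegularPair r₁ r₂) {x y : T}
    (hxy : (r₂ : T) * x = r₁ * y) : ∃ u : T, x = r₁ * u ∧ y = r₂ * u := by
  obtain ⟨m, hm, hu, hmx⟩ := hden x
  obtain ⟨m', hm', hu', hmy⟩ := hden y
  have h1 := h.snd ⟨m' * (m * x), A.mul_mem hm' hmx⟩ (Ideal.mem_span_singleton'.mpr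
    ⟨⟨m * (m' * y), A.mul_mem hm hmy⟩, Subtype.ext (by
      change m * (m' * y) * (r₁ : T) = r₂ * (m' * (m * x))
      linear_combination - m * m' * hxy)⟩)
  obtain ⟨γ, hγ⟩ := Ideal.mem_span_singleton'.mp h1
  have hγ' : (γ : T) * r₁ = m' * (m * x) := congrArg Subtype.val hγ
  obtain ⟨v, hv⟩ := hu'.mul hu
  have hx : x = r₁ * (↑v⁻¹ * γ) := by
    have h2 : (↑v⁻¹ : T) * (m' * m) = 1 := by rw [← hv, Units.inv_mul]
    linear_combination -x * h2 - (↑v⁻¹ : T) * hγ'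
  refine ⟨_, hx, ?_⟩
  have := h.eq_zero hden (s := y - r₂ * (↑v⁻¹ * γ)) (by
    linear_combination -hxy + (r₂ : T) * hx)
  exact sub_eq_zero.mp this

theorem Subring.RegularPair.mem {r₁ r₂ : A}
    (hden : ∀ s : T, ∃ m ∈ A, IsUnit m ∧ m * s ∈ A) (h : A.RegularPair r₁ r₂) {x : T}
    (h1 : (r₁ : T) * x ∈ A) (h2 : (r₂ : T) * x ∈ A) : x ∈ A := by
  have h3 := h.snd ⟨_, h1⟩ (Ideal.mem_span_singleton'.mpr ⟨⟨_, h2⟩, Subtype.ext (by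
    change (r₂ : T) * x * r₁ = r₂ * (r₁ * x)
    ring)⟩)
  obtain ⟨γ, hγ⟩ := Ideal.mem_span_singleton'.mp h3
  have hγ' : (γ : T) * r₁ = r₁ * x := congrArg Subtype.val hγ
  have := h.eq_zero hden (s := γ - x) (by linear_combination hγ')
  rw [← sub_eq_zero.mp this]
  exact γ.2

/-- The Čech `H¹` of the structure sheaf vanishes as soon as the depth is at least three. -/
theorem Subring.exists_add_of_mem_saturation
    (ha : a ∈ A) (hb : b ∈ A) (hc : c ∈ A) (he : e ∈ A)
    (hden : ∀ s : T, ∃ m ∈ A, IsUnit m ∧ m * s ∈ A) (hac : a * c ∈ A) (hbe : b * e ∈ A)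
    {q : ℕ} (hq : q ≠ 0) (hrel : (a * e) ^ q = (b * c) ^ q)
    (hdepth : ∀ N : Ideal A, (⟨a, ha⟩ : A) ∈ N.radical → (⟨b, hb⟩ : A) ∈ N.radical →
      (⟨c, hc⟩ : A) ∈ N.radical → (⟨e, he⟩ : A) ∈ N.radical →
      ∃ r₁ ∈ N, ∃ r₂ ∈ N, ∃ r₃ ∈ N, A.RegularPair r₁ r₂ ∧
        (∀ x, r₃ * x ∈ Ideal.span {r₁, r₂} → x ∈ Ideal.span {r₁, r₂}))
    {s : T} (hs : s ∈ A.saturation hac hbe) :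
    ∃ u ∈ A.saturation ha hb, ∃ v ∈ A.saturation hc he, s = u + v := by
  set G₁ := A.saturation ha hb with hG₁
  set G₂ := A.saturation hc he with hG₂
  have hAG₁ : A ≤ G₁ := A.le_saturation ha hb
  have hAG₂ : A ≤ G₂ := A.le_saturation hc he
  have hinter : ∀ x ∈ G₁, x ∈ G₂ → x ∈ A := by
    rintro x ⟨n, h1, h2⟩ ⟨m, h3, h4⟩
    let N : Ideal A :=
      { carrier := {α | (α : T) * x ∈ A}
        zero_mem' := by simp [A.zero_mem]
        add_mem' := fun {α β} h h' => by
          change ((α : T) + β) * x ∈ A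
          rw [add_mul]; exact A.add_mem h h'
        smul_mem' := fun α β h => by
          change ((α : T) * β) * x ∈ A
          rw [mul_assoc]; exact A.mul_mem α.2 h }
    obtain ⟨r₁, hr₁, r₂, hr₂, -, -, hr, -⟩ := hdepth N ⟨n, h1⟩ ⟨n, h2⟩ ⟨m, h3⟩ ⟨m, h4⟩
    exact hr.mem hden hr₁ hr₂
  let N : Ideal A :=
    { carrier := {α | ∃ u ∈ G₁, ∃ v ∈ G₂, (α : T) * s = u + v}
      zero_mem' := ⟨0, G₁.zero_mem, 0, G₂.zero_mem, by simp⟩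
      add_mem' := by
        rintro α β ⟨u, hu, v, hv, h⟩ ⟨u', hu', v', hv', h'⟩
        refine ⟨_, G₁.add_mem hu hu', _, G₂.add_mem hv hv', ?_⟩
        change ((α : T) + β) * s = _
        linear_combination h + h'
      smul_mem' := by
        rintro α β ⟨u, hu, v, hv, h⟩
        refine ⟨_, G₁.mul_mem (hAG₁ α.2) hu, _, G₂.mul_mem (hAG₂ α.2) hv, ?_⟩
        change ((α : T) * β) * s = _
        linear_combination (α : T) * h }
  obtain ⟨n, hn₁, hn₂⟩ := hs
  obtain ⟨k, hk₁, hk₂⟩ : ∃ k : ℕ, (a * c) ^ (q * k) * s ∈ A ∧ (b * e) ^ (q * k) * s ∈ A := by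
    refine ⟨n, ?_, ?_⟩
    all_goals
      obtain ⟨j, hj⟩ := Nat.exists_eq_add_of_le' (Nat.le_mul_of_pos_left n (Nat.pos_of_ne_zero hq))
      rw [hj, pow_add, mul_assoc]
    · exact A.mul_mem (A.pow_mem hac j) hn₁
    · exact A.mul_mem (A.pow_mem hbe j) hn₂
  have hrel' : a ^ (q * k) * e ^ (q * k) = b ^ (q * k) * c ^ (q * k) := by
    rw [← mul_pow, ← mul_pow, pow_mul, hrel, ← pow_mul]
  have hN : (⟨a, ha⟩ : A) ∈ N.radical ∧ (⟨b, hb⟩ : A) ∈ N.radical ∧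
      (⟨c, hc⟩ : A) ∈ N.radical ∧ (⟨e, he⟩ : A) ∈ N.radical := by
    generalize q * k = m at hk₁ hk₂ hrel'
    rw [mul_pow] at hk₁ hk₂
    have key : ∀ x : T, x ∈ G₁ ∨ x ∈ G₂ → ∃ u ∈ G₁, ∃ v ∈ G₂, x = u + v := by
      rintro x (h | h)
      · exact ⟨x, h, 0, G₂.zero_mem, by simp⟩
      · exact ⟨0, G₁.zero_mem, x, h, by simp⟩
    refine ⟨⟨m, key (a ^ m * s) (Or.inr ⟨2 * m, ?_, ?_⟩)⟩,
      ⟨m, key (b ^ m * s) (Or.inr ⟨2 * m, ?_, ?_⟩)⟩,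
      ⟨m, key (c ^ m * s) (Or.inl ⟨2 * m, ?_, ?_⟩)⟩,
      ⟨m, key (e ^ m * s) (Or.inl ⟨2 * m, ?_, ?_⟩)⟩⟩
    · convert A.mul_mem (A.pow_mem hc m) hk₁ using 1; ring
    · convert A.mul_mem (A.pow_mem hc m) hk₂ using 1
      linear_combination (e ^ m * s) * hrel'
    · convert A.mul_mem (A.pow_mem he m) hk₁ using 1
      linear_combination -(c ^ m * s) * hrel'
    · convert A.mul_mem (A.pow_mem he m) hk₂ using 1; ring
    · convert A.mul_mem (A.pow_mem ha m) hk₁ using 1; ring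
    · convert A.mul_mem (A.pow_mem ha m) hk₂ using 1
      linear_combination -(b ^ m * s) * hrel'
    · convert A.mul_mem (A.pow_mem hb m) hk₁ using 1
      linear_combination (a ^ m * s) * hrel'
    · convert A.mul_mem (A.pow_mem hb m) hk₂ using 1; ring
  obtain ⟨r₁, ⟨u₁, hu₁, v₁, hv₁, e₁⟩, r₂, ⟨u₂, hu₂, v₂, hv₂, e₂⟩, r₃, ⟨u₃, hu₃, v₃, hv₃, e₃⟩,
    hr, hr₃⟩ := hdepth N hN.1 hN.2.1 hN.2.2.1 hN.2.2.2
  have hmemA : ∀ (r r' : A) {u v u' v' : T}, u ∈ G₁ → v ∈ G₂ → u' ∈ G₁ → v' ∈ G₂ →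
      (r : T) * s = u + v → (r' : T) * s = u' + v' → (r' : T) * u - r * u' ∈ A := by
    intro r r' u v u' v' hu hv hu' hv' h h'
    refine hinter _ (G₁.sub_mem (G₁.mul_mem (hAG₁ r'.2) hu) (G₁.mul_mem (hAG₁ r.2) hu')) ?_
    have := G₂.sub_mem (G₂.mul_mem (hAG₂ r.2) hv') (G₂.mul_mem (hAG₂ r'.2) hv)
    convert this using 1
    linear_combination (r : T) * h' - (r' : T) * h
  have h12 := hmemA r₁ r₂ hu₁ hv₁ hu₂ hv₂ e₁ e₂
  have h13 := hmemA r₁ r₃ hu₁ hv₁ hu₃ hv₃ e₁ e₃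
  have h23 := hmemA r₂ r₃ hu₂ hv₂ hu₃ hv₃ e₂ e₃
  have h := hr₃ ⟨_, h12⟩ (Ideal.mem_span_pair.mpr ⟨-⟨_, h23⟩, ⟨_, h13⟩, Subtype.ext (by
    change -((r₃ : T) * u₂ - r₂ * u₃) * r₁ + (r₃ * u₁ - r₁ * u₃) * r₂ =
      r₃ * (r₂ * u₁ - r₁ * u₂)
    ring)⟩)
  obtain ⟨β, α, hαβ⟩ := Ideal.mem_span_pair.mp h
  have hαβ' : (β : T) * r₁ + α * r₂ = r₂ * u₁ - r₁ * u₂ := congrArg Subtype.val hαβ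
  obtain ⟨u, hu, hu'⟩ := hr.exists_eq_mul hden (x := u₁ - α) (y := u₂ + β)
    (by linear_combination -hαβ')
  have hsat : ∀ {a b : T} (ha : a ∈ A) (hb : b ∈ A) (u : T), (r₁ : T) * u ∈ A.saturation ha hb →
      (r₂ : T) * u ∈ A.saturation ha hb → u ∈ A.saturation ha hb := by
    rintro a b ha hb u ⟨n, h1, h2⟩ ⟨m, h3, h4⟩
    refine ⟨m + n, hr.mem hden ?_ ?_, hr.mem hden ?_ ?_⟩
    · convert A.mul_mem (A.pow_mem ha m) h1 using 1; ring
    · convert A.mul_mem (A.pow_mem ha n) h3 using 1; ring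
    · convert A.mul_mem (A.pow_mem hb m) h2 using 1; ring
    · convert A.mul_mem (A.pow_mem hb n) h4 using 1; ring
  refine ⟨u, hsat ha hb u ?_ ?_, s - u, hsat hc he _ ?_ ?_, by ring⟩
  · rw [← hu]; exact G₁.sub_mem hu₁ (hAG₁ α.2)
  · rw [← hu']; exact G₁.add_mem hu₂ (hAG₁ β.2)
  · convert G₂.add_mem hv₁ (hAG₂ α.2) using 1
    linear_combination e₁ + hu
  · convert G₂.sub_mem hv₂ (hAG₂ β.2) using 1
    linear_combination e₂ + hu'

end Saturation

section GradedCoefficients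

variable {O M : Type*} [CommRing O] [AddCommMonoid M]

theorem AddMonoidAlgebra.coeff_mul_mem_of_forall_mem {B B' B'' : M → AddSubgroup O}
    (hB : ∀ m n, ∀ x ∈ B m, ∀ y ∈ B' n, x * y ∈ B'' (m + n)) {f g : AddMonoidAlgebra O M}
    (hf : ∀ m, f.coeff m ∈ B m) (hg : ∀ m, g.coeff m ∈ B' m) (m : M) :
    (f * g).coeff m ∈ B'' m := by
  classical
  rw [AddMonoidAlgebra.coeff_mul]
  refine AddSubgroup.sum_mem _ fun i _ => AddSubgroup.sum_mem _ fun j _ => ?_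
  dsimp only
  split_ifs with h
  · rw [← h]; exact hB _ _ _ (hf i) _ (hg j)
  · exact AddSubgroup.zero_mem _

/-- The elements of a monoid algebra whose coefficients lie in prescribed subgroups. -/
def AddMonoidAlgebra.gradedSubring (B : M → AddSubgroup O) (h1 : 1 ∈ B 0)
    (hB : ∀ m n, ∀ x ∈ B m, ∀ y ∈ B n, x * y ∈ B (m + n)) : Subring (AddMonoidAlgebra O M) where
  carrier := {f | ∀ m, f.coeff m ∈ B m}
  one_mem' := by
    classical
    intro m
    rw [AddMonoidAlgebra.one_def, AddMonoidAlgebra.coeff_single, Finsupp.single_apply]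
    split_ifs with h
    · rwa [← h]
    · exact AddSubgroup.zero_mem _
  zero_mem' := fun m => by
    rw [AddMonoidAlgebra.coeff_zero]; exact AddSubgroup.zero_mem _
  neg_mem' := fun {f} hf m => by
    rw [AddMonoidAlgebra.coeff_neg]; exact AddSubgroup.neg_mem _ (hf m)
  add_mem' := fun {f g} hf hg m => by
    rw [AddMonoidAlgebra.coeff_add]; exact AddSubgroup.add_mem _ (hf m) (hg m)
  mul_mem' := fun {f g} hf hg m => AddMonoidAlgebra.coeff_mul_mem_of_forall_mem hB hf hg m

theorem AddMonoidAlgebra.single_mem_gradedSubring {B : M → AddSubgroup O} (h1 : 1 ∈ B 0)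
    (hB : ∀ m n, ∀ x ∈ B m, ∀ y ∈ B n, x * y ∈ B (m + n)) {m : M} {x : O} (hx : x ∈ B m) :
    AddMonoidAlgebra.single m x ∈ AddMonoidAlgebra.gradedSubring B h1 hB := by
  classical
  intro n
  rw [AddMonoidAlgebra.coeff_single, Finsupp.single_apply]
  split_ifs with h
  · rwa [← h]
  · exact AddSubgroup.zero_mem _

end GradedCoefficients

section ConstantCoefficient

variable {O : Type*} [CommRing O]

/-- The elements of `O[Y₀, Y₁] ⊆ O[Y₀^±1, Y₁^±1]`. -/
def nonnegSubring (O : Type*) [CommRing O] : Subring (AddMonoidAlgebra O (ℤ × ℤ)) :=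
  AddMonoidAlgebra.gradedSubring
    (fun m => { carrier := {x | ¬ 0 ≤ m → x = 0}
                zero_mem' := fun _ => rfl
                add_mem' := fun hx hy h => by rw [hx h, hy h, add_zero]
                neg_mem' := fun hx h => by rw [hx h, neg_zero] })
    (fun h => absurd le_rfl h)
    (fun m n x hx y hy h => by
      by_cases hm : 0 ≤ m
      · by_cases hn : 0 ≤ n
        · exact absurd (add_nonneg hm hn) h
        · rw [hy hn, mul_zero]
      · rw [hx hm, zero_mul])

theorem mem_nonnegSubring {f : AddMonoidAlgebra O (ℤ × ℤ)} :
    f ∈ nonnegSubring O ↔ ∀ m, ¬ 0 ≤ m → f.coeff m = 0 := Iff.rfl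

theorem coeff_mul_zero_of_mem_nonnegSubring {f g : AddMonoidAlgebra O (ℤ × ℤ)}
    (hf : f ∈ nonnegSubring O) (hg : g ∈ nonnegSubring O) :
    (f * g).coeff 0 = f.coeff 0 * g.coeff 0 := by
  classical
  rw [AddMonoidAlgebra.coeff_mul, Finsupp.sum, Finset.sum_eq_single 0]
  · rw [Finsupp.sum, Finset.sum_eq_single 0]
    · simp
    · intro b _ hb
      rw [if_neg (by simpa using hb)]
    · intro h
      rw [Finsupp.notMem_support_iff.mp h]; simp
  · intro b _ hb
    refine Finset.sum_eq_zero fun c _ => ?_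
    dsimp only
    split_ifs with h
    · by_cases h0 : 0 ≤ b
      · rw [hg c, mul_zero]
        intro hc
        exact hb (((add_eq_zero_iff_of_nonneg h0 hc).mp h).1)
      · rw [hf b h0, zero_mul]
    · rfl
  · intro h
    rw [Finsupp.notMem_support_iff.mp h]; simp

/-- The constant coefficient on `O[Y₀, Y₁]`. -/
def constantCoeffNonneg (O : Type*) [CommRing O] : nonnegSubring O →+* O where
  toFun f := f.1.coeff 0
  map_one' := by
    change (1 : AddMonoidAlgebra O (ℤ × ℤ)).coeff 0 = 1
    exact AddMonoidAlgebra.coeff_one_zero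
  map_zero' := rfl
  map_add' _ _ := rfl
  map_mul' f g := coeff_mul_zero_of_mem_nonnegSubring f.2 g.2

end ConstantCoefficient

section Bidegree

variable {O : Type*} [CommRing O]

/-- The subgroup `O₁ ∩ u^|m| O₂` of `O`, for nonnegative `m`. -/
def bidegreePart (O₁ O₂ : Subring O) (u : Multiplicative ℤ →* O) (m : ℤ × ℤ) : AddSubgroup O where
  carrier := {x | (¬ 0 ≤ m → x = 0) ∧ x ∈ O₁ ∧ x * u (.ofAdd (-(m.1 + m.2))) ∈ O₂}
  zero_mem' := ⟨fun _ => rfl, O₁.zero_mem, by rw [zero_mul]; exact O₂.zero_mem⟩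
  add_mem' := fun hx hy => ⟨fun h => by rw [hx.1 h, hy.1 h, add_zero], O₁.add_mem hx.2.1 hy.2.1,
    by rw [add_mul]; exact O₂.add_mem hx.2.2 hy.2.2⟩
  neg_mem' := fun hx => ⟨fun h => by rw [hx.1 h, neg_zero], O₁.neg_mem hx.2.1,
    by rw [neg_mul]; exact O₂.neg_mem hx.2.2⟩

/-- The elements of `O[Y₀, Y₁]` whose coefficient at `m` lies in `O₁ ∩ u^|m| O₂`. -/
def bidegreeSubring (O₁ O₂ : Subring O) (u : Multiplicative ℤ →* O) :
    Subring (AddMonoidAlgebra O (ℤ × ℤ)) :=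
  AddMonoidAlgebra.gradedSubring (bidegreePart O₁ O₂ u)
    ⟨fun h => absurd le_rfl h, O₁.one_mem, by simp [O₂.one_mem]⟩
    (fun m n x hx y hy => ⟨fun h => by
        by_cases hm : 0 ≤ m
        · by_cases hn : 0 ≤ n
          · exact absurd (add_nonneg hm hn) h
          · rw [hy.1 hn, mul_zero]
        · rw [hx.1 hm, zero_mul], O₁.mul_mem hx.2.1 hy.2.1, by
        have := O₂.mul_mem hx.2.2 hy.2.2
        rw [mul_mul_mul_comm, ← map_mul, ← ofAdd_add] at this
        convert this using 4
        simp only [Prod.fst_add, Prod.snd_add]; ring⟩)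

theorem single_mem_bidegreeSubring {O₁ O₂ : Subring O} {u : Multiplicative ℤ →* O} {m : ℤ × ℤ}
    {x : O} (hm : 0 ≤ m) (h₁ : x ∈ O₁) (h₂ : x * u (.ofAdd (-(m.1 + m.2))) ∈ O₂) :
    AddMonoidAlgebra.single m x ∈ bidegreeSubring O₁ O₂ u :=
  AddMonoidAlgebra.single_mem_gradedSubring _ _ ⟨fun h => absurd hm h, h₁, h₂⟩

end Bidegree

section SplittingFromCohomology

variable {T O : Type*} [CommRing T] [CommRing O]

theorem exists_splitting_of_depth {A : Subring T} {a b c e z₀ z₁ : T} (ha : a ∈ A) (hb : b ∈ A)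
    (hc : c ∈ A) (he : e ∈ A) (hz₀ : z₀ ∈ A) (hz₁ : z₁ ∈ A)
    (hden : ∀ s : T, ∃ m ∈ A, IsUnit m ∧ m * s ∈ A) (hua : IsUnit a) (huc : IsUnit c)
    {q : ℕ} (hq : q ≠ 0) (hrel : (a * e) ^ q = (b * c) ^ q) (hrel₁ : (z₀ * b) ^ q = (z₁ * a) ^ q)
    (hdepth : ∀ N : Ideal A, (⟨a, ha⟩ : A) ∈ N.radical → (⟨b, hb⟩ : A) ∈ N.radical →
      (⟨c, hc⟩ : A) ∈ N.radical → (⟨e, he⟩ : A) ∈ N.radical →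
      ∃ r₁ ∈ N, ∃ r₂ ∈ N, ∃ r₃ ∈ N, A.RegularPair r₁ r₂ ∧
        (∀ x, r₃ * x ∈ Ideal.span {r₁, r₂} → x ∈ Ideal.span {r₁, r₂}))
    (O₁ O₂ : Subring O) (u : Multiplicative ℤ →* O) (x : O)
    (Ψ : T →+* AddMonoidAlgebra O (ℤ × ℤ)) (hΨ : ∀ α ∈ A, Ψ α ∈ bidegreeSubring O₁ O₂ u)
    (hΨa : Ψ a = .single (1, 0) (u (.ofAdd 1))) (hΨb : Ψ b = .single (0, 1) (u (.ofAdd 1)))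
    (hΨc : Ψ c = .single (1, 0) 1) (hΨe : Ψ e = .single (0, 1) 1)
    (hΨz : Ψ z₀ = .single (1, 0) x) :
    ∃ R₁ R₂ R₁₂ : Subring O, R₁ ≤ R₁₂ ∧ R₂ ≤ R₁₂ ∧ R₁ ≤ O₁ ∧ R₂ ≤ O₂ ∧
      (∀ r ∈ R₁₂, ∃ r₁ ∈ R₁, ∃ r₂ ∈ R₂, r = r₁ + r₂) ∧
      ∀ (i : ℕ) (j : ℤ), (x ^ i * u (.ofAdd j)) ^ q ∈ R₁₂ := by
  have hac := A.mul_mem ha hc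
  have hbe := A.mul_mem hb he
  have hu : ∀ n : ℤ, u (.ofAdd n) * u (.ofAdd (-n)) = 1 := fun n => by
    rw [← map_mul, ← ofAdd_add, add_neg_cancel, ofAdd_zero, map_one]
  have hupow : ∀ n : ℕ, u (.ofAdd 1) ^ n = u (.ofAdd (n : ℤ)) := fun n => by
    rw [← map_pow, ← ofAdd_nsmul, nsmul_eq_mul, mul_one]
  have hucancel : ∀ (n : ℤ) (y : O), u (.ofAdd n) * y = 0 → y = 0 := fun n y h => by
    linear_combination u (.ofAdd (-n)) * h - y * hu n
  have hshift : ∀ (m k : ℤ × ℤ) (y : O) (f : AddMonoidAlgebra O (ℤ × ℤ)),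
      (AddMonoidAlgebra.single m y * f).coeff (m + k) = y * f.coeff k := fun m k y f => by
    rw [AddMonoidAlgebra.coeff_single_mul_apply]; simp
  have hnonneg : (A.saturation hac hbe).map Ψ ≤ nonnegSubring O := by
    rintro _ ⟨s, ⟨n, h1, h2⟩, rfl⟩
    rw [mem_nonnegSubring]
    intro m hm
    have e1 := (hΨ _ h1 ((2 * (n : ℤ), (0 : ℤ)) + m)).1
    have e2 := (hΨ _ h2 (((0 : ℤ), 2 * (n : ℤ)) + m)).1
    have f1 : Ψ ((a * c) ^ n * s) = .single (2 * n, 0) (u (.ofAdd (n : ℤ))) * Ψ s := by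
      rw [map_mul, map_pow, map_mul, hΨa, hΨc, AddMonoidAlgebra.single_mul_single,
        AddMonoidAlgebra.single_pow, mul_one, hupow]
      congr 2
      ext <;> simp; ring
    have f2 : Ψ ((b * e) ^ n * s) = .single (0, 2 * n) (u (.ofAdd (n : ℤ))) * Ψ s := by
      rw [map_mul, map_pow, map_mul, hΨb, hΨe, AddMonoidAlgebra.single_mul_single,
        AddMonoidAlgebra.single_pow, mul_one, hupow]
      congr 2
      ext <;> simp; ring
    rw [f1, hshift] at e1
    rw [f2, hshift] at e2
    by_cases hm2 : 0 ≤ m.2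
    · refine hucancel _ _ (e2 fun h => hm ⟨?_, hm2⟩)
      simpa using h.1
    · refine hucancel _ _ (e1 fun h => hm2 ?_)
      simpa using h.2
  let R : Subring T → Subring O := fun G =>
    ((G.map Ψ).comap (nonnegSubring O).subtype).map (constantCoeffNonneg O)
  have hR : ∀ G : Subring T, G ≤ A.saturation hac hbe → ∀ s ∈ G, (Ψ s).coeff 0 ∈ R G :=
    fun G hG s hs => ⟨⟨Ψ s, hnonneg ⟨s, hG hs, rfl⟩⟩, ⟨s, hs, rfl⟩, rfl⟩
  have hR' : ∀ G : Subring T, ∀ r ∈ R G, ∃ s ∈ G, (Ψ s).coeff 0 = r := by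
    rintro G _ ⟨⟨_, _⟩, ⟨s, hs, rfl⟩, rfl⟩
    exact ⟨s, hs, rfl⟩
  have hRmono : ∀ {G G' : Subring T}, G ≤ G' → R G ≤ R G' := by
    rintro G G' h _ ⟨f, ⟨s, hs, hf⟩, rfl⟩
    exact ⟨f, ⟨s, h hs, hf⟩, rfl⟩
  have hle₁ := Subring.saturation_le_left ha hb hc he hac hbe
  have hle₂ := Subring.saturation_le_right ha hb hc he hac hbe
  refine ⟨R (A.saturation hc he), R (A.saturation ha hb), R (A.saturation hac hbe),
    hRmono hle₂, hRmono hle₁, ?_, ?_, ?_, ?_⟩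
  · intro r hr
    obtain ⟨s, ⟨n, h1, -⟩, rfl⟩ := hR' _ _ hr
    have e1 := (hΨ _ h1 (((n : ℤ), (0 : ℤ)) + 0)).2.1
    have f1 : Ψ (c ^ n * s) = .single (n, 0) 1 * Ψ s := by
      rw [map_mul, map_pow, hΨc, AddMonoidAlgebra.single_pow, one_pow]
      simp
    rwa [f1, hshift, one_mul] at e1
  · intro r hr
    obtain ⟨s, ⟨n, h1, -⟩, rfl⟩ := hR' _ _ hr
    have e1 := (hΨ _ h1 (((n : ℤ), (0 : ℤ)) + 0)).2.2
    have f1 : Ψ (a ^ n * s) = .single (n, 0) (u (.ofAdd (n : ℤ))) * Ψ s := by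
      rw [map_mul, map_pow, hΨa, AddMonoidAlgebra.single_pow, hupow]
      simp
    rw [f1, hshift] at e1
    convert e1 using 1
    have := hu n
    simp only [add_zero]
    linear_combination -(Ψ s).coeff 0 * this
  · intro r hr
    obtain ⟨s, hs, rfl⟩ := hR' _ _ hr
    obtain ⟨s₁, hs₁, s₂, hs₂, rfl⟩ :=
      Subring.exists_add_of_mem_saturation ha hb hc he hden hac hbe hq hrel hdepth hs
    refine ⟨_, hR _ hle₂ _ hs₂, _, hR _ hle₁ _ hs₁, ?_⟩
    rw [map_add, AddMonoidAlgebra.coeff_add, Finsupp.add_apply, add_comm]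
  · intro i j
    obtain ⟨l, hl⟩ : ∃ l : ℕ, (l : ℤ) = |j| - j := ⟨(|j| - j).toNat, by
      rw [Int.toNat_of_nonneg (by have := le_abs_self j; omega)]⟩
    obtain ⟨j', hj'⟩ : ∃ j' : ℕ, (j' : ℤ) = j + |j| + i := ⟨(j + |j| + i).toNat, by
      rw [Int.toNat_of_nonneg (by have := neg_abs_le j; omega)]⟩
    obtain ⟨n, hn⟩ : ∃ n : ℕ, (n : ℤ) = i + |j| := ⟨i + j.natAbs, by push_cast; rfl⟩
    have hsum : i + j' + l = 2 * n := by omega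
    obtain ⟨v, hv⟩ := ((hua.mul huc).pow (n * q)).exists_right_inv
    set w := (z₀ ^ i * a ^ j' * c ^ l) ^ q * v with hw
    have hw₁ : (a * c) ^ (n * q) * w = (z₀ ^ i * a ^ j' * c ^ l) ^ q := by
      rw [hw]; linear_combination (z₀ ^ i * a ^ j' * c ^ l) ^ q * hv
    have hw₂ : (b * e) ^ (n * q) * w = (z₁ ^ i * b ^ j' * e ^ l) ^ q := by
      have key : (b * e) ^ (n * q) * (z₀ ^ i * a ^ j' * c ^ l) ^ q =
          (a * c) ^ (n * q) * (z₁ ^ i * b ^ j' * e ^ l) ^ q := by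
        obtain ⟨a', ha'⟩ := (hua.pow q).exists_right_inv
        simp only [mul_pow, mul_comm n q, pow_mul, pow_right_comm _ _ q] at hrel hrel₁ ⊢
        have hb' : b ^ q = a' * b ^ q * a ^ q := by linear_combination -b ^ q * ha'
        have he' : e ^ q = a' * b ^ q * c ^ q := by
          linear_combination -e ^ q * ha' + a' * hrel
        have hz' : z₁ ^ q = a' * b ^ q * z₀ ^ q := by
          linear_combination -z₁ ^ q * ha' - a' * hrel₁
        rw [he', hz']
        generalize a' * b ^ q = t at *
        rw [hb']
        have ht : t ^ (2 * n) = t ^ i * t ^ j' * t ^ l := by rw [← pow_add, ← pow_add, hsum]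
        rw [two_mul, pow_add] at ht
        simp only [mul_pow]
        linear_combination (a ^ q) ^ n * (c ^ q) ^ n * (z₀ ^ q) ^ i * (a ^ q) ^ j' *
          (c ^ q) ^ l * ht
      rw [hw]
      linear_combination v * key + (z₁ ^ i * b ^ j' * e ^ l) ^ q * hv
    have hwmem : w ∈ A.saturation hac hbe := ⟨n * q,
      by rw [hw₁]; exact A.pow_mem (A.mul_mem (A.mul_mem (A.pow_mem hz₀ _) (A.pow_mem ha _))
        (A.pow_mem hc _)) _,
      by rw [hw₂]; exact A.pow_mem (A.mul_mem (A.mul_mem (A.pow_mem hz₁ _) (A.pow_mem hb _))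
        (A.pow_mem he _)) _⟩
    convert hR _ le_rfl _ hwmem using 1
    have f1 : Ψ ((a * c) ^ (n * q) * w) =
        .single (2 * (n * q), 0) (u (.ofAdd (n * q : ℤ))) * Ψ w := by
      rw [map_mul, map_pow, map_mul, hΨa, hΨc, AddMonoidAlgebra.single_mul_single,
        AddMonoidAlgebra.single_pow, mul_one, hupow]
      push_cast
      congr 2
      ext <;> simp; ring
    have f2 : Ψ ((z₀ ^ i * a ^ j' * c ^ l) ^ q) =
        .single (2 * (n * q), 0) ((x ^ i * u (.ofAdd (j' : ℤ))) ^ q) := by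
      simp only [map_mul, map_pow, hΨa, hΨc, hΨz, AddMonoidAlgebra.single_mul_single,
        AddMonoidAlgebra.single_pow, mul_one, hupow, one_pow]
      congr 1
      ext
      · have : (i : ℤ) + j' + l = 2 * n := by exact_mod_cast hsum
        simp
        linear_combination (q : ℤ) * this
      · simp
    have h1 := hshift (2 * (n * q : ℤ), (0 : ℤ)) 0 (u (.ofAdd (n * q : ℤ))) (Ψ w)
    rw [← f1, hw₁, f2, add_zero, AddMonoidAlgebra.coeff_single, Finsupp.single_eq_same] at h1
    have h2 := hu (n * q)
    have h3 : u (.ofAdd (j' : ℤ)) ^ q * u (.ofAdd (-(n * q : ℤ))) = u (.ofAdd j) ^ q := by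
      rw [← map_pow u, ← map_pow u, ← map_mul, ← ofAdd_nsmul, ← ofAdd_nsmul, ← ofAdd_add]
      congr 2
      simp only [nsmul_eq_mul]
      linear_combination (q : ℤ) * (hj' - hn)
    rw [mul_pow] at h1 ⊢
    linear_combination (x ^ i) ^ q * -h3 + u (.ofAdd (-(n * q : ℤ))) * h1 + (Ψ w).coeff 0 * h2

end SplittingFromCohomology

section SplittingOfQuotient

variable {R A O : Type*} [CommRing R] [CommRing A] [CommRing O]

theorem exists_splitting_of_depth_of_surjective (π : R →+* A) (hπ : Function.Surjective π)
    {a b c e z₀ z₁ : R} (hreg : ∀ y ∈ ({a, b, c, e} : Set R), ∀ x, π y * x = 0 → x = 0)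
    {q : ℕ} (hq : q ≠ 0) (hrel : π (a * e) ^ q = π (b * c) ^ q)
    (hrel₁ : π (z₀ * b) ^ q = π (z₁ * a) ^ q)
    (hdepth : ∀ N : Ideal A, (∀ y ∈ ({a, b, c, e} : Set R), π y ∈ N.radical) →
      ∃ r₁ ∈ N, ∃ r₂ ∈ N, ∃ r₃ ∈ N, (∀ x, r₁ * x = 0 → x = 0) ∧
        (∀ x, r₂ * x ∈ Ideal.span {r₁} → x ∈ Ideal.span {r₁}) ∧
        (∀ x, r₃ * x ∈ Ideal.span {r₁, r₂} → x ∈ Ideal.span {r₁, r₂}))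
    (O₁ O₂ : Subring O) (u : Multiplicative ℤ →* O) (x : O)
    (ψ : R →+* AddMonoidAlgebra O (ℤ × ℤ)) (hker : ∀ r, π r = 0 → ψ r = 0)
    (hψ : ∀ r, ψ r ∈ bidegreeSubring O₁ O₂ u)
    (hψa : ψ a = .single (1, 0) (u (.ofAdd 1))) (hψb : ψ b = .single (0, 1) (u (.ofAdd 1)))
    (hψc : ψ c = .single (1, 0) 1) (hψe : ψ e = .single (0, 1) 1)
    (hψz : ψ z₀ = .single (1, 0) x) :
    ∃ R₁ R₂ R₁₂ : Subring O, R₁ ≤ R₁₂ ∧ R₂ ≤ R₁₂ ∧ R₁ ≤ O₁ ∧ R₂ ≤ O₂ ∧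
      (∀ r ∈ R₁₂, ∃ r₁ ∈ R₁, ∃ r₂ ∈ R₂, r = r₁ + r₂) ∧
      ∀ (i : ℕ) (j : ℤ), (x ^ i * u (.ofAdd j)) ^ q ∈ R₁₂ := by
  simp only [Set.mem_insert_iff, Set.mem_singleton_iff, forall_eq_or_imp, forall_eq]
    at hreg hdepth
  obtain ⟨hra, hrb, hrc, hre⟩ := hreg
  let s : A := π (a * b * c * e)
  have hs : s ∈ nonZeroDivisors A := by
    rw [mem_nonZeroDivisors_iff_left]
    intro x hx
    refine hra _ (hrb _ (hrc _ (hre _ ?_)))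
    simp only [s, map_mul] at hx
    rw [← hx]; ring
  let T := Localization.Away s
  let ι : A →+* T := algebraMap A T
  have hι : Function.Injective ι :=
    IsLocalization.injective T (Submonoid.powers_le.mpr hs)
  obtain ⟨ψ', hψ'⟩ : ∃ ψ' : A →+* AddMonoidAlgebra O (ℤ × ℤ), ∀ r, ψ' (π r) = ψ r :=
    ⟨π.liftOfSurjective hπ ⟨ψ, fun r hr => hker r hr⟩,
      fun r => π.liftOfRightInverse_comp_apply _ _ ⟨ψ, fun r hr => hker r hr⟩ r⟩
  have huu : u (.ofAdd 1) * u (.ofAdd (-1)) = 1 := by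
    rw [← map_mul, ← ofAdd_add, add_neg_cancel, ofAdd_zero, map_one]
  have hunit : IsUnit (ψ' s) := by
    refine IsUnit.of_mul_eq_one (.single (-2, -2) (u (.ofAdd (-1)) * u (.ofAdd (-1)))) ?_
    simp only [s, hψ', map_mul, hψa, hψb, hψc, hψe, AddMonoidAlgebra.single_mul_single]
    rw [AddMonoidAlgebra.one_def]
    congr 1
    linear_combination (u (.ofAdd 1) * u (.ofAdd (-1)) + 1) * huu
  let Ψ : T →+* AddMonoidAlgebra O (ℤ × ℤ) := IsLocalization.Away.lift s hunit
  have hΨ : ∀ r, Ψ (ι (π r)) = ψ r := fun r => by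
    rw [← hψ']; exact IsLocalization.Away.lift_eq s hunit _
  have hmem : ∀ r, ι r ∈ ι.range := fun r => ⟨r, rfl⟩
  have hus : IsUnit (ι s) := IsLocalization.Away.algebraMap_isUnit s
  have hsplit : ι s = ι (π a) * (ι (π b) * ι (π c) * ι (π e)) := by
    simp only [s, map_mul]; ring
  have hsplit' : ι s = ι (π c) * (ι (π a) * ι (π b) * ι (π e)) := by
    simp only [s, map_mul]; ring
  let ε := RingEquiv.ofBijective ι.rangeRestrict
    ⟨fun x y h => hι (congrArg Subtype.val h), ι.rangeRestrict_surjective⟩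
  have hε : ∀ r : A, ε r = ⟨ι r, hmem r⟩ := fun r => rfl
  refine exists_splitting_of_depth (A := ι.range) (hmem (π a)) (hmem (π b)) (hmem (π c))
    (hmem (π e)) (hmem (π z₀)) (hmem (π z₁)) ?_
    (isUnit_of_mul_isUnit_left (hsplit ▸ hus)) (isUnit_of_mul_isUnit_left (hsplit' ▸ hus)) hq
    (by simpa only [map_mul, map_pow] using congrArg ι hrel)
    (by simpa only [map_mul, map_pow] using congrArg ι hrel₁) ?_
    O₁ O₂ u x Ψ ?_ (by rw [hΨ, hψa]) (by rw [hΨ, hψb]) (by rw [hΨ, hψc]) (by rw [hΨ, hψe])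
    (by rw [hΨ, hψz])
  · intro t
    obtain ⟨n, y, hy⟩ := IsLocalization.Away.surj s t
    refine ⟨ι s ^ n, ⟨s ^ n, map_pow _ _ _⟩, hus.pow n, y, ?_⟩
    rw [mul_comm]; exact hy.symm
  · intro N ha hb hc he
    have hrad : ∀ y : A, (⟨ι y, hmem y⟩ : ι.range) ∈ N.radical →
        y ∈ (N.comap (ε : A →+* ι.range)).radical := by
      rintro y ⟨n, hn⟩
      exact ⟨n, by rw [Ideal.mem_comap, map_pow]; exact hn⟩
    obtain ⟨r₁, h₁, r₂, h₂, r₃, h₃, h4, h5, h6⟩ := hdepth (N.comap (ε : A →+* ι.range))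
      ⟨hrad _ ha, hrad _ hb, hrad _ hc, hrad _ he⟩
    refine ⟨ε r₁, h₁, ε r₂, h₂, ε r₃, h₃, ⟨fun x hx => ?_, fun x hx => ?_⟩, fun x hx => ?_⟩
    · obtain ⟨x, rfl⟩ := ε.surjective x
      rw [← map_mul, map_eq_zero_iff ε ε.injective] at hx
      rw [h4 x hx, map_zero]
    · obtain ⟨x, rfl⟩ := ε.surjective x
      obtain ⟨y, hy⟩ := Ideal.mem_span_singleton'.mp hx
      obtain ⟨y, rfl⟩ := ε.surjective y
      rw [← map_mul, ← map_mul] at hy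
      obtain ⟨z, hz⟩ := Ideal.mem_span_singleton'.mp
        (h5 x (Ideal.mem_span_singleton'.mpr ⟨y, ε.injective hy⟩))
      exact Ideal.mem_span_singleton'.mpr ⟨ε z, by rw [← map_mul, hz]⟩
    · obtain ⟨x, rfl⟩ := ε.surjective x
      obtain ⟨y, y', hy⟩ := Ideal.mem_span_pair.mp hx
      obtain ⟨y, rfl⟩ := ε.surjective y
      obtain ⟨y', rfl⟩ := ε.surjective y'
      rw [← map_mul, ← map_mul, ← map_mul, ← map_add] at hy
      obtain ⟨z, z', hz⟩ := Ideal.mem_span_pair.mp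
        (h6 x (Ideal.mem_span_pair.mpr ⟨y, y', ε.injective hy⟩))
      exact Ideal.mem_span_pair.mpr ⟨ε z, ε z', by rw [← map_mul, ← map_mul, ← map_add, hz]⟩
  · rintro _ ⟨y, rfl⟩
    obtain ⟨r, rfl⟩ := hπ y
    rw [hΨ]; exact hψ r

end SplittingOfQuotient

section ReducedMonoidAlgebra

theorem AddMonoidAlgebra.isReduced {O M : Type*} [CommRing O] [IsReduced O] [AddCommMonoid M]
    [UniqueSums M] : IsReduced (AddMonoidAlgebra O M) := by
  refine ⟨fun f hf => ?_⟩
  ext m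
  rw [AddMonoidAlgebra.coeff_zero, Finsupp.zero_apply]
  refine IsNilpotent.eq_zero ((nilpotent_iff_mem_prime (R := O)).mpr fun P hP => ?_)
  have := (hf.map (AddMonoidAlgebra.mapRingHom M (Ideal.Quotient.mk P))).eq_zero
  have h := congrArg (fun g => g.coeff m) this
  rw [← Ideal.Quotient.eq_zero_iff_mem]
  simpa using h

end ReducedMonoidAlgebra

section CoordLift

universe u

variable (K : Type u) [Field K]

/-- The coordinates `z_{ij}` as elements of `CoordRing K`. -/
noncomputable def coordVar (v : Fin 3 × Fin 2) : CoordRing K :=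
  Fin.cases (motive := fun _ => CoordRing K)
    (if v.2 = 0 then Polynomial.C Polynomial.X else Polynomial.X)
    (fun i => coordLow K (i, v.2)) v.1

variable {K} {B : Type*} [CommRing B] [Algebra K B] (ζ : Fin 3 × Fin 2 → B)

/-- Evaluation of elements of `CoordRing K`. -/
noncomputable def coordLift : CoordRing K →+* B :=
  Polynomial.eval₂RingHom (Polynomial.eval₂RingHom
    (MvPolynomial.aeval (R := K) (fun v : Fin 2 × Fin 2 => ζ (v.1.succ, v.2)) : _ →+* B)
    (ζ (0, 0))) (ζ (0, 1))

theorem coordLift_coordVar (v : Fin 3 × Fin 2) : coordLift ζ (coordVar K v) = ζ v := by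
  obtain ⟨i, j⟩ := v
  induction i using Fin.cases with
  | zero =>
    fin_cases j <;> simp [coordVar, coordLift]
  | succ i => simp [coordVar, coordLift, coordLow]

theorem coordLift_aeval (g : MvPolynomial (Fin 3 × Fin 2) K) :
    coordLift ζ (MvPolynomial.aeval (coordVar K) g) = MvPolynomial.aeval ζ g := by
  induction g using MvPolynomial.induction_on with
  | C a =>
    rw [MvPolynomial.aeval_C, MvPolynomial.aeval_C]
    change coordLift ζ (Polynomial.C (Polynomial.C (MvPolynomial.C a))) = _
    simp [coordLift]
  | add p q hp hq => simp only [map_add, hp, hq]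
  | mul_X p i hp => simp only [map_mul, hp, MvPolynomial.aeval_X, coordLift_coordVar]

theorem coordLift_mem {S : Subring B} (hS : ∀ a : K, algebraMap K B a ∈ S) (hζ : ∀ v, ζ v ∈ S)
    (r : CoordRing K) : coordLift ζ r ∈ S := by
  have h1 : ∀ s : MvPolynomial (Fin 2 × Fin 2) K, MvPolynomial.aeval
      (fun v : Fin 2 × Fin 2 => ζ (v.1.succ, v.2)) s ∈ S := fun s => by
    induction s using MvPolynomial.induction_on with
    | C a => rw [MvPolynomial.aeval_C]; exact hS a
    | add p q hp hq => rw [map_add]; exact S.add_mem hp hq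
    | mul_X p i hp => rw [map_mul, MvPolynomial.aeval_X]; exact S.mul_mem hp (hζ _)
  have h2 : ∀ s : Polynomial (MvPolynomial (Fin 2 × Fin 2) K), Polynomial.eval₂RingHom
      (MvPolynomial.aeval (R := K) (fun v : Fin 2 × Fin 2 => ζ (v.1.succ, v.2)) : _ →+* B)
      (ζ (0, 0)) s ∈ S := fun s => by
    induction s using Polynomial.induction_on' with
    | add p q hp hq => rw [map_add]; exact S.add_mem hp hq
    | monomial n a =>
      rw [Polynomial.coe_eval₂RingHom, Polynomial.eval₂_monomial]
      exact S.mul_mem (h1 a) (S.pow_mem (hζ _) n)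
  induction r using Polynomial.induction_on' with
  | add p q hp hq => rw [map_add]; exact S.add_mem hp hq
  | monomial n a =>
    rw [coordLift, Polynomial.coe_eval₂RingHom, Polynomial.eval₂_monomial]
    exact S.mul_mem (h2 a) (S.pow_mem (hζ _) n)

end CoordLift

section SegrePoint

open LaurentPolynomial

variable {K : Type*} [Field K] (F : MvPolynomial (Fin 3) K)

/-- The homomorphism `n ↦ Tⁿ`. -/
noncomputable def curveUnit : Multiplicative ℤ →* CurveRing F where
  toFun n := AdjoinRoot.of _ (T n.toAdd)
  map_one' := by simp
  map_mul' m n := by rw [curve_of_T_mul]; rfl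

theorem curveUnit_ofAdd (n : ℤ) : curveUnit F (.ofAdd n) = AdjoinRoot.of _ (T n) := rfl

/-- The generic point `((x : T : 1), (Y₀ : Y₁))` of the Segre product. -/
noncomputable def segrePoint (v : Fin 3 × Fin 2) : AddMonoidAlgebra (CurveRing F) (ℤ × ℤ) :=
  AddMonoidAlgebra.single (if v.2 = 0 then (1, 0) else (0, 1)) (chartOne F v.1)

theorem segrePoint_mem (v : Fin 3 × Fin 2) : segrePoint F v ∈ bidegreeSubring
    (Algebra.adjoin K {chartOne F 0, chartOne F 1}).toSubring
    (Algebra.adjoin K {chartTwo F 0, chartTwo F 2}).toSubring (curveUnit F) := by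
  have h₁ : ∀ i, chartOne F i ∈ Algebra.adjoin K {chartOne F 0, chartOne F 1} := by
    intro i
    fin_cases i
    · exact Algebra.subset_adjoin (by simp)
    · exact Algebra.subset_adjoin (by simp)
    · exact one_mem _
  have h₂ : ∀ i, chartTwo F i ∈ Algebra.adjoin K {chartTwo F 0, chartTwo F 2} := by
    intro i
    fin_cases i
    · exact Algebra.subset_adjoin (by simp)
    · exact one_mem _
    · exact Algebra.subset_adjoin (by simp)
  have h₃ : ∀ i, chartOne F i * curveUnit F (.ofAdd (-1)) = chartTwo F i := fun i => by
    rw [chartOne_eq, curveUnit_ofAdd, mul_right_comm, curve_of_T_mul]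
    simp
  refine single_mem_bidegreeSubring ?_ (h₁ v.1) ?_
  · split_ifs <;> simp [Prod.le_def]
  · have : -((if v.2 = 0 then ((1, 0) : ℤ × ℤ) else (0, 1)).1 +
        (if v.2 = 0 then ((1, 0) : ℤ × ℤ) else (0, 1)).2) = -1 := by
      split_ifs <;> rfl
    rw [this, h₃]
    exact h₂ v.1

theorem algebraMap_mem_bidegreeSubring (a : K) :
    algebraMap K (AddMonoidAlgebra (CurveRing F) (ℤ × ℤ)) a ∈ bidegreeSubring
    (Algebra.adjoin K {chartOne F 0, chartOne F 1}).toSubring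
    (Algebra.adjoin K {chartTwo F 0, chartTwo F 2}).toSubring (curveUnit F) := by
  change AddMonoidAlgebra.single 0 (algebraMap K (CurveRing F) a) ∈ _
  refine single_mem_bidegreeSubring le_rfl (Subalgebra.algebraMap_mem _ a) ?_
  simp

/-- Polynomials vanishing on the Segre product vanish at its generic point. -/
theorem aeval_segrePoint_eq_zero [IsReduced (CurveRing F)] {g : MvPolynomial (Fin 3 × Fin 2) K}
    (hg : ∃ N : ℕ, MvPolynomial.rename (Sum.inl : Fin 3 → Fin 3 ⊕ Fin 2) F ∣
      (MvPolynomial.aeval (fun v : Fin 3 × Fin 2 => (MvPolynomial.X (Sum.inl v.1) *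
        MvPolynomial.X (Sum.inr v.2) : MvPolynomial (Fin 3 ⊕ Fin 2) K)) g) ^ N) :
    MvPolynomial.aeval (segrePoint F) g = 0 := by
  have := AddMonoidAlgebra.isReduced (O := CurveRing F) (M := ℤ × ℤ)
  obtain ⟨N, H, hH⟩ := hg
  let θ : Fin 3 ⊕ Fin 2 → AddMonoidAlgebra (CurveRing F) (ℤ × ℤ) :=
    Sum.elim (fun i => AddMonoidAlgebra.single 0 (chartOne F i))
      (fun j => AddMonoidAlgebra.single (if j = 0 then (1, 0) else (0, 1)) 1)
  have h := congrArg (MvPolynomial.aeval θ) hH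
  rw [map_pow, map_mul, MvPolynomial.aeval_rename, ← AlgHom.comp_apply,
    MvPolynomial.comp_aeval] at h
  have h1 : (fun v : Fin 3 × Fin 2 => MvPolynomial.aeval θ (MvPolynomial.X (Sum.inl v.1) *
      MvPolynomial.X (Sum.inr v.2) : MvPolynomial (Fin 3 ⊕ Fin 2) K)) = segrePoint F := by
    funext v
    simp [θ, segrePoint, AddMonoidAlgebra.single_mul_single]
  have h2 : MvPolynomial.aeval (θ ∘ Sum.inl) F = 0 := by
    have : MvPolynomial.aeval (θ ∘ Sum.inl) F = AddMonoidAlgebra.singleZeroAlgHom (R := K)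
        (M := ℤ × ℤ) (MvPolynomial.aeval (chartOne F) F) := by
      rw [← AlgHom.comp_apply, MvPolynomial.comp_aeval]
      rfl
    rw [this, aeval_chartOne, map_zero]
  rw [h1, h2, zero_mul] at h
  exact eq_zero_of_pow_eq_zero h

end SegrePoint

section RadicalTransport

theorem map_mem_radical_span {R S ι : Type*} [CommRing R] [CommRing S] (φ : R →+* S) (f : ι → R)
    {x : R} (hx : x ∈ (Ideal.span (Set.range f)).radical) :
    φ x ∈ (Ideal.span (Set.range fun i => φ (f i))).radical := by
  obtain ⟨n, hn⟩ := hx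
  refine ⟨n, ?_⟩
  have := Ideal.mem_map_of_mem φ hn
  rwa [Ideal.map_span, ← Set.range_comp, map_pow] at this

theorem eventually_pow_char_sub_mem {R : Type*} [CommRing R] (p : ℕ) [Fact p.Prime] [CharP R p]
    {J : Ideal R} {x y : R} (h : x - y ∈ J.radical) :
    ∃ n, ∀ m ≥ n, x ^ p ^ m - y ^ p ^ m ∈ J := by
  obtain ⟨n, hn⟩ := h
  refine ⟨n, fun m hm => ?_⟩
  rw [← sub_pow_char_pow]
  exact J.mem_of_dvd (pow_dvd_pow _
    (hm.trans (Nat.lt_pow_self (Fact.out : p.Prime).one_lt).le)) hn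

theorem exists_surjective_kernel.{u} {R : Type u} [CommRing R] (J : Ideal R) :
    ∃ (A : Type u) (_ : CommRing A) (π : R →+* A), Function.Surjective π ∧
      ∀ x, π x = 0 ↔ x ∈ J :=
  ⟨R ⧸ J, inferInstance, Ideal.Quotient.mk J, Ideal.Quotient.mk_surjective,
    fun _ => Ideal.Quotient.eq_zero_iff_mem⟩

theorem map_eq_zero_of_mem_span {R S ι : Type*} [CommRing R] [CommRing S] (ψ : R →+* S)
    {f : ι → R} (hf : ∀ i, ψ (f i) = 0) {x : R} (hx : x ∈ Ideal.span (Set.range f)) :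
    ψ x = 0 := by
  have : Ideal.span (Set.range f) ≤ RingHom.ker ψ :=
    Ideal.span_le.mpr (by rintro _ ⟨i, rfl⟩; exact hf i)
  exact this hx

end RadicalTransport

section EvalEval

variable {R B D σ τ : Type*} [CommRing R] [CommRing B] [Algebra R B]

theorem MvPolynomial.aeval_aeval (g : τ → B) (h : σ → MvPolynomial τ R) (F : MvPolynomial σ R) :
    aeval g (aeval h F) = aeval (fun i => aeval g (h i)) F := by
  rw [← AlgHom.comp_apply, MvPolynomial.comp_aeval]

theorem Polynomial.C_aeval (g : σ → B) (F : MvPolynomial σ R) :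
    Polynomial.C (MvPolynomial.aeval g F) = MvPolynomial.aeval (fun i => Polynomial.C (g i)) F := by
  exact MvPolynomial.comp_aeval_apply g
    ((Polynomial.CAlgHom : B →ₐ[B] Polynomial B).restrictScalars R) F

end EvalEval

section Core

universe u

variable {K : Type u} [Field K]

theorem aeval_coordVar_minor (i j : Fin 2) :
    MvPolynomial.aeval (coordVar K) (MvPolynomial.X (i.succ, 0) * MvPolynomial.X (j.succ, 1) -
      MvPolynomial.X (j.succ, 0) * MvPolynomial.X (i.succ, 1) : MvPolynomial (Fin 3 × Fin 2) K) =
    coordLow K (i, 0) * coordLow K (j, 1) - coordLow K (j, 0) * coordLow K (i, 1) := by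
  simp [coordVar]

theorem aeval_coordVar_colZero (F : MvPolynomial (Fin 3) K) :
    MvPolynomial.aeval (coordVar K) (MvPolynomial.aeval
      (fun i => (MvPolynomial.X (i, 0) : MvPolynomial (Fin 3 × Fin 2) K)) F) =
    Polynomial.C (colZero F) := by
  have h : (Polynomial.C (colZero F) : CoordRing K) = MvPolynomial.aeval
      (fun i => (Polynomial.C (![Polynomial.X, Polynomial.C (MvPolynomial.X (0, 0)),
        Polynomial.C (MvPolynomial.X (1, 0))] i) : CoordRing K)) F := by
    exact Polynomial.C_aeval _ F
  rw [h]
  refine (MvPolynomial.aeval_aeval (B := CoordRing K) (coordVar K)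
    (fun i => (MvPolynomial.X (i, 0) : MvPolynomial (Fin 3 × Fin 2) K)) F).trans ?_
  congr 2
  funext i
  rw [MvPolynomial.aeval_X]
  fin_cases i <;> simp [coordVar, coordLow] <;> rfl

theorem aeval_coordVar_colOne (F : MvPolynomial (Fin 3) K) :
    MvPolynomial.aeval (coordVar K) (MvPolynomial.aeval
      (fun i => (MvPolynomial.X (i, 1) : MvPolynomial (Fin 3 × Fin 2) K)) F) = colOne F := by
  rw [colOne]
  refine (MvPolynomial.aeval_aeval (B := CoordRing K) (coordVar K)
    (fun i => (MvPolynomial.X (i, 1) : MvPolynomial (Fin 3 × Fin 2) K)) F).trans ?_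
  congr 2
  funext i
  rw [MvPolynomial.aeval_X]
  fin_cases i <;> simp [coordVar] <;> rfl

/-- In positive characteristic, the Segre product of a smooth plane curve of degree at least three
with the projective line is not cut out by three equations. -/
theorem false_of_three_equations_of_charP [IsAlgClosed K] (p : ℕ) [CharP K p] [Fact p.Prime]
    {F : MvPolynomial (Fin 3) K} {d : ℕ} (hF : F.IsHomogeneous d)
    (hc : F.coeff (Finsupp.single 0 d) = 1) (hd : 3 ≤ d)
    (hsm : ∀ v : Fin 3 → K, v ≠ 0 → ¬(MvPolynomial.aeval v F = 0 ∧
      ∀ i, MvPolynomial.aeval v (MvPolynomial.pderiv i F) = 0))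
    (f : Fin 3 → MvPolynomial (Fin 3 × Fin 2) K)
    (hf : ∀ i, ∃ N : ℕ, MvPolynomial.rename (Sum.inl : Fin 3 → Fin 3 ⊕ Fin 2) F ∣
      (MvPolynomial.aeval (fun v : Fin 3 × Fin 2 => (MvPolynomial.X (Sum.inl v.1) *
        MvPolynomial.X (Sum.inr v.2) : MvPolynomial (Fin 3 ⊕ Fin 2) K)) (f i)) ^ N)
    (hminor : ∀ i j : Fin 3, (MvPolynomial.X (i, 0) * MvPolynomial.X (j, 1) -
      MvPolynomial.X (j, 0) * MvPolynomial.X (i, 1) : MvPolynomial (Fin 3 × Fin 2) K) ∈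
      (Ideal.span (Set.range f)).radical)
    (hcol : ∀ j : Fin 2, MvPolynomial.aeval
      (fun i => (MvPolynomial.X (i, j) : MvPolynomial (Fin 3 × Fin 2) K)) F ∈
      (Ideal.span (Set.range f)).radical) : False := by
  have := isReduced_curveRing hF hc hsm
  let φ : MvPolynomial (Fin 3 × Fin 2) K →+* CoordRing K :=
    (MvPolynomial.aeval (coordVar K) : _ →ₐ[K] CoordRing K).toRingHom
  have hlow := map_mem_radical_span (S := CoordRing K) φ f (hminor 1 2)
  have htop := map_mem_radical_span (S := CoordRing K) φ f (hminor 0 1)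
  have hcol0 := map_mem_radical_span (S := CoordRing K) φ f (hcol 0)
  have hcol1 := map_mem_radical_span (S := CoordRing K) φ f (hcol 1)
  have hψf : ∀ i, coordLift (segrePoint F) (φ (f i)) = 0 := fun i =>
    (coordLift_aeval _ _).trans (aeval_segrePoint_eq_zero F (hf i))
  have e1 : φ (MvPolynomial.X (1, 0) * MvPolynomial.X (2, 1) -
      MvPolynomial.X (2, 0) * MvPolynomial.X (1, 1)) =
      coordLow K (0, 0) * coordLow K (1, 1) - coordLow K (0, 1) * coordLow K (1, 0) :=
    (aeval_coordVar_minor 0 1).trans (by ring)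
  have e2 : φ (MvPolynomial.X (0, 0) * MvPolynomial.X (1, 1) -
      MvPolynomial.X (1, 0) * MvPolynomial.X (0, 1)) =
      Polynomial.C Polynomial.X * coordLow K (0, 1) - Polynomial.X * coordLow K (0, 0) := by
    have hX : ∀ v, φ (MvPolynomial.X v) = coordVar K v := MvPolynomial.aeval_X _
    rw [map_sub, map_mul, map_mul, hX, hX, hX, hX, mul_comm (coordVar K (1, 0))]
    rfl
  have e3 : φ (MvPolynomial.aeval (fun i => MvPolynomial.X (i, 0)) F) = Polynomial.C (colZero F) :=
    aeval_coordVar_colZero F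
  have e4 : φ (MvPolynomial.aeval (fun i => MvPolynomial.X (i, 1)) F) = colOne F :=
    aeval_coordVar_colOne F
  rw [e1] at hlow
  rw [e2] at htop
  rw [e3] at hcol0
  rw [e4] at hcol1
  have e5 : coordLow K (0, 0) * coordLow K (1, 1) - coordLow K (0, 1) * coordLow K (1, 0) =
      Polynomial.C (Polynomial.C (lowMinor K)) := by
    simp [coordLow, lowMinor]
  obtain ⟨hreg, hdepth⟩ := coordRing_regularity hF hc (fun i => φ (f i)) (e5 ▸ hlow) hcol0 hcol1
  obtain ⟨A, _, π, hπ, hker⟩ := exists_surjective_kernel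
    (Ideal.span (Set.range fun i => φ (f i)))
  obtain ⟨n₁, hn₁⟩ := eventually_pow_char_sub_mem p hlow
  obtain ⟨n₂, hn₂⟩ := eventually_pow_char_sub_mem p htop
  have hset : ∀ y ∈ ({coordLow K (0, 0), coordLow K (0, 1), coordLow K (1, 0),
      coordLow K (1, 1)} : Set (CoordRing K)), ∃ v, y = coordLow K v := by
    rintro y (rfl | rfl | rfl | rfl) <;> exact ⟨_, rfl⟩
  obtain ⟨R₁, R₂, R₁₂, h₁, h₂, hR₁, hR₂, hsplit, hS⟩ :=
    exists_splitting_of_depth_of_surjective π hπ (a := coordLow K (0, 0)) (b := coordLow K (0, 1))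
      (c := coordLow K (1, 0)) (e := coordLow K (1, 1)) (z₀ := Polynomial.C Polynomial.X)
      (z₁ := Polynomial.X) (q := p ^ max n₁ n₂) (by
        intro y hy x hx
        obtain ⟨v, rfl⟩ := hset y hy
        obtain ⟨x, rfl⟩ := hπ x
        rw [← map_mul, hker] at hx
        exact (hker _).mpr (hreg v x hx))
      (pow_ne_zero _ (Fact.out : p.Prime).ne_zero)
      (by rw [← sub_eq_zero, ← map_pow, ← map_pow, ← map_sub, hker]
          exact hn₁ _ (le_max_left _ _))
      (by rw [← sub_eq_zero, ← map_pow, ← map_pow, ← map_sub, hker]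
          exact hn₂ _ (le_max_right _ _))
      (fun N hN => hdepth π hπ hker N fun v => hN _ (by
        obtain ⟨i, j⟩ := v
        fin_cases i <;> fin_cases j <;> simp))
      (Algebra.adjoin K {chartOne F 0, chartOne F 1}).toSubring
      (Algebra.adjoin K {chartTwo F 0, chartTwo F 2}).toSubring (curveUnit F)
      (AdjoinRoot.root _) (coordLift (segrePoint F))
      (fun r hr => map_eq_zero_of_mem_span _ hψf ((hker r).mp hr))
      (coordLift_mem _ (algebraMap_mem_bidegreeSubring F) (segrePoint_mem F))
      (coordLift_coordVar (segrePoint F) (1, 0)) (coordLift_coordVar (segrePoint F) (1, 1))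
      (coordLift_coordVar (segrePoint F) (2, 0)) (coordLift_coordVar (segrePoint F) (2, 1))
      (coordLift_coordVar (segrePoint F) (0, 0))
  exact false_of_splitting_curve p hF hc hd hsm R₁ R₂ R₁₂ h₁ h₂ (fun a ha => hR₁ ha)
    (fun a ha => hR₂ ha) hsplit (max n₁ n₂) hS

end Core

section SegreSystem

variable {R S : Type*} [CommRing R] [CommRing S]

/-- The substitution `z_{ij} ↦ x_i y_j`. -/
noncomputable def segreParam (R : Type*) [CommRing R] :
    MvPolynomial (Fin 3 × Fin 2) R →ₐ[R] MvPolynomial (Fin 3 ⊕ Fin 2) R :=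
  MvPolynomial.aeval fun v => MvPolynomial.X (Sum.inl v.1) * MvPolynomial.X (Sum.inr v.2)

/-- The minors of the generic matrix `(z_{ij})`. -/
noncomputable def segreMinor (R : Type*) [CommRing R] (i j : Fin 3) :
    MvPolynomial (Fin 3 × Fin 2) R :=
  MvPolynomial.X (i, 0) * MvPolynomial.X (j, 1) - MvPolynomial.X (j, 0) * MvPolynomial.X (i, 1)

/-- The value of a ternary form at a column of the generic matrix `(z_{ij})`. -/
noncomputable def segreCol (F : MvPolynomial (Fin 3) R) (j : Fin 2) :
    MvPolynomial (Fin 3 × Fin 2) R :=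
  MvPolynomial.aeval (fun i => MvPolynomial.X (i, j)) F

/-- Three polynomials which define the product of `V₊(F)` and the projective line. -/
structure IsSegreSystem (F : MvPolynomial (Fin 3) R)
    (f : Fin 3 → MvPolynomial (Fin 3 × Fin 2) R) : Prop where
  eqn : ∀ i, segreParam R (f i) ∈
    (Ideal.span (Set.range fun _ : Unit => MvPolynomial.rename Sum.inl F)).radical
  minor : ∀ i j, segreMinor R i j ∈ (Ideal.span (Set.range f)).radical
  col : ∀ j, segreCol F j ∈ (Ideal.span (Set.range f)).radical

/-- A form and its partial derivatives. -/
noncomputable def jacobianFamily (F : MvPolynomial (Fin 3) R) (o : Option (Fin 3)) :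
    MvPolynomial (Fin 3) R :=
  o.elim F fun i => MvPolynomial.pderiv i F

theorem map_segreParam (φ : R →+* S) (g : MvPolynomial (Fin 3 × Fin 2) R) :
    MvPolynomial.map φ (segreParam R g) = segreParam S (MvPolynomial.map φ g) := by
  refine (MvPolynomial.map_bind₁ φ _ g).trans ?_
  rw [segreParam, MvPolynomial.bind₁]
  congr 2
  funext v
  simp

theorem map_segreMinor (φ : R →+* S) (i j : Fin 3) :
    MvPolynomial.map φ (segreMinor R i j) = segreMinor S i j := by
  simp [segreMinor]

theorem map_segreCol (φ : R →+* S) (F : MvPolynomial (Fin 3) R) (j : Fin 2) :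
    MvPolynomial.map φ (segreCol F j) = segreCol (MvPolynomial.map φ F) j := by
  refine (MvPolynomial.map_bind₁ φ _ F).trans ?_
  rw [segreCol, MvPolynomial.bind₁]
  congr 2
  funext v
  simp

theorem map_jacobianFamily (φ : R →+* S) (F : MvPolynomial (Fin 3) R) (o : Option (Fin 3)) :
    MvPolynomial.map φ (jacobianFamily F o) = jacobianFamily (MvPolynomial.map φ F) o := by
  cases o with
  | none => rfl
  | some i => exact MvPolynomial.pderiv_map.symm

theorem map_mem_radical_jacobianFamily (φ : R →+* S) {F : MvPolynomial (Fin 3) R} {i : Fin 3}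
    (h : MvPolynomial.X i ∈ (Ideal.span (Set.range (jacobianFamily F))).radical) :
    MvPolynomial.X i ∈
      (Ideal.span (Set.range (jacobianFamily (MvPolynomial.map φ F)))).radical := by
  have := map_mem_radical_span (MvPolynomial.map φ) _ h
  simpa only [MvPolynomial.map_X, map_jacobianFamily] using this

theorem IsSegreSystem.map (φ : R →+* S) {F : MvPolynomial (Fin 3) R}
    {f : Fin 3 → MvPolynomial (Fin 3 × Fin 2) R} (h : IsSegreSystem F f) :
    IsSegreSystem (MvPolynomial.map φ F) fun i => MvPolynomial.map φ (f i) where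
  eqn i := by
    have := map_mem_radical_span (MvPolynomial.map φ) _ (h.eqn i)
    simpa only [map_segreParam, MvPolynomial.map_rename] using this
  minor i j := by
    have := map_mem_radical_span (MvPolynomial.map φ) _ (h.minor i j)
    simpa only [map_segreMinor] using this
  col j := by
    have := map_mem_radical_span (MvPolynomial.map φ) _ (h.col j)
    simpa only [map_segreCol] using this

end SegreSystem

section Spreading

open Filter

variable {K : Type*} [Field K] {σ : Type*}

/-- A polynomial has coefficients in the subring generated by any large enough finite set. -/
theorem eventually_mem_range_map (P : MvPolynomial σ K) : ∀ᶠ s : Finset K in atTop,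
    ∃ Q : MvPolynomial σ (Algebra.adjoin ℤ (s : Set K)),
      MvPolynomial.map (algebraMap _ K) Q = P := by
  filter_upwards [eventually_ge_atTop P.coeffs] with s hs
  refine MvPolynomial.mem_range_map_iff_coeffs_subset.mpr fun a ha => ?_
  exact ⟨⟨a, Algebra.subset_adjoin (hs ha)⟩, rfl⟩

/-- Membership in the radical of an ideal descends to large enough finitely generated subrings. -/
theorem eventually_mem_radical_span {ι : Type*} [Finite ι] {f : ι → MvPolynomial σ K}
    {x : MvPolynomial σ K} (hx : x ∈ (Ideal.span (Set.range f)).radical) :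
    ∀ᶠ s : Finset K in atTop, ∀ (f' : ι → MvPolynomial σ (Algebra.adjoin ℤ (s : Set K)))
      (x' : MvPolynomial σ (Algebra.adjoin ℤ (s : Set K))),
      (∀ i, MvPolynomial.map (algebraMap _ K) (f' i) = f i) →
      MvPolynomial.map (algebraMap _ K) x' = x → x' ∈ (Ideal.span (Set.range f')).radical := by
  have := Fintype.ofFinite ι
  obtain ⟨n, hn⟩ := hx
  obtain ⟨c, hc⟩ := Ideal.mem_span_range_iff_exists_fun.mp hn
  filter_upwards [eventually_all.mpr fun i => eventually_mem_range_map (c i)]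
    with s hs f' x' hf' hx'
  choose c' hc' using hs
  refine ⟨n, Ideal.mem_span_range_iff_exists_fun.mpr ⟨c', ?_⟩⟩
  refine MvPolynomial.map_injective (algebraMap (Algebra.adjoin ℤ (s : Set K)) K)
    Subtype.val_injective ?_
  simp only [map_sum, map_mul, map_pow, hc', hf', hx', hc]

theorem Int.isJacobsonRing : IsJacobsonRing ℤ := by
  refine isJacobsonRing_iff_prime_eq.mpr fun P hP => ?_
  rcases eq_or_ne P ⊥ with rfl | hP0
  · refine eq_bot_iff.mpr fun x hx => ?_
    have := Int.isUnit_iff.mp (Ideal.mem_jacobson_bot.mp hx (2 * x))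
    rw [Ideal.mem_bot]
    rcases this with h | h <;> nlinarith [sq_nonneg x]
  · have := hP.isMaximal hP0
    exact Ideal.jacobson_eq_self_of_isMaximal

/-- A finitely generated ring has a homomorphism to an algebraically closed field of positive
characteristic. -/
theorem exists_ringHom_isAlgClosed_charP.{u} (D : Type u) [CommRing D] [Nontrivial D]
    [Algebra.FiniteType ℤ D] : ∃ (p : ℕ) (_ : Fact p.Prime) (L : Type u) (_ : Field L)
      (_ : IsAlgClosed L) (_ : CharP L p), Nonempty (D →+* L) := by
  obtain ⟨m, hm⟩ := Ideal.exists_maximal D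
  let _ : Field (D ⧸ m) := Ideal.Quotient.field m
  have := Int.isJacobsonRing
  have : Module.Finite ℤ (D ⧸ m) := finite_of_finite_type_of_isJacobsonRing ℤ (D ⧸ m)
  obtain ⟨p, hp⟩ := CharP.exists (D ⧸ m)
  have hp0 : p ≠ 0 := by
    rintro rfl
    have := CharP.charP_to_charZero (D ⧸ m)
    exact Int.not_isField (isField_of_isIntegral_of_isField (S := D ⧸ m)
      (algebraMap ℤ (D ⧸ m)).injective_int (Field.toIsField _))
  have hprime : Fact p.Prime := ⟨(CharP.char_is_prime_or_zero (D ⧸ m) p).resolve_right hp0⟩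
  exact ⟨p, hprime, AlgebraicClosure (D ⧸ m), inferInstance, inferInstance,
    charP_of_injective_algebraMap (algebraMap (D ⧸ m) _).injective p,
    ⟨(algebraMap (D ⧸ m) (AlgebraicClosure (D ⧸ m))).comp (Ideal.Quotient.mk m)⟩⟩

end Spreading

section Descent

open Filter

/-- The Segre product of a smooth plane curve of degree at least three with the projective line is
not cut out by three equations. -/
theorem IsSegreSystem.false_of_coeff_eq_one {K : Type*} [Field K] {d : ℕ} (hd : 3 ≤ d)
    {F : MvPolynomial (Fin 3) K} {f : Fin 3 → MvPolynomial (Fin 3 × Fin 2) K}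
    (hF : F.IsHomogeneous d) (hc : F.coeff (Finsupp.single 0 d) = 1) (hs : IsSegreSystem F f)
    (hsm : ∀ i, MvPolynomial.X i ∈ (Ideal.span (Set.range (jacobianFamily F))).radical) :
    False := by
  obtain ⟨s, ⟨F', hF'⟩, hf', heqn, hminor, hcol, hjac⟩ := ((eventually_mem_range_map F).and
    ((eventually_all.mpr fun i => eventually_mem_range_map (f i)).and
    ((eventually_all.mpr fun i => eventually_mem_radical_span (hs.eqn i)).and
    ((eventually_all.mpr fun i => eventually_all.mpr fun j =>
      eventually_mem_radical_span (hs.minor i j)).and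
    ((eventually_all.mpr fun j => eventually_mem_radical_span (hs.col j)).and
    (eventually_all.mpr fun i => eventually_mem_radical_span (hsm i))))))).exists
  choose f' hf' using hf'
  have hinj : Function.Injective (algebraMap (Algebra.adjoin ℤ (s : Set K)) K) :=
      Subtype.val_injective
  have hs' : IsSegreSystem F' f' :=
    { eqn := fun i => heqn i _ _ (fun _ => by rw [MvPolynomial.map_rename, hF'])
        (by rw [map_segreParam, hf'])
      minor := fun i j => hminor i j _ _ hf' (map_segreMinor _ i j)
      col := fun j => hcol j _ _ hf' (by rw [map_segreCol, hF']) }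
  have hjac' : ∀ i, MvPolynomial.X i ∈ (Ideal.span (Set.range (jacobianFamily F'))).radical :=
    fun i => hjac i _ _ (fun o => by rw [map_jacobianFamily, hF']) (MvPolynomial.map_X _ i)
  have hhom : F'.IsHomogeneous d := .of_map hinj (by rwa [hF'])
  have hcoeff : F'.coeff (Finsupp.single 0 d) = 1 := hinj (by
    rw [← MvPolynomial.coeff_map, hF', hc, map_one])
  have : Algebra.FiniteType ℤ (Algebra.adjoin ℤ (s : Set K)) :=
    (Algebra.adjoin ℤ (s : Set K)).fg_iff_finiteType.mp (Subalgebra.fg_adjoin_finset s)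
  obtain ⟨p, _, L, _, _, _, ⟨φ⟩⟩ := exists_ringHom_isAlgClosed_charP
    (Algebra.adjoin ℤ (s : Set K))
  have hsL := hs'.map φ
  refine false_of_three_equations_of_charP p (hhom.map φ)
    (by rw [MvPolynomial.coeff_map, hcoeff, map_one]) hd ?_ _ (fun i => ?_) hsL.minor hsL.col
  · rintro v hv ⟨h0, h1⟩
    refine hv (funext fun i => ?_)
    obtain ⟨n, hn⟩ := map_mem_radical_jacobianFamily φ (hjac' i)
    have := map_eq_zero_of_mem_span (MvPolynomial.aeval v : _ →ₐ[L] L).toRingHom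
      (f := jacobianFamily (MvPolynomial.map φ F')) (by
        rintro (_ | j)
        · exact h0
        · exact h1 j) hn
    have hv0 : v i ^ n = 0 := by simpa using this
    exact eq_zero_of_pow_eq_zero hv0
  · obtain ⟨N, hN⟩ := hsL.eqn i
    refine ⟨N, ?_⟩
    rw [Set.range_const, Ideal.mem_span_singleton] at hN
    exact hN

end Descent

section Shear

theorem aeval_single_one_form {K : Type*} [CommRing K] {F : MvPolynomial (Fin 3) K} {d : ℕ}
    (hF : F.IsHomogeneous d) :
    aeval (Pi.single 0 1 : Fin 3 → K) F = F.coeff (Finsupp.single 0 d) := by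
  rw [aeval_def, eval₂_eq', Finset.sum_eq_single (Finsupp.single 0 d)]
  · simp [Fin.prod_univ_three]
  · intro m hm hne
    have hdeg := hF (mem_support_iff.1 hm)
    rw [Finsupp.weight_apply, Finsupp.sum_fintype _ _ (by simp), Fin.sum_univ_three] at hdeg
    simp only [Pi.one_apply, smul_eq_mul, mul_one] at hdeg
    have h12 : m 1 ≠ 0 ∨ m 2 ≠ 0 := by
      by_contra! h
      refine hne (Finsupp.ext fun i => ?_)
      fin_cases i
      · simpa [h.1, h.2] using hdeg
      · simpa using h.1
      · simpa using h.2
    rcases h12 with h | h <;> simp [Fin.prod_univ_three, h]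
  · intro h
    simp [notMem_support_iff.1 h]

theorem exists_aeval_eq_one {K : Type*} [Field K] [IsAlgClosed K] {F : MvPolynomial (Fin 3) K}
    {d : ℕ} (hF : F.IsHomogeneous d) (hd : d ≠ 0) (hF0 : F ≠ 0) :
    ∃ q : Fin 3 → K, q 0 ≠ 0 ∧ aeval q F = 1 := by
  obtain ⟨q, hq⟩ : ∃ q : Fin 3 → K, aeval q (F * X 0) ≠ 0 := by
    by_contra! h
    refine mul_ne_zero hF0 (X_ne_zero 0) (MvPolynomial.funext fun x => ?_)
    rw [map_zero]
    exact h x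
  rw [map_mul, aeval_X] at hq
  obtain ⟨c, hc⟩ := IsAlgClosed.exists_pow_nat_eq (aeval q F)⁻¹ (Nat.pos_of_ne_zero hd)
  have hc0 : c ≠ 0 := by
    rintro rfl
    rw [zero_pow hd] at hc
    exact inv_ne_zero (left_ne_zero_of_mul hq) hc.symm
  refine ⟨fun i => c * q i, mul_ne_zero hc0 (right_ne_zero_of_mul hq), ?_⟩
  rw [hF.aeval_mul_left, hc, inv_mul_cancel₀ (left_ne_zero_of_mul hq)]

theorem X_mem_radical_jacobianFamily {K : Type*} [Field K] [IsAlgClosed K]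
    {F : MvPolynomial (Fin 3) K}
    (hsm : ∀ v : Fin 3 → K, v ≠ 0 → ¬(aeval v F = 0 ∧ ∀ i, aeval v (pderiv i F) = 0))
    (i : Fin 3) : X i ∈ (Ideal.span (Set.range (jacobianFamily F))).radical := by
  rw [← vanishingIdeal_zeroLocus_eq_radical (K := K), zeroLocus_span, mem_vanishingIdeal_iff]
  intro v hv
  have hv0 : v = 0 := by
    by_contra h
    exact hsm v h ⟨hv _ ⟨none, rfl⟩, fun i => hv _ ⟨some i, rfl⟩⟩
  simp [hv0]

variable {K : Type*} [Field K] (r : Fin 3 → K)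

/-- The substitution `x_i ↦ x_i + r_i x_0`. -/
noncomputable def shearForm : MvPolynomial (Fin 3) K →ₐ[K] MvPolynomial (Fin 3) K :=
  aeval fun i => X i + C (r i) * X 0

/-- The substitution `z_{ij} ↦ z_{ij} + r_i z_{0j}`. -/
noncomputable def shearSegre :
    MvPolynomial (Fin 3 × Fin 2) K →ₐ[K] MvPolynomial (Fin 3 × Fin 2) K :=
  aeval fun v => X v + C (r v.1) * X (0, v.2)

/-- The substitution `x_i ↦ x_i + r_i x_0`, `y_j ↦ y_j`. -/
noncomputable def shearProd :
    MvPolynomial (Fin 3 ⊕ Fin 2) K →ₐ[K] MvPolynomial (Fin 3 ⊕ Fin 2) K :=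
  aeval (Sum.elim (fun i => X (Sum.inl i) + C (r i) * X (Sum.inl 0)) fun j => X (Sum.inr j))

theorem shearForm_isHomogeneous {F : MvPolynomial (Fin 3) K} {d : ℕ} (hF : F.IsHomogeneous d) :
    (shearForm r F).IsHomogeneous d := by
  have := hF.aeval (fun i => X i + C (r i) * X 0) (n := 1) fun i =>
    (isHomogeneous_X K i).add (by simpa using (isHomogeneous_C _ (r i)).mul (isHomogeneous_X K 0))
  rwa [one_mul] at this

theorem aeval_shearForm (v : Fin 3 → K) (F : MvPolynomial (Fin 3) K) :
    aeval v (shearForm r F) = aeval (fun i => v i + r i * v 0) F := by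
  refine (aeval_aeval _ _ F).trans ?_
  simp

theorem aeval_pderiv_shearForm (v : Fin 3 → K) (F : MvPolynomial (Fin 3) K) (j : Fin 3) :
    aeval v (pderiv j (shearForm r F)) = ∑ i, aeval (fun i => v i + r i * v 0) (pderiv i F) *
      aeval v (pderiv j (X i + C (r i) * X 0)) := by
  rw [shearForm, Derivation.aeval_eq_sum_pderiv, map_sum]
  refine Finset.sum_congr rfl fun i _ => ?_
  rw [map_mul]
  congr 1
  exact aeval_shearForm r v _

variable {r}

theorem shearForm_smooth (hr : 1 + r 0 ≠ 0) {F : MvPolynomial (Fin 3) K}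
    (hsm : ∀ v : Fin 3 → K, v ≠ 0 → ¬(aeval v F = 0 ∧ ∀ i, aeval v (pderiv i F) = 0))
    (v : Fin 3 → K) (hv : v ≠ 0) :
    ¬(aeval v (shearForm r F) = 0 ∧ ∀ i, aeval v (pderiv i (shearForm r F)) = 0) := by
  rintro ⟨h, h'⟩
  rw [aeval_shearForm] at h
  simp only [aeval_pderiv_shearForm] at h'
  refine hsm (fun i => v i + r i * v 0) (fun h0 => hv ?_) ⟨h, ?_⟩
  · have h00 : v 0 = 0 := by
      have : v 0 + r 0 * v 0 = 0 := congrFun h0 0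
      have : (1 + r 0) * v 0 = 0 := by rw [← this]; ring
      exact (mul_eq_zero.mp this).resolve_left hr
    funext i
    simpa [h00] using congrFun h0 i
  · set G : Fin 3 → K := fun i => aeval (fun i => v i + r i * v 0) (pderiv i F) with hG
    have h1 : G 1 = 0 := by simpa [hG, Fin.sum_univ_three, pderiv_X, Pi.single_apply] using h' 1
    have h2 : G 2 = 0 := by simpa [hG, Fin.sum_univ_three, pderiv_X, Pi.single_apply] using h' 2
    have h3 : G 0 * (1 + r 0) + G 1 * r 1 + G 2 * r 2 = 0 := by
      simpa [hG, Fin.sum_univ_three, pderiv_X, Pi.single_apply] using h' 0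
    have h0 : G 0 = 0 := by
      rw [h1, h2] at h3
      simpa [hr] using h3
    intro i
    fin_cases i
    exacts [h0, h1, h2]

theorem segreCol_shearForm (F : MvPolynomial (Fin 3) K) (j : Fin 2) :
    segreCol (shearForm r F) j = shearSegre r (segreCol F j) := by
  refine (aeval_aeval _ _ F).trans ((aeval_aeval _ _ F).trans ?_).symm
  congr 2
  funext i
  simp

theorem X_eq_shearSegre_sub (hr : 1 + r 0 ≠ 0) (i : Fin 3) (j : Fin 2) :
    (X (i, j) : MvPolynomial (Fin 3 × Fin 2) K) =
      shearSegre r (X (i, j)) - C (r i / (1 + r 0)) * shearSegre r (X (0, j)) := by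
  have h : C (r i / (1 + r 0)) * (1 + C (r 0)) = (C (r i) : MvPolynomial (Fin 3 × Fin 2) K) := by
    rw [← C_1, ← C_add, ← C_mul, div_mul_cancel₀ _ hr]
  simp only [shearSegre, aeval_X]
  linear_combination X (0, j) * h

theorem segreMinor_eq_shearSegre (hr : 1 + r 0 ≠ 0) (i j : Fin 3) :
    segreMinor K i j = shearSegre r (segreMinor K i j) -
      C (r j / (1 + r 0)) * shearSegre r (segreMinor K i 0) -
      C (r i / (1 + r 0)) * shearSegre r (segreMinor K 0 j) := by
  have h : segreMinor K i j = X (i, 0) * X (j, 1) - X (j, 0) * X (i, 1) := rfl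
  rw [h]
  simp only [segreMinor, map_sub, map_mul]
  linear_combination (X (j, 1)) * X_eq_shearSegre_sub hr i 0 + (shearSegre r (X (i, 0)) -
    C (r i / (1 + r 0)) * shearSegre r (X (0, 0))) * X_eq_shearSegre_sub hr j 1 -
    (X (i, 1)) * X_eq_shearSegre_sub hr j 0 - (shearSegre r (X (j, 0)) -
    C (r j / (1 + r 0)) * shearSegre r (X (0, 0))) * X_eq_shearSegre_sub hr i 1

theorem segreParam_shearSegre (g : MvPolynomial (Fin 3 × Fin 2) K) :
    segreParam K (shearSegre r g) = shearProd r (segreParam K g) := by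
  refine (aeval_aeval _ _ g).trans ((aeval_aeval _ _ g).trans ?_).symm
  congr 2
  funext v
  simp
  ring

theorem rename_shearForm (F : MvPolynomial (Fin 3) K) :
    rename (Sum.inl : Fin 3 → Fin 3 ⊕ Fin 2) (shearForm r F) =
      shearProd r (rename (Sum.inl : Fin 3 → Fin 3 ⊕ Fin 2) F) := by
  have : ((rename (Sum.inl : Fin 3 → Fin 3 ⊕ Fin 2)).comp (shearForm r)) =
      (shearProd r).comp (rename (Sum.inl : Fin 3 → Fin 3 ⊕ Fin 2)) :=
    algHom_ext fun i => by simp [shearForm, shearProd]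
  exact DFunLike.congr_fun this F

theorem IsSegreSystem.shear (hr : 1 + r 0 ≠ 0) {F : MvPolynomial (Fin 3) K}
    {f : Fin 3 → MvPolynomial (Fin 3 × Fin 2) K} (h : IsSegreSystem F f) :
    IsSegreSystem (shearForm r F) fun i => shearSegre r (f i) where
  eqn i := by
    rw [segreParam_shearSegre, rename_shearForm]
    exact map_mem_radical_span (shearProd r).toRingHom _ (h.eqn i)
  minor i j := by
    have key : ∀ i j, shearSegre r (segreMinor K i j) ∈
        (Ideal.span (Set.range fun i => shearSegre r (f i))).radical := fun i j =>
      map_mem_radical_span (shearSegre r).toRingHom _ (h.minor i j)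
    rw [segreMinor_eq_shearSegre hr]
    exact Ideal.sub_mem _ (Ideal.sub_mem _ (key _ _) (Ideal.mul_mem_left _ _ (key _ _)))
      (Ideal.mul_mem_left _ _ (key _ _))
  col j := by
    rw [segreCol_shearForm]
    exact map_mem_radical_span (shearSegre r).toRingHom _ (h.col j)

/-- The Segre product of a smooth plane curve of degree at least three with the projective line is
not cut out by three equations. -/
theorem IsSegreSystem.false_of_smooth [IsAlgClosed K] {d : ℕ} (hd : 3 ≤ d)
    {F : MvPolynomial (Fin 3) K} {f : Fin 3 → MvPolynomial (Fin 3 × Fin 2) K}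
    (hF : F.IsHomogeneous d) (hs : IsSegreSystem F f)
    (hsm : ∀ v : Fin 3 → K, v ≠ 0 → ¬(aeval v F = 0 ∧ ∀ i, aeval v (pderiv i F) = 0)) :
    False := by
  have hF0 : F ≠ 0 := by
    rintro rfl
    exact hsm 1 one_ne_zero ⟨map_zero _, fun i => by simp⟩
  obtain ⟨q, hq0, hq⟩ := exists_aeval_eq_one hF (by omega) hF0
  have hr : 1 + (q - Pi.single 0 1 : Fin 3 → K) 0 ≠ 0 := by simpa using hq0
  refine (hs.shear hr).false_of_coeff_eq_one hd (shearForm_isHomogeneous _ hF) ?_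
    (X_mem_radical_jacobianFamily (shearForm_smooth hr hsm))
  rw [← aeval_single_one_form (shearForm_isHomogeneous _ hF), aeval_shearForm]
  refine Eq.trans ?_ hq
  congr 2
  funext i
  simp

end Shear

section Geometry

open Matrix

variable {K : Type*} [Field K] {v w : Fin 3 → K}

theorem exists_eq_smul_add_smul_of_dotProduct_crossProduct {i : Fin 3}
    (hi : crossProduct v w i ≠ 0) {u : Fin 3 → K} (hu : crossProduct v w ⬝ᵥ u = 0) :
    ∃ a b : K, u = a • v + b • w := by
  refine ⟨(crossProduct v w i)⁻¹ * crossProduct u w i,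
    (crossProduct v w i)⁻¹ * crossProduct v u i, funext fun j => ?_⟩
  have key : crossProduct v w i * u j = crossProduct u w i * v j + crossProduct v u i * w j +
      (crossProduct v w ⬝ᵥ u) * (Pi.single i 1 : Fin 3 → K) j := by
    fin_cases i <;> fin_cases j <;>
      simp [cross_apply, dotProduct, Fin.sum_univ_three] <;> ring
  rw [hu, zero_mul, add_zero] at key
  simp only [Pi.add_apply, Pi.smul_apply, smul_eq_mul]
  rw [← mul_right_inj' hi, key]
  field_simp

/-- If the line spanned by `v` and `w` meets `V` in a single point, then the pairs of proportional
vectors of `V` are cut out by the equations `(n ⬝ A) B = (n ⬝ B) A`, where `n` is orthogonal to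
that line. -/
theorem exists_common_direction {V : Set (Fin 3 → K)} {p : Fin 3 → K} {i : Fin 3}
    (hi : crossProduct v w i ≠ 0)
    (hV : ∀ a b : K, ¬(a = 0 ∧ b = 0) → a • v + b • w ∈ V → ∃ c : K, c ≠ 0 ∧
      a • v + b • w = c • p)
    {A B : Fin 3 → K} (hA : A ∈ V) (hB : B ∈ V)
    (h : (crossProduct v w ⬝ᵥ A) • B = (crossProduct v w ⬝ᵥ B) • A) :
    ∃ u ∈ V, ∃ s t : K, A = s • u ∧ B = t • u := by
  have hline : ∀ u ∈ V, crossProduct v w ⬝ᵥ u = 0 → u ≠ 0 → ∃ c : K, c ≠ 0 ∧ u = c • p := by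
    intro u huV hu hu0
    obtain ⟨a, b, rfl⟩ := exists_eq_smul_add_smul_of_dotProduct_crossProduct hi hu
    refine hV a b ?_ huV
    rintro ⟨rfl, rfl⟩
    simp at hu0
  by_cases hnA : crossProduct v w ⬝ᵥ A = 0
  · by_cases hnB : crossProduct v w ⬝ᵥ B = 0
    · by_cases hA0 : A = 0
      · exact ⟨B, hB, 0, 1, by simp [hA0], by simp⟩
      · by_cases hB0 : B = 0
        · exact ⟨A, hA, 1, 0, by simp, by simp [hB0]⟩
        · obtain ⟨c, hc, hAc⟩ := hline A hA hnA hA0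
          obtain ⟨c', -, hBc⟩ := hline B hB hnB hB0
          exact ⟨A, hA, 1, c' / c, by simp, by rw [hBc, hAc, smul_smul, div_mul_cancel₀ _ hc]⟩
    · refine ⟨B, hB, 0, 1, ?_, by simp⟩
      rw [hnA, zero_smul, eq_comm, smul_eq_zero] at h
      simpa using h.resolve_left hnB
  · refine ⟨A, hA, 1, (crossProduct v w ⬝ᵥ B) / (crossProduct v w ⬝ᵥ A), by simp, ?_⟩
    rw [div_eq_inv_mul, mul_smul, ← h, smul_smul, inv_mul_cancel₀ hnA, one_smul]

end Geometry

section SegreIdeal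

variable {k : Type*} [Field k] {F : MvPolynomial (Fin 3) k}

theorem aeval_mk_eq {σ τ : Type*} (J : Ideal (MvPolynomial τ k)) (f : σ → MvPolynomial τ k)
    (g : MvPolynomial σ k) :
    aeval (fun i => Ideal.Quotient.mk J (f i)) g = Ideal.Quotient.mk J (aeval f g) :=
  (comp_aeval_apply f (Ideal.Quotient.mkₐ k J) g).symm

theorem mem_segreIdeal_iff {g : MvPolynomial (Fin 3 × Fin 2) k} :
    g ∈ segreIdeal k 2 1 (Ideal.span {F}) ⊥ ↔
      rename (Sum.inl : Fin 3 → Fin 3 ⊕ Fin 2) F ∣ segreParam k g := by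
  have hJ : (Ideal.span {F}).map (rename (R := k) (Sum.inl : Fin 3 → Fin 3 ⊕ Fin 2)) ⊔
      (⊥ : Ideal (MvPolynomial (Fin 2) k)).map
        (rename (R := k) (Sum.inr : Fin 2 → Fin 3 ⊕ Fin 2)) =
      Ideal.span {rename (Sum.inl : Fin 3 → Fin 3 ⊕ Fin 2) F} := by
    rw [Ideal.map_bot, sup_bot_eq, Ideal.map_span, Set.image_singleton]
  rw [← Ideal.mem_span_singleton, ← hJ, segreIdeal, RingHom.mem_ker]
  refine Iff.trans (Eq.congr_left ?_) Ideal.Quotient.eq_zero_iff_mem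
  exact aeval_mk_eq _ _ g

theorem segreMinor_mem_segreIdeal (i j : Fin 3) :
    segreMinor k i j ∈ segreIdeal k 2 1 (Ideal.span {F}) ⊥ := by
  rw [mem_segreIdeal_iff]
  convert dvd_zero _
  simp only [segreMinor, segreParam, map_sub, map_mul, aeval_X]
  ring

theorem segreCol_mem_segreIdeal {d : ℕ} (hF : F.IsHomogeneous d) (j : Fin 2) :
    segreCol F j ∈ segreIdeal k 2 1 (Ideal.span {F}) ⊥ := by
  rw [mem_segreIdeal_iff]
  have : segreParam k (segreCol F j) =
      X (Sum.inr j) ^ d * rename (Sum.inl : Fin 3 → Fin 3 ⊕ Fin 2) F := by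
    rw [segreCol, segreParam, aeval_aeval]
    simp only [aeval_X]
    simp_rw [mul_comm (X (Sum.inl _))]
    rw [hF.aeval_mul_left, rename_eq_aeval]
    rfl
  exact this ▸ dvd_mul_left _ _

theorem not_exists_three_generators {d : ℕ} (hd : 3 ≤ d) (hF : F.IsHomogeneous d)
    (hsm : IsSmoothHypersurface F) {t : ℕ} (ht : t ≤ 3)
    (f : Fin t → MvPolynomial (Fin 3 × Fin 2) k)
    (hf : (Ideal.span (Set.range f)).radical =
      (segreIdeal k 2 1 (Ideal.span {F}) ⊥).radical) : False := by
  let f' : Fin 3 → MvPolynomial (Fin 3 × Fin 2) k :=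
    fun i => if h : i.1 < t then f ⟨i.1, h⟩ else 0
  have hle : Ideal.span (Set.range f) ≤ Ideal.span (Set.range f') := by
    refine Ideal.span_mono ?_
    rintro _ ⟨i, rfl⟩
    exact ⟨⟨i.1, i.2.trans_le ht⟩, by simp [f']⟩
  have hI : segreIdeal k 2 1 (Ideal.span {F}) ⊥ ≤ (Ideal.span (Set.range f')).radical :=
    Ideal.le_radical.trans (hf.symm.le.trans (Ideal.radical_mono hle))
  have hs : IsSegreSystem F f' :=
    { eqn := fun i => by
        have hmem : f' i ∈ (segreIdeal k 2 1 (Ideal.span {F}) ⊥).radical := by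
          by_cases h : i.1 < t
          · simp only [f', h, dif_pos, ← hf]
            exact Ideal.le_radical (Ideal.subset_span ⟨_, rfl⟩)
          · simp [f', h]
        obtain ⟨N, hN⟩ := hmem
        refine ⟨N, ?_⟩
        rw [Set.range_const, Ideal.mem_span_singleton, ← map_pow]
        exact mem_segreIdeal_iff.1 hN
      minor := fun i j => hI (segreMinor_mem_segreIdeal i j)
      col := fun j => hI (segreCol_mem_segreIdeal hF j) }
  refine (hs.map (algebraMap k (AlgebraicClosure k))).false_of_smooth hd (hF.map _)
    fun v hv h => hsm v hv ⟨h.1, fun i => ?_⟩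
  rw [← pderiv_map]
  exact h.2 i

end SegreIdeal

section FourEquations

variable {k : Type*} [Field k] {F : MvPolynomial (Fin 3) k}

/-- The `i`-th coordinate of `(n ⬝ A) B - (n ⬝ B) A`, where `A` and `B` are the columns of the
generic matrix. -/
noncomputable def segrePencil (n : Fin 3 → k) (i : Fin 3) : MvPolynomial (Fin 3 × Fin 2) k :=
  ∑ l, C (n l) * segreMinor k l i

theorem segreMinor_isHomogeneous (i j : Fin 3) : (segreMinor k i j).IsHomogeneous 2 :=
  ((isHomogeneous_X _ _).mul (isHomogeneous_X _ _)).sub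
    ((isHomogeneous_X _ _).mul (isHomogeneous_X _ _))

theorem segrePencil_isHomogeneous (n : Fin 3 → k) (i : Fin 3) :
    (segrePencil n i).IsHomogeneous 2 :=
  IsHomogeneous.sum _ _ _ fun l _ => by
    simpa using (isHomogeneous_C _ (n l)).mul (segreMinor_isHomogeneous l i)

theorem segreCol_isHomogeneous {d : ℕ} (hF : F.IsHomogeneous d) (j : Fin 2) :
    (segreCol F j).IsHomogeneous d := by
  have := hF.aeval (fun i => X (i, j)) fun i => isHomogeneous_X k (i, j)
  rwa [one_mul] at this

theorem segrePencil_mem_segreIdeal (n : Fin 3 → k) (i : Fin 3) :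
    segrePencil n i ∈ segreIdeal k 2 1 (Ideal.span {F}) ⊥ :=
  Ideal.sum_mem _ fun l _ => Ideal.mul_mem_left _ _ (segreMinor_mem_segreIdeal l i)

theorem sum_C_mul_segrePencil (n : Fin 3 → k) : ∑ i, C (n i) * segrePencil n i = 0 := by
  simp only [segrePencil, segreMinor, Fin.sum_univ_three]
  ring

theorem aeval_segrePencil {K : Type*} [Field K] [Algebra k K] (n : Fin 3 → k) (i : Fin 3)
    (z : Fin 3 × Fin 2 → K) :
    aeval z (segrePencil n i) =
      ((algebraMap k K ∘ n) ⬝ᵥ fun l => z (l, 0)) * z (i, 1) -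
        ((algebraMap k K ∘ n) ⬝ᵥ fun l => z (l, 1)) * z (i, 0) := by
  simp only [segrePencil, segreMinor, dotProduct, Fin.sum_univ_three, map_add, map_sub, map_mul,
    aeval_X, Function.comp_apply, algHom_C]
  ring

/-- The two values of the form `F` at the columns, and two equations of the pencil. -/
noncomputable def segreFour (F : MvPolynomial (Fin 3) k) (n : Fin 3 → k) (i₀ : Fin 3) :
    Fin 4 → MvPolynomial (Fin 3 × Fin 2) k :=
  ![segreCol F 0, segreCol F 1, segrePencil n (i₀.succAbove 0), segrePencil n (i₀.succAbove 1)]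

theorem segreFour_isHomogeneous {d : ℕ} (hF : F.IsHomogeneous d) (n : Fin 3 → k) (i₀ : Fin 3)
    (i : Fin 4) : ∃ e, (segreFour F n i₀ i).IsHomogeneous e := by
  fin_cases i
  exacts [⟨d, segreCol_isHomogeneous hF 0⟩, ⟨d, segreCol_isHomogeneous hF 1⟩,
    ⟨2, segrePencil_isHomogeneous n _⟩, ⟨2, segrePencil_isHomogeneous n _⟩]

theorem segreFour_mem_segreIdeal {d : ℕ} (hF : F.IsHomogeneous d) (n : Fin 3 → k) (i₀ : Fin 3)
    (i : Fin 4) : segreFour F n i₀ i ∈ segreIdeal k 2 1 (Ideal.span {F}) ⊥ := by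
  fin_cases i
  exacts [segreCol_mem_segreIdeal hF 0, segreCol_mem_segreIdeal hF 1,
    segrePencil_mem_segreIdeal n _, segrePencil_mem_segreIdeal n _]

theorem aeval_segrePencil_eq_zero {K : Type*} [Field K] [Algebra k K] {n : Fin 3 → k} {i₀ : Fin 3}
    (hi₀ : n i₀ ≠ 0) {z : Fin 3 × Fin 2 → K}
    (hz : ∀ i, aeval z (segrePencil n (i₀.succAbove i)) = 0) (i : Fin 3) :
    aeval z (segrePencil n i) = 0 := by
  refine Fin.succAboveCases i₀ ?_ hz i
  have := congrArg (aeval z) (sum_C_mul_segrePencil n)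
  rw [Fin.sum_univ_succAbove _ i₀] at this
  simpa [hz, hi₀] using this

theorem radical_span_segreFour {d : ℕ} (hF : F.IsHomogeneous d) {v w : Fin 3 → k} {i₀ : Fin 3}
    (hi₀ : crossProduct v w i₀ ≠ 0) {p : Fin 3 → AlgebraicClosure k}
    (hL : ∀ a b : AlgebraicClosure k, ¬(a = 0 ∧ b = 0) →
      aeval (a • (algebraMap k (AlgebraicClosure k) ∘ v) +
        b • (algebraMap k (AlgebraicClosure k) ∘ w)) F = 0 →
      ∃ c : AlgebraicClosure k, c ≠ 0 ∧
        a • (algebraMap k (AlgebraicClosure k) ∘ v) +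
          b • (algebraMap k (AlgebraicClosure k) ∘ w) = c • p) :
    (Ideal.span (Set.range (segreFour F (crossProduct v w) i₀))).radical =
      (segreIdeal k 2 1 (Ideal.span {F}) ⊥).radical := by
  refine le_antisymm (Ideal.radical_mono (Ideal.span_le.2 ?_))
    (Ideal.radical_le_radical_iff.2 fun g hg => ?_)
  · rintro _ ⟨i, rfl⟩
    exact segreFour_mem_segreIdeal hF _ _ i
  rw [← vanishingIdeal_zeroLocus_eq_radical (K := AlgebraicClosure k), mem_vanishingIdeal_iff]
  intro z hz
  rw [zeroLocus_span] at hz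
  have hz' : ∀ i, aeval z (segreFour F (crossProduct v w) i₀ i) = 0 := fun i => hz _ ⟨i, rfl⟩
  have hcross : crossProduct (algebraMap k (AlgebraicClosure k) ∘ v)
      (algebraMap k (AlgebraicClosure k) ∘ w) =
      algebraMap k (AlgebraicClosure k) ∘ crossProduct v w := by
    funext i
    fin_cases i <;> simp [cross_apply]
  have hpencil := aeval_segrePencil_eq_zero hi₀ (z := z) fun i => by
    fin_cases i
    exacts [hz' 2, hz' 3]
  have hcol : ∀ j, aeval (fun i => z (i, j)) F = 0 := fun j => by
    have : aeval z (segreCol F j) = 0 := by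
      fin_cases j
      exacts [hz' 0, hz' 1]
    rw [segreCol, aeval_aeval] at this
    simpa only [aeval_X] using this
  obtain ⟨u, hu, s, t, hs, ht⟩ := exists_common_direction (V := {u | aeval u F = 0})
    (i := i₀) (by simpa [hcross] using hi₀) hL (hcol 0) (hcol 1) (by
      rw [hcross]
      funext i
      simpa [aeval_segrePencil, sub_eq_zero] using hpencil i)
  have hzu : z = fun q => aeval (Sum.elim u ![s, t]) (X (Sum.inl q.1) * X (Sum.inr q.2) :
      MvPolynomial (Fin 3 ⊕ Fin 2) k) := by
    funext ⟨i, j⟩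
    fin_cases j
    · simpa [mul_comm] using congrFun hs i
    · simpa [mul_comm] using congrFun ht i
  obtain ⟨q, hq⟩ := mem_segreIdeal_iff.1 hg
  have := congrArg (aeval (Sum.elim u ![s, t])) hq
  rw [segreParam, aeval_aeval, ← hzu, map_mul, aeval_rename, Sum.elim_comp_inl] at this
  rw [this, hu, zero_mul]

end FourEquations

theorem ara_smooth_plane_curve_with_total_tangent_line_prod_P1
    (k : Type*) [Field k] (d : ℕ) (hd : 3 ≤ d)
    (F : MvPolynomial (Fin 3) k) (hF : F.IsHomogeneous d)
    (hsm : IsSmoothHypersurface F)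
    -- the line `L`, spanned by `v` and `w`:
    (v w : Fin 3 → k) (hvw : LinearIndependent k ![v, w])
    -- the point `P`:
    (p : Fin 3 → AlgebraicClosure k) (hp : p ≠ 0)
    (hpL : ∃ a b : AlgebraicClosure k,
      p = a • (algebraMap k (AlgebraicClosure k) ∘ v)
        + b • (algebraMap k (AlgebraicClosure k) ∘ w))
    -- `L` meets `X` exactly at the point `P` (over the algebraic closure):
    (hLX : ∀ a b : AlgebraicClosure k, ¬(a = 0 ∧ b = 0) →
      (MvPolynomial.eval
          (a • (algebraMap k (AlgebraicClosure k) ∘ v)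
            + b • (algebraMap k (AlgebraicClosure k) ∘ w))
          (F.map (algebraMap k (AlgebraicClosure k))) = 0
        ↔ ∃ c : AlgebraicClosure k, c ≠ 0 ∧
            a • (algebraMap k (AlgebraicClosure k) ∘ v)
              + b • (algebraMap k (AlgebraicClosure k) ∘ w) = c • p)) :
    araH (segreIdeal k 2 1 (Ideal.span {F}) ⊥) = 4 ∧
    (CharZero k →
      ara (segreIdeal k 2 1 (Ideal.span {F}) ⊥) = 4 ∧
      ara (segreIdeal k 2 1 (Ideal.span {F}) ⊥)
        = araH (segreIdeal k 2 1 (Ideal.span {F}) ⊥)) ∧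
    araH (segreIdeal k 2 1 (Ideal.span {F}) ⊥) ≠ 3 := by
  obtain ⟨i₀, hi₀⟩ := Function.ne_iff.1 (crossProduct_ne_zero_iff_linearIndependent.2 hvw)
  set I := segreIdeal k 2 1 (Ideal.span {F}) ⊥
  have hmem : (4 : ℕ) ∈ {t | ∃ f : Fin t → MvPolynomial (Fin 3 × Fin 2) k,
      (∀ i, ∃ d, (f i).IsHomogeneous d) ∧ (Ideal.span (Set.range f)).radical = I.radical} := by
    refine ⟨segreFour F (crossProduct v w) i₀, segreFour_isHomogeneous hF _ _,
      radical_span_segreFour (p := p) hF hi₀ fun a b hab h => (hLX a b hab).1 ?_⟩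
    rwa [eval_map, ← aeval_def]
  have hmem' : (4 : ℕ) ∈ {t | ∃ f : Fin t → MvPolynomial (Fin 3 × Fin 2) k,
      (Ideal.span (Set.range f)).radical = I.radical} := by
    obtain ⟨f, -, hf⟩ := hmem
    exact ⟨f, hf⟩
  have harah : araH I = 4 := by
    refine le_antisymm (Nat.sInf_le hmem) ?_
    obtain ⟨f, -, hf⟩ := Nat.sInf_mem ⟨4, hmem⟩
    by_contra! hlt
    exact not_exists_three_generators hd hF hsm (Nat.lt_succ_iff.1 hlt) f hf
  have hara : ara I = 4 := by
    refine le_antisymm (Nat.sInf_le hmem') ?_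
    obtain ⟨f, hf⟩ := Nat.sInf_mem ⟨4, hmem'⟩
    by_contra! hlt
    exact not_exists_three_generators hd hF hsm (Nat.lt_succ_iff.1 hlt) f hf
  exact ⟨harah, fun _ => ⟨hara, hara.trans harah.symm⟩, by omega⟩
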